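/- Let n ≥ 2. (1) If M ∈ M_{n−1}(k) is nilpotent with Jordan type a, a partition of n−1 (i.e., FS(M) = {(0,a)}), then lev(T_0^M) = lev(a). (2) If r ∈ {0,1}, M ∈ M_{n−1}(k) with FS(M) = {(λ_i,a^i)}_{1≤i≤l}, and either r = 1 or λ_i ≠ 0 for some i, then lev(T_r^M) = lev(Σ_{i=1}^l a^i) + 1. -/

import Mathlib

open scoped BigOperators

noncomputable section

/-- The space of `n`-dimensional (nonassociative) algebra structures on `kⁿ`:
bilinear maps `kⁿ × kⁿ → kⁿ`. -/
abbrev AlgStr (k : Type*) [Field k] (n : ℕ) : Type _ :=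
  (Fin n → k) →ₗ[k] (Fin n → k) →ₗ[k] (Fin n → k)

variable {k : Type*} [Field k]

/-- The algebra structure with prescribed structure constants `c`:
`μ(x, y) m = ∑ i, ∑ j, x i * y j * c i j m`. -/
def ofConst {n : ℕ} (c : Fin n → Fin n → Fin n → k) : AlgStr k n :=
  ∑ i, ∑ j,
    ((LinearMap.mul k k).compl₁₂ (LinearMap.proj i) (LinearMap.proj j)).compr₂
      (LinearMap.toSpanSingleton k (Fin n → k) (c i j))

/-- The structure constants of an algebra structure in the standard basis. -/
def structConst {n : ℕ} (μ : AlgStr k n) : Fin n × Fin n × Fin n → k :=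
  fun t => μ (Pi.single t.1 1) (Pi.single t.2.1 1) t.2.2

/-- A subset of `AlgStr k n` is Zariski closed if it is the common zero locus of a
family of polynomials in the structure constants. -/
def IsZariskiClosed {n : ℕ} (S : Set (AlgStr k n)) : Prop :=
  ∃ P : Set (MvPolynomial (Fin n × Fin n × Fin n) k),
    ∀ μ : AlgStr k n, μ ∈ S ↔ ∀ p ∈ P, MvPolynomial.eval (structConst μ) p = 0

/-- The action of `GL(V)` on algebra structures: `(g • μ)(x,y) = g (μ (g⁻¹ x) (g⁻¹ y))`. -/
def transport {n : ℕ} (g : (Fin n → k) ≃ₗ[k] (Fin n → k)) (μ : AlgStr k n) :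
    AlgStr k n :=
  ((μ.comp g.symm.toLinearMap).compl₂ g.symm.toLinearMap).compr₂ g.toLinearMap

/-- The `GL(V)`-orbit of an algebra structure; two structures represent isomorphic
algebras iff they lie in the same orbit. -/
def orbit {n : ℕ} (μ : AlgStr k n) : Set (AlgStr k n) :=
  {χ | ∃ g : (Fin n → k) ≃ₗ[k] (Fin n → k), transport g μ = χ}

/-- The Zariski closure of a set of algebra structures. -/
def zclosure {n : ℕ} (S : Set (AlgStr k n)) : Set (AlgStr k n) :=
  {χ | ∀ T : Set (AlgStr k n), IsZariskiClosed T → S ⊆ T → χ ∈ T}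

/-- `μ` degenerates to `χ` if `χ` lies in the Zariski closure of the orbit of `μ`. -/
def degenerates {n : ℕ} (μ χ : AlgStr k n) : Prop :=
  χ ∈ zclosure (orbit μ)

/-- A proper degeneration: additionally `χ` is not isomorphic to `μ`. -/
def properlyDegenerates {n : ℕ} (μ χ : AlgStr k n) : Prop :=
  degenerates μ χ ∧ χ ∉ orbit μ

/-- There is a chain of `m` proper degenerations starting at `μ`. -/
def hasChain {n : ℕ} (μ : AlgStr k n) (m : ℕ) : Prop :=
  ∃ c : ℕ → AlgStr k n, c m = μ ∧ ∀ i < m, properlyDegenerates (c (i + 1)) (c i)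

/-- The level of `μ` is `m`: there is a chain of `m` proper degenerations starting
at `μ` but no chain of `m+1`. -/
def levelIs {n : ℕ} (μ : AlgStr k n) (m : ℕ) : Prop :=
  hasChain μ m ∧ ¬ hasChain μ (m + 1)

/-- The subalgebra generated by a set `s`. -/
def subalgGen {n : ℕ} (μ : AlgStr k n) (s : Set (Fin n → k)) :
    Submodule k (Fin n → k) :=
  sInf {W | s ⊆ W ∧ ∀ x ∈ W, ∀ y ∈ W, μ x y ∈ W}

/-- The generation type of `μ` is `m`: `m` is the maximal dimension of a
one-generated subalgebra. -/
def genType {n : ℕ} (μ : AlgStr k n) (m : ℕ) : Prop :=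
  IsGreatest {d : ℕ | ∃ a : Fin n → k, Module.finrank k ↥(subalgGen μ {a}) = d} m

/-- A standard `1`-generated algebra: it admits a grading `A = ⊕_{i ≥ 1} A_i` with
`dim A_1 = 1`, `A_i A_j ⊆ A_{i+j}`, generated by `A_1` as an algebra. -/
def StandardOneGenerated {m : ℕ} (μ : AlgStr k m) : Prop :=
  ∃ A : ℕ → Submodule k (Fin m → k),
    A 0 = ⊥ ∧ DirectSum.IsInternal A ∧ Module.finrank k ↥(A 1) = 1 ∧
    (∀ i j : ℕ, ∀ x ∈ A i, ∀ y ∈ A j, μ x y ∈ A (i + j)) ∧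
    subalgGen μ ((A 1 : Submodule k (Fin m → k)) : Set (Fin m → k)) = ⊤

/-- Extension by zero of coordinates, `kᵐ → kⁿ`. -/
def inclMap (k : Type*) [Field k] {m n : ℕ} (h : m ≤ n) :
    (Fin m → k) →ₗ[k] (Fin n → k) where
  toFun x i := if hi : (i : ℕ) < m then x ⟨i, hi⟩ else 0
  map_add' x y := by funext i; by_cases hi : (i : ℕ) < m <;> simp [hi]
  map_smul' a x := by funext i; by_cases hi : (i : ℕ) < m <;> simp [hi]

/-- The `n`-dimensional algebra `B ⊕ k^{n-m}` obtained from an `m`-dimensional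
algebra `B` by adjoining a complement with all products zero. -/
def extendZero {m n : ℕ} (h : m ≤ n) (B : AlgStr k m) : AlgStr k n :=
  ((B.comp (LinearMap.funLeft k k (Fin.castLE h))).compl₂
      (LinearMap.funLeft k k (Fin.castLE h))).compr₂ (inclMap k h)

/-- The `i`-th standard basis vector (as a plain function, `0` if `i ≥ n`). -/
def unitVec {k : Type*} [Field k] (n i : ℕ) : Fin n → k :=
  fun j => if (j : ℕ) = i then 1 else 0

/-- Projection onto the coordinate `0` part. -/
def proj0 (k : Type*) [Field k] (n : ℕ) : (Fin n → k) →ₗ[k] (Fin n → k) :=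
  LinearMap.pi fun i => if (i : ℕ) = 0 then LinearMap.proj i else 0

/-- Projection onto the coordinates `≥ 1` part. -/
def projPos (k : Type*) [Field k] (n : ℕ) : (Fin n → k) →ₗ[k] (Fin n → k) :=
  LinearMap.pi fun i => if (i : ℕ) = 0 then 0 else LinearMap.proj i

/-- The Inönü–Wigner contraction of `μ` with respect to the `1`-dimensional
subalgebra spanned by the first basis vector (the remaining coordinates form the
square-zero ideal part). -/
def IWcontract0 {n : ℕ} (μ : AlgStr k n) : AlgStr k n :=
  ((μ.comp (projPos k n)).compl₂ (proj0 k n)).compr₂ (projPos k n) +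
    ((μ.comp (proj0 k n)).compl₂ (projPos k n)).compr₂ (projPos k n) +
    (μ.comp (proj0 k n)).compl₂ (proj0 k n)

/-- The annihilator of an algebra structure. -/
def annihilator {n : ℕ} (μ : AlgStr k n) : Submodule k (Fin n → k) where
  carrier := {a | ∀ b, μ a b = 0 ∧ μ b a = 0}
  add_mem' := by
    intro a b ha hb
    intro c
    constructor
    · rw [map_add, LinearMap.add_apply, (ha c).1, (hb c).1, add_zero]
    · rw [map_add, (ha c).2, (hb c).2, add_zero]
  zero_mem' := by
    intro b
    constructor
    · rw [map_zero, LinearMap.zero_apply]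
    · rw [map_zero]
  smul_mem' := by
    intro t a ha b
    constructor
    · rw [map_smul, LinearMap.smul_apply, (ha b).1, smul_zero]
    · rw [map_smul, (ha b).2, smul_zero]

/-- `μ` has a square-zero (two-sided) ideal of codimension `1`. -/
def hasSqZeroIdealCodim1 {n : ℕ} (μ : AlgStr k n) : Prop :=
  ∃ I : Submodule k (Fin n → k), Module.finrank k ↥I = n - 1 ∧
    (∀ x ∈ I, ∀ y : Fin n → k, μ x y ∈ I ∧ μ y x ∈ I) ∧
    ∀ x ∈ I, ∀ y ∈ I, μ x y = 0

/-- `a` (viewed as the sequence of parts `a 0 ≥ a 1 ≥ …`) is a partition of `N`. -/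
def IsPartitionOf (a : ℕ → ℕ) (N : ℕ) : Prop :=
  (∀ i j : ℕ, i ≤ j → a j ≤ a i) ∧
    ∃ l : ℕ, (∀ i, l ≤ i → a i = 0) ∧ ∑ i ∈ Finset.range l, a i = N

/-- The dominance order on partitions: `a ⪰ b`. -/
def Dominates (a b : ℕ → ℕ) : Prop :=
  ∀ m : ℕ, ∑ i ∈ Finset.range m, b i ≤ ∑ i ∈ Finset.range m, a i

/-- `a` is the Jordan type of the matrix `M` at the eigenvalue `lam`:
`a` is a partition of the generalized eigenspace dimension, and the parts of `a`
are the sizes of the Jordan blocks of `M` with eigenvalue `lam`, expressed via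
the ranks of powers of `M - lam • 1`. -/
def IsJordanTypeAt {N : ℕ} (M : Matrix (Fin N) (Fin N) k) (lam : k) (a : ℕ → ℕ) :
    Prop :=
  IsPartitionOf a (N - ((M - lam • (1 : Matrix (Fin N) (Fin N) k)) ^ N).rank) ∧
    ∀ p : ℕ, ((M - lam • (1 : Matrix (Fin N) (Fin N) k)) ^ p).rank =
      N - ∑ i ∈ Finset.range N, min (a i) p

/-- The full specter of `M` is `{(lam i, a i)}`: the `lam i` are pairwise distinct,
each `a i` is the (nonempty) Jordan type of `M` at `lam i`, and every eigenvalue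
of `M` occurs among the `lam i`. -/
def IsFullSpecter {N : ℕ} (M : Matrix (Fin N) (Fin N) k) {l : ℕ}
    (lam : Fin l → k) (a : Fin l → ℕ → ℕ) : Prop :=
  Function.Injective lam ∧
    (∀ i, IsJordanTypeAt M (lam i) (a i) ∧ a i 0 ≠ 0) ∧
    ∀ c : k, (∃ v : Fin N → k, v ≠ 0 ∧ M.mulVec v = c • v) → ∃ i, lam i = c

/-- There is a chain of `len` strict dominance steps of partitions of `N`
starting (on top) at `a`. -/
def partChain (a : ℕ → ℕ) (N len : ℕ) : Prop :=
  ∃ c : ℕ → ℕ → ℕ, (∀ i ≤ len, IsPartitionOf (c i) N) ∧ c len = a ∧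
    ∀ i < len, Dominates (c (i + 1)) (c i) ∧ c (i + 1) ≠ c i

/-- The structure `T_α^M ∈ A_{m+1}`. -/
def Tstr {m : ℕ} (α : k) (M : Matrix (Fin m) (Fin m) k) : AlgStr k (m + 1) :=
  ofConst fun i j mm =>
    if hi : i = 0 then
      if hj : j = 0 then (if mm = 0 then α else 0)
      else if hmm : mm = 0 then 0 else M (mm.pred hmm) (j.pred hj)
    else if hj : j = 0 then
      if hmm : mm = 0 then 0 else (if i = mm then α else 0) - M (mm.pred hmm) (i.pred hi)
    else 0

/-- The trivial singular extension `k^{n-2} ⋊_{(L₁,R₁,L₂,R₂)} χ` of the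
`2`-dimensional algebra `χ` given by the coefficients `c11, c12, c21, d12, d21, d22`
(with `χ(e₁,e₁) = c11·e₁ + e₂`, `χ(e₁,e₂) = c12·e₁ + d12·e₂`,
`χ(e₂,e₁) = c21·e₁ + d21·e₂`, `χ(e₂,e₂) = d22·e₂`). -/
def sdExt {m : ℕ} (c11 c12 c21 d12 d21 d22 : k)
    (L1 R1 L2 R2 : Matrix (Fin m) (Fin m) k) : AlgStr k (m + 2) :=
  ofConst fun i j mm =>
    if hi0 : (i : ℕ) = 0 then
      if hj0 : (j : ℕ) = 0 then
        if (mm : ℕ) = 0 then c11 else if (mm : ℕ) = 1 then 1 else 0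
      else if hj1 : (j : ℕ) = 1 then
        if (mm : ℕ) = 0 then c12 else if (mm : ℕ) = 1 then d12 else 0
      else if hmm : (mm : ℕ) < 2 then 0
      else L1 ⟨(mm : ℕ) - 2, by have := mm.isLt; omega⟩
             ⟨(j : ℕ) - 2, by have := j.isLt; omega⟩
    else if hi1 : (i : ℕ) = 1 then
      if hj0 : (j : ℕ) = 0 then
        if (mm : ℕ) = 0 then c21 else if (mm : ℕ) = 1 then d21 else 0
      else if hj1 : (j : ℕ) = 1 then
        if (mm : ℕ) = 1 then d22 else 0
      else if hmm : (mm : ℕ) < 2 then 0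
      else L2 ⟨(mm : ℕ) - 2, by have := mm.isLt; omega⟩
             ⟨(j : ℕ) - 2, by have := j.isLt; omega⟩
    else
      if hj0 : (j : ℕ) = 0 then
        if hmm : (mm : ℕ) < 2 then 0
        else R1 ⟨(mm : ℕ) - 2, by have := mm.isLt; omega⟩
               ⟨(i : ℕ) - 2, by have := i.isLt; omega⟩
      else if hj1 : (j : ℕ) = 1 then
        if hmm : (mm : ℕ) < 2 then 0
        else R2 ⟨(mm : ℕ) - 2, by have := mm.isLt; omega⟩
               ⟨(i : ℕ) - 2, by have := i.isLt; omega⟩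
      else 0

/-! Concrete algebra structures, given by multiplication tables on the standard
basis `e₁, …, eₙ` (0-indexed as `0, …, n-1`); all unspecified products are zero. -/

/-- `A₃ ⊕ k^{n-2}`: `e₁e₁ = e₂`. -/
def A3str (n : ℕ) : AlgStr k n :=
  ofConst fun i j m => if (i : ℕ) = 0 ∧ (j : ℕ) = 0 ∧ (m : ℕ) = 1 then 1 else 0

/-- `n₃ ⊕ k^{n-3}`: `e₁e₂ = e₃`, `e₂e₁ = -e₃`. -/
def n3str (n : ℕ) : AlgStr k n :=
  ofConst fun i j m =>
    if (i : ℕ) = 0 ∧ (j : ℕ) = 1 ∧ (m : ℕ) = 2 then 1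
    else if (i : ℕ) = 1 ∧ (j : ℕ) = 0 ∧ (m : ℕ) = 2 then -1
    else 0

/-- `p⁻`: `e₁eᵢ = eᵢ`, `eᵢe₁ = -eᵢ` for `i ≥ 2`. -/
def pminusStr (n : ℕ) : AlgStr k n :=
  ofConst fun i j m =>
    if (i : ℕ) = 0 ∧ 1 ≤ (j : ℕ) ∧ m = j then 1
    else if 1 ≤ (i : ℕ) ∧ (j : ℕ) = 0 ∧ m = i then -1
    else 0

/-- `ν^α`: `e₁e₁ = e₁`, `e₁eᵢ = α eᵢ`, `eᵢe₁ = (1-α) eᵢ` for `i ≥ 2`. -/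
def nuStr (n : ℕ) (α : k) : AlgStr k n :=
  ofConst fun i j m =>
    if (i : ℕ) = 0 then
      if (j : ℕ) = 0 then (if (m : ℕ) = 0 then 1 else 0)
      else (if m = j then α else 0)
    else if (j : ℕ) = 0 then (if m = i then 1 - α else 0)
    else 0

/-- `k^{n-2} ⋊ E₄`: `e₁e₁ = e₁`, `e₁e₂ = e₁ + e₂`, `e₂e₂ = e₂`,
`e₁eᵢ = eᵢ`, `eᵢe₂ = eᵢ` for `i ≥ 3`.  (For `n = 2` this is `E₄`.) -/
def kE4str (n : ℕ) : AlgStr k n :=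
  ofConst fun i j m =>
    if (i : ℕ) = 0 ∧ (j : ℕ) = 0 then (if (m : ℕ) = 0 then 1 else 0)
    else if (i : ℕ) = 0 ∧ (j : ℕ) = 1 then (if (m : ℕ) = 0 ∨ (m : ℕ) = 1 then 1 else 0)
    else if (i : ℕ) = 1 ∧ (j : ℕ) = 1 then (if (m : ℕ) = 1 then 1 else 0)
    else if (i : ℕ) = 0 ∧ 2 ≤ (j : ℕ) then (if m = j then 1 else 0)
    else if 2 ≤ (i : ℕ) ∧ (j : ℕ) = 1 then (if m = i then 1 else 0)
    else 0

/-- `T₀^{2,(α,β)}`: `e₁e₂ = αe₂ + e₃`, `e₂e₁ = -αe₂ - e₃`,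
`e₁eᵢ = βeᵢ`, `eᵢe₁ = -βeᵢ` for `i ≥ 3`. -/
def T02str (n : ℕ) (α β : k) : AlgStr k n :=
  ofConst fun i j m =>
    if (i : ℕ) = 0 ∧ (j : ℕ) = 1 then
      (if (m : ℕ) = 1 then α else if (m : ℕ) = 2 then 1 else 0)
    else if (i : ℕ) = 1 ∧ (j : ℕ) = 0 then
      (if (m : ℕ) = 1 then -α else if (m : ℕ) = 2 then -1 else 0)
    else if (i : ℕ) = 0 ∧ 2 ≤ (j : ℕ) then (if m = j then β else 0)
    else if 2 ≤ (i : ℕ) ∧ (j : ℕ) = 0 then (if m = i then -β else 0)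
    else 0

/-- `T₁^{2,(α,β)}`: `e₁e₁ = e₁`, `e₁e₂ = αe₂ + e₃`, `e₂e₁ = (1-α)e₂ - e₃`,
`e₁eᵢ = βeᵢ`, `eᵢe₁ = (1-β)eᵢ` for `i ≥ 3`. -/
def T12str (n : ℕ) (α β : k) : AlgStr k n :=
  ofConst fun i j m =>
    if (i : ℕ) = 0 ∧ (j : ℕ) = 0 then (if (m : ℕ) = 0 then 1 else 0)
    else if (i : ℕ) = 0 ∧ (j : ℕ) = 1 then
      (if (m : ℕ) = 1 then α else if (m : ℕ) = 2 then 1 else 0)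
    else if (i : ℕ) = 1 ∧ (j : ℕ) = 0 then
      (if (m : ℕ) = 1 then 1 - α else if (m : ℕ) = 2 then -1 else 0)
    else if (i : ℕ) = 0 ∧ 2 ≤ (j : ℕ) then (if m = j then β else 0)
    else if 2 ≤ (i : ℕ) ∧ (j : ℕ) = 0 then (if m = i then 1 - β else 0)
    else 0

/-- `T₀³`: `e₁e₂ = e₃`, `e₂e₁ = -e₃`, `e₁e₃ = e₄`, `e₃e₁ = -e₄`. -/
def T03str (n : ℕ) : AlgStr k n :=
  ofConst fun i j m =>
    if (i : ℕ) = 0 ∧ (j : ℕ) = 1 ∧ (m : ℕ) = 2 then 1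
    else if (i : ℕ) = 1 ∧ (j : ℕ) = 0 ∧ (m : ℕ) = 2 then -1
    else if (i : ℕ) = 0 ∧ (j : ℕ) = 2 ∧ (m : ℕ) = 3 then 1
    else if (i : ℕ) = 2 ∧ (j : ℕ) = 0 ∧ (m : ℕ) = 3 then -1
    else 0

/-- `T₀^{2,2}`: `e₁e₂ = e₃`, `e₂e₁ = -e₃`, `e₁e₄ = e₅`, `e₄e₁ = -e₅`. -/
def T022str (n : ℕ) : AlgStr k n :=
  ofConst fun i j m =>
    if (i : ℕ) = 0 ∧ (j : ℕ) = 1 ∧ (m : ℕ) = 2 then 1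
    else if (i : ℕ) = 1 ∧ (j : ℕ) = 0 ∧ (m : ℕ) = 2 then -1
    else if (i : ℕ) = 0 ∧ (j : ℕ) = 3 ∧ (m : ℕ) = 4 then 1
    else if (i : ℕ) = 3 ∧ (j : ℕ) = 0 ∧ (m : ℕ) = 4 then -1
    else 0

/-- `η_l ⊕ k^{n-2l-1}`: `e_{2i-1}e_{2i} = e_{2l+1}`, `e_{2i}e_{2i-1} = -e_{2l+1}`
for `1 ≤ i ≤ l`. -/
def etaStr (n l : ℕ) : AlgStr k n :=
  ofConst fun i j m =>
    if (i : ℕ) % 2 = 0 ∧ (j : ℕ) = (i : ℕ) + 1 ∧ (i : ℕ) < 2 * l ∧ (m : ℕ) = 2 * l then 1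
    else if (j : ℕ) % 2 = 0 ∧ (i : ℕ) = (j : ℕ) + 1 ∧ (j : ℕ) < 2 * l ∧ (m : ℕ) = 2 * l then -1
    else 0

/-- `F^{α,β} ⊕ k^{n-3}`: `e₁e₁ = e₃`, `e₁e₂ = αe₃`, `e₂e₁ = βe₃`. -/
def FabStr (n : ℕ) (α β : k) : AlgStr k n :=
  ofConst fun i j m =>
    if (i : ℕ) = 0 ∧ (j : ℕ) = 0 ∧ (m : ℕ) = 2 then 1
    else if (i : ℕ) = 0 ∧ (j : ℕ) = 1 ∧ (m : ℕ) = 2 then α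
    else if (i : ℕ) = 1 ∧ (j : ℕ) = 0 ∧ (m : ℕ) = 2 then β
    else 0

/-- `k^{n-2} ⋊ A₃`: `e₁e₁ = e₂`, `e₁eᵢ = eᵢ`, `eᵢe₁ = -eᵢ` for `i ≥ 3`. -/
def kA3str (n : ℕ) : AlgStr k n :=
  ofConst fun i j m =>
    if (i : ℕ) = 0 ∧ (j : ℕ) = 0 ∧ (m : ℕ) = 1 then 1
    else if (i : ℕ) = 0 ∧ 2 ≤ (j : ℕ) then (if m = j then 1 else 0)
    else if 2 ≤ (i : ℕ) ∧ (j : ℕ) = 0 then (if m = i then -1 else 0)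
    else 0

/-- `k² ⋊_{α,β} A₃ ⊕ k^{n-4}`: `e₁e₁ = e₂`, `e₁e₃ = αe₄`, `e₃e₁ = βe₄`. -/
def k2A3str (n : ℕ) (α β : k) : AlgStr k n :=
  ofConst fun i j m =>
    if (i : ℕ) = 0 ∧ (j : ℕ) = 0 ∧ (m : ℕ) = 1 then 1
    else if (i : ℕ) = 0 ∧ (j : ℕ) = 2 ∧ (m : ℕ) = 3 then α
    else if (i : ℕ) = 2 ∧ (j : ℕ) = 0 ∧ (m : ℕ) = 3 then β
    else 0

/-- `k^{n-2} ⋊_α A₁^α`: `e₁e₁ = e₁ + e₂`, `e₁eᵢ = αeᵢ`, `eᵢe₁ = (1-α)eᵢ` for `i ≥ 2`. -/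
def kA1str (n : ℕ) (α : k) : AlgStr k n :=
  ofConst fun i j m =>
    if (i : ℕ) = 0 ∧ (j : ℕ) = 0 then (if (m : ℕ) = 0 ∨ (m : ℕ) = 1 then 1 else 0)
    else if (i : ℕ) = 0 then (if m = j then α else 0)
    else if (j : ℕ) = 0 then (if m = i then 1 - α else 0)
    else 0

/-- `k^{n-2} ⋊₁ A₂`: `e₁e₁ = e₂`, `e₁eᵢ = eᵢ`, `eᵢe₁ = -eᵢ` for `i ≥ 2`. -/
def kA2str (n : ℕ) : AlgStr k n :=
  ofConst fun i j m =>
    if (i : ℕ) = 0 ∧ (j : ℕ) = 0 then (if (m : ℕ) = 1 then 1 else 0)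
    else if (i : ℕ) = 0 then (if m = j then 1 else 0)
    else if (j : ℕ) = 0 then (if m = i then -1 else 0)
    else 0

/-- `k^{n-2} ⋊₀ᵗ B₂^α`: `e₁eᵢ = αeᵢ`, `eᵢe₁ = (1-α)eᵢ` for `i ≥ 2`. -/
def ktB2str (n : ℕ) (α : k) : AlgStr k n :=
  ofConst fun i j m =>
    if (i : ℕ) = 0 ∧ 1 ≤ (j : ℕ) then (if m = j then α else 0)
    else if 1 ≤ (i : ℕ) ∧ (j : ℕ) = 0 then (if m = i then 1 - α else 0)
    else 0

/-- `k^{n-2} ⋊₀ᵗ D₂^{α,β}`: `e₁e₁ = e₁`, `e₁eᵢ = αeᵢ`, `eᵢe₁ = βeᵢ` for `i ≥ 2`. -/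
def ktD2str (n : ℕ) (α β : k) : AlgStr k n :=
  ofConst fun i j m =>
    if (i : ℕ) = 0 ∧ (j : ℕ) = 0 then (if (m : ℕ) = 0 then 1 else 0)
    else if (i : ℕ) = 0 then (if m = j then α else 0)
    else if (j : ℕ) = 0 then (if m = i then β else 0)
    else 0


/-! ### Zariski closure of sets of `k`-points of a `k`-algebra -/

/-- The `k`-point `φ` of `R` lies in the Zariski closure of the set `E` of `k`-points. -/
def PointClosure {R : Type*} [CommRing R] [Algebra k R] (E : Set (R →ₐ[k] k))
    (φ : R →ₐ[k] k) : Prop :=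
  ∀ F : R, (∀ ψ ∈ E, ψ F = 0) → φ F = 0

lemma exists_det_ne_zero_of_lt_rank {r c : Type*} [Fintype r] [Fintype c] [DecidableEq r]
    (A : Matrix r c k) {d : ℕ} (h : d < A.rank) :
    ∃ (P : Matrix (Fin (d + 1)) r k) (Q : Matrix c (Fin (d + 1)) k), (P * A * Q).det ≠ 0 := by
  classical
  have h' : d + 1 ≤ Module.finrank k (LinearMap.range A.mulVecLin) := h
  obtain ⟨v, hv⟩ := exists_linearIndependent_of_le_finrank h'
  choose q hq using fun i => (v i).2
  have hli : LinearIndependent k fun i => A.mulVecLin (q i) := by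
    have := hv.map' (LinearMap.range A.mulVecLin).subtype (Submodule.ker_subtype _)
    have h2 : (fun i => A.mulVecLin (q i)) = (LinearMap.range A.mulVecLin).subtype ∘ v :=
      funext hq
    rw [h2]
    exact this
  let Q : Matrix c (Fin (d + 1)) k := Matrix.of fun i j => q j i
  have hinj : Function.Injective (A * Q).mulVec := by
    rw [Matrix.mulVec_injective_iff]
    exact hli
  obtain ⟨g, hg⟩ := (Matrix.mulVecLin (A * Q)).exists_leftInverse_of_injective
    (LinearMap.ker_eq_bot.2 hinj)
  refine ⟨LinearMap.toMatrix' g, Q, ?_⟩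
  have : LinearMap.toMatrix' g * A * Q = 1 := by
    rw [Matrix.mul_assoc, ← LinearMap.toMatrix'_toLin' (A * Q), ← LinearMap.toMatrix'_comp, Matrix.toLin'_apply', hg,
      LinearMap.toMatrix'_id]
  simp [this]

lemma PointClosure.rank_le {R : Type*} [CommRing R] [Algebra k R] {E : Set (R →ₐ[k] k)}
    {φ : R →ₐ[k] k} (h : PointClosure E φ) {r c : Type*} [Fintype r] [Fintype c]
    (A : Matrix r c R) {d : ℕ} (hA : ∀ ψ ∈ E, (A.map ψ).rank ≤ d) : (A.map φ).rank ≤ d := by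
  classical
  by_contra! hlt
  obtain ⟨P, Q, hdet⟩ := exists_det_ne_zero_of_lt_rank _ hlt
  have key : ∀ ψ : R →ₐ[k] k,
      ψ ((P.map (algebraMap k R) * A * Q.map (algebraMap k R)).det) = (P * A.map ψ * Q).det := by
    intro ψ
    rw [AlgHom.map_det]
    congr 1
    ext i j
    simp [Matrix.mul_apply]
  refine hdet ?_
  rw [← key]
  refine h _ fun ψ hψ => ?_
  rw [key]
  by_contra hne
  have hu : IsUnit (P * A.map ψ * Q) := (Matrix.isUnit_iff_isUnit_det _).2 (Ne.isUnit hne)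
  have h2 := Matrix.rank_of_isUnit _ hu
  have h3 := (Matrix.rank_mul_le_left (P * A.map ψ) Q).trans (Matrix.rank_mul_le_right P (A.map ψ))
  have h4 := hA ψ hψ
  simp only [Fintype.card_fin] at h2
  omega

open Polynomial in
/-- A closed family of pairs (point, scalar) in which the scalar is an eigenvalue of a matrix
depending polynomially on the point has a closed projection. -/
lemma PointClosure.exists_lift [IsAlgClosed k] {R : Type*} [CommRing R] [Algebra k R]
    {ι : Type*} [Fintype ι] [DecidableEq ι] [Nonempty ι] (A : Matrix ι ι R)
    {E : Set (R[X] →ₐ[k] k)}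
    (hE : ∀ ψ ∈ E, (A.map (fun a => ψ (C a)) - Matrix.scalar ι (ψ X)).det = 0)
    {φ : R →ₐ[k] k} (h : ∀ F : R, (∀ ψ ∈ E, ψ (C F) = 0) → φ F = 0) :
    ∃ s : k, ∀ F : R[X], (∀ ψ ∈ E, ψ F = 0) → (F.map (φ : R →+* k)).eval s = 0 := by
  classical
  let I : Ideal R[X] :=
    { carrier := {F | ∀ ψ ∈ E, ψ F = 0}
      add_mem' := fun {a b} ha hb ψ hψ => by simp [ha ψ hψ, hb ψ hψ]
      zero_mem' := fun ψ _ => by simp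
      smul_mem' := fun c a ha ψ hψ => by simp [ha ψ hψ] }
  have hsurj : Function.Surjective (mapRingHom (φ : R →+* k)) :=
    map_surjective _ fun c => ⟨algebraMap k R c, by simp⟩
  obtain ⟨d, hd⟩ := (IsPrincipalIdealRing.principal (I.map (mapRingHom (φ : R →+* k)))).principal
  have hdmem : d ∈ I.map (mapRingHom (φ : R →+* k)) := by
    rw [hd]; exact Submodule.mem_span_singleton_self d
  obtain ⟨F, hF, rfl⟩ := (Ideal.mem_map_iff_of_surjective _ hsurj).1 hdmem
  have hmap : ∀ f : R →+* k, f ((aeval A F).det) = (aeval (A.map f) (F.map f)).det := by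
    intro f
    rw [RingHom.map_det]
    congr 1
    rw [aeval_def, aeval_def, hom_eval₂, eval₂_map]
    congr 1
    refine RingHom.ext fun x => Matrix.ext fun i j => ?_
    simp [Matrix.algebraMap_matrix_apply, apply_ite f]
  have hdet0 : (aeval (A.map φ) (F.map (φ : R →+* k))).det = 0 := by
    have := hmap (φ : R →+* k)
    rw [RingHom.coe_coe] at this
    rw [← this]
    refine h _ fun ψ hψ => ?_
    have h1 := hmap ((ψ : R[X] →+* k).comp C)
    have h2 : ψ (C (aeval A F).det) = ((ψ : R[X] →+* k).comp C) ((aeval A F).det) := rfl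
    rw [h2, h1]
    have h3 : ψ F = (F.map ((ψ : R[X] →+* k).comp C)).eval (ψ X) := by
      have : (ψ : R[X] →+* k) = eval₂RingHom ((ψ : R[X] →+* k).comp C) (ψ X) := by
        refine Polynomial.ringHom_ext (fun a => ?_) ?_ <;> simp
      rw [eval_map]
      exact congrArg (fun f : R[X] →+* k => f F) this
    have h4 : (F.map ((ψ : R[X] →+* k).comp C)).IsRoot (ψ X) := by
      rw [IsRoot, ← h3]; exact hF ψ hψ
    obtain ⟨G, hG⟩ := dvd_iff_isRoot.2 h4
    rw [hG, map_mul, Matrix.det_mul]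
    have h5 := hE ψ hψ
    simp only [map_sub, aeval_X, aeval_C]
    have h6 : (A.map ((ψ : R[X] →+* k).comp C)) - algebraMap k (Matrix ι ι k) (ψ X) =
      (A.map (fun a => ψ (C a)) - Matrix.scalar ι (ψ X)) := rfl
    rw [h6, h5, zero_mul]
  have hspec : (0 : k) ∈ spectrum k (aeval (A.map φ) (F.map (φ : R →+* k))) := by
    rw [spectrum.zero_mem_iff, Matrix.isUnit_iff_isUnit_det, hdet0]
    simp
  rw [spectrum.map_polynomial_aeval_of_nonempty _ _
    (spectrum.nonempty_of_isAlgClosed_of_finiteDimensional k _)] at hspec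
  obtain ⟨s, -, hs⟩ := hspec
  refine ⟨s, fun F' hF' => ?_⟩
  have : mapRingHom (φ : R →+* k) F' ∈ I.map (mapRingHom (φ : R →+* k)) :=
    Ideal.mem_map_of_mem _ hF'
  rw [hd] at this
  obtain ⟨u, hu⟩ := Submodule.mem_span_singleton.1 this
  have hu' : F'.map (φ : R →+* k) = u * F.map (φ : R →+* k) := hu.symm
  have hs' : (F.map (φ : R →+* k)).eval s = 0 := hs
  rw [hu', eval_mul, hs', mul_zero]

/-! ### Zariski closure of sets of algebra structures -/

lemma mem_zclosure_iff {n : ℕ} (S : Set (AlgStr k n)) (χ : AlgStr k n) :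
    χ ∈ zclosure S ↔ ∀ p : MvPolynomial (Fin n × Fin n × Fin n) k,
      (∀ μ ∈ S, MvPolynomial.eval (structConst μ) p = 0) →
        MvPolynomial.eval (structConst χ) p = 0 := by
  constructor
  · intro h p hp
    exact h {μ | MvPolynomial.eval (structConst μ) p = 0} ⟨{p}, by simp⟩ hp
  · rintro h T ⟨P, hP⟩ hST
    exact (hP χ).2 fun p hp => h p fun μ hμ => (hP μ).1 (hST hμ) p hp

lemma subset_zclosure {n : ℕ} (S : Set (AlgStr k n)) : S ⊆ zclosure S :=
  fun _ hχ _ _ hST => hST hχ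

lemma zclosure_subset_of_subset {n : ℕ} {S T : Set (AlgStr k n)} (h : S ⊆ zclosure T) :
    zclosure S ⊆ zclosure T := fun _ hχ U hU hTU =>
  hχ U hU fun _ hμ => h hμ U hU hTU

lemma structConst_ofConst {n : ℕ} (c : Fin n → Fin n → Fin n → k) (i j l : Fin n) :
    structConst (ofConst c) (i, j, l) = c i j l := by
  simp [structConst, ofConst, LinearMap.sum_apply, Finset.sum_apply, Pi.single_apply, ite_apply]

lemma ofConst_structConst {n : ℕ} (μ : AlgStr k n) :
    ofConst (fun i j l => structConst μ (i, j, l)) = μ := by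
  refine LinearMap.pi_ext' fun i => LinearMap.ext_ring ?_
  refine LinearMap.pi_ext' fun j => LinearMap.ext_ring ?_
  funext l
  exact structConst_ofConst (fun i j l => structConst μ (i, j, l)) i j l

lemma algStr_ext {n : ℕ} {μ χ : AlgStr k n} (h : ∀ i j l, structConst μ (i, j, l) =
    structConst χ (i, j, l)) : μ = χ := by
  rw [← ofConst_structConst μ, ← ofConst_structConst χ]
  simp only [h]

/-- Linear functionals of an algebra structure are polynomials in the structure constants. -/
lemma exists_eval_eq_of_linear {n : ℕ} (ℓ : AlgStr k n →ₗ[k] k) :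
    ∃ p : MvPolynomial (Fin n × Fin n × Fin n) k,
      ∀ μ, MvPolynomial.eval (structConst μ) p = ℓ μ := by
  let e : (Fin n × Fin n × Fin n → k) ≃ₗ[k] AlgStr k n :=
    { toFun := fun c => ofConst fun i j l => c (i, j, l)
      map_add' := fun c d => algStr_ext fun i j l => by
        rw [structConst_ofConst]
        have := fun c : Fin n × Fin n × Fin n → k =>
          structConst_ofConst (fun i j l => c (i, j, l)) i j l
        simp only [structConst] at this ⊢
        simp [this]
      map_smul' := fun a c => algStr_ext fun i j l => by
        rw [structConst_ofConst]
        have := fun c : Fin n × Fin n × Fin n → k =>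
          structConst_ofConst (fun i j l => c (i, j, l)) i j l
        simp only [structConst] at this ⊢
        simp [this]
      invFun := structConst
      left_inv := fun c => by
        funext ⟨i, j, l⟩
        exact structConst_ofConst _ i j l
      right_inv := ofConst_structConst }
  refine ⟨∑ t, MvPolynomial.X t * MvPolynomial.C (ℓ (e (Pi.single t 1))), fun μ => ?_⟩
  have h1 : μ = e (structConst μ) := (e.apply_symm_apply μ).symm
  conv_rhs => rw [h1, ← Finset.univ_sum_single (structConst μ)]
  simp only [map_sum, map_mul, MvPolynomial.eval_X, MvPolynomial.eval_C]
  refine Finset.sum_congr rfl fun t _ => ?_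
  have : (Pi.single t (structConst μ t) : Fin n × Fin n × Fin n → k) =
    structConst μ t • Pi.single t 1 := by
    rw [← Pi.single_smul, smul_eq_mul, mul_one]
  rw [this, map_smul, map_smul, smul_eq_mul]

lemma transport_apply {n : ℕ} (g : (Fin n → k) ≃ₗ[k] (Fin n → k)) (μ : AlgStr k n)
    (x y : Fin n → k) : transport g μ x y = g (μ (g.symm x) (g.symm y)) := rfl

lemma orbit_symm {n : ℕ} {μ χ : AlgStr k n} (h : χ ∈ orbit μ) : μ ∈ orbit χ := by
  obtain ⟨g, rfl⟩ := h
  exact ⟨g.symm, LinearMap.ext fun x => LinearMap.ext fun y => by simp [transport_apply]⟩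

lemma orbit_trans {n : ℕ} {μ χ ν : AlgStr k n} (h : χ ∈ orbit μ) (h' : ν ∈ orbit χ) :
    ν ∈ orbit μ := by
  obtain ⟨g, rfl⟩ := h
  obtain ⟨g', rfl⟩ := h'
  exact ⟨g.trans g', rfl⟩

lemma orbit_eq_of_mem {n : ℕ} {μ χ : AlgStr k n} (h : χ ∈ orbit μ) : orbit χ = orbit μ :=
  Set.Subset.antisymm (fun _ h' => orbit_trans h h') fun _ h' => orbit_trans (orbit_symm h) h'

lemma transport_mem_zclosure {n : ℕ} {S : Set (AlgStr k n)} {χ : AlgStr k n}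
    (h : χ ∈ zclosure S) (g : (Fin n → k) ≃ₗ[k] (Fin n → k)) :
    transport g χ ∈ zclosure (transport g '' S) := by
  rw [mem_zclosure_iff] at h ⊢
  intro p hp
  have hlin : ∀ t : Fin n × Fin n × Fin n, ∃ q : MvPolynomial (Fin n × Fin n × Fin n) k,
      ∀ μ, MvPolynomial.eval (structConst μ) q = structConst (transport g μ) t := by
    intro t
    exact exists_eval_eq_of_linear
      { toFun := fun μ => structConst (transport g μ) t
        map_add' := fun μ ν => by simp [structConst, transport_apply]
        map_smul' := fun a μ => by simp [structConst, transport_apply] }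
  choose q hq using hlin
  have key : ∀ μ, MvPolynomial.eval (structConst μ) (MvPolynomial.bind₁ q p) =
      MvPolynomial.eval (structConst (transport g μ)) p := by
    intro μ
    rw [MvPolynomial.eval, MvPolynomial.eval₂Hom_bind₁]
    congr 2
    funext t
    exact hq t μ
  rw [← key]
  exact h _ fun μ hμ => by rw [key]; exact hp _ ⟨μ, hμ, rfl⟩

lemma degenerates_trans {n : ℕ} {μ χ ν : AlgStr k n} (h : degenerates μ χ)
    (h' : degenerates χ ν) : degenerates μ ν := by
  refine zclosure_subset_of_subset (S := orbit χ) ?_ h'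
  rintro _ ⟨g, rfl⟩
  have h1 := transport_mem_zclosure h g
  have h2 : transport g '' orbit μ ⊆ zclosure (orbit μ) := by
    rintro _ ⟨_, hν, rfl⟩
    exact subset_zclosure _ (orbit_trans hν ⟨g, rfl⟩)
  exact zclosure_subset_of_subset h2 h1

lemma degenerates_of_mem_orbit {n : ℕ} {μ χ : AlgStr k n} (h : χ ∈ orbit μ) : degenerates μ χ :=
  subset_zclosure _ h

/-- The limit at `0` of a polynomial curve lies in the closure of its other points. -/
lemma mem_zclosure_of_curve [Infinite k] {n : ℕ} {S : Set (AlgStr k n)} (c : k → AlgStr k n)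
    (q : Fin n × Fin n × Fin n → Polynomial k)
    (hq : ∀ t x, structConst (c t) x = (q x).eval t) (hS : ∀ t, t ≠ 0 → c t ∈ S) :
    c 0 ∈ zclosure S := by
  rw [mem_zclosure_iff]
  intro p hp
  have key : ∀ t, MvPolynomial.eval (structConst (c t)) p =
      (MvPolynomial.aeval q p).eval t := by
    intro t
    have h1 : (Polynomial.evalRingHom t) (MvPolynomial.aeval q p) =
      MvPolynomial.eval (structConst (c t)) p := by
      rw [MvPolynomial.aeval_def, MvPolynomial.hom_eval₂, MvPolynomial.eval]
      simp only [MvPolynomial.coe_eval₂Hom]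
      congr 1
      · ext; simp
      · funext x; simp [hq]
    exact h1.symm
  have hz : MvPolynomial.aeval q p = 0 := by
    refine Polynomial.eq_zero_of_infinite_isRoot _ (Set.Infinite.mono (s := {0}ᶜ) ?_ ?_)
    · intro t ht
      have := key t
      rw [hp _ (hS t ht)] at this
      exact this.symm
    · exact (Set.finite_singleton (0 : k)).infinite_compl
  rw [key, hz, Polynomial.eval_zero]

/-! ### Structures with a square-zero ideal of codimension one -/

/-- The structure `(x, y) ↦ f(x) L(y) - f(y) L(x) + α f(y) x`. -/
def semiStr {n : ℕ} (f : (Fin n → k) →ₗ[k] k) (L : (Fin n → k) →ₗ[k] (Fin n → k)) (α : k) :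
    AlgStr k n :=
  LinearMap.mk₂ k (fun x y => f x • L y - f y • L x + (α * f y) • x)
    (fun x x' y => by simp only [map_add]; module)
    (fun c x y => by simp only [map_smul, smul_eq_mul]; module)
    (fun x y y' => by simp only [map_add]; module)
    (fun c x y => by simp only [map_smul, smul_eq_mul]; module)

lemma semiStr_apply {n : ℕ} (f : (Fin n → k) →ₗ[k] k) (L : (Fin n → k) →ₗ[k] (Fin n → k)) (α : k)
    (x y : Fin n → k) : semiStr f L α x y = f x • L y - f y • L x + (α * f y) • x := rfl

/-- The extension by zero of a matrix to an endomorphism of a space with one more coordinate. -/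
def extendMatrix {m : ℕ} (M : Matrix (Fin m) (Fin m) k) :
    (Fin (m + 1) → k) →ₗ[k] (Fin (m + 1) → k) where
  toFun x := Fin.cons 0 (M.mulVec (Fin.tail x))
  map_add' x y := by
    have : Fin.tail (x + y) = Fin.tail x + Fin.tail y := rfl
    rw [this, Matrix.mulVec_add]
    funext i
    refine Fin.cases ?_ (fun i => ?_) i <;> simp
  map_smul' c x := by
    have : Fin.tail (c • x) = c • Fin.tail x := rfl
    rw [this, Matrix.mulVec_smul]
    funext i
    refine Fin.cases ?_ (fun i => ?_) i <;> simp

lemma extendMatrix_apply {m : ℕ} (M : Matrix (Fin m) (Fin m) k) (x : Fin (m + 1) → k) :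
    extendMatrix M x = Fin.cons 0 (M.mulVec (Fin.tail x)) := rfl

lemma tail_single_zero {m : ℕ} : Fin.tail (Pi.single 0 1 : Fin (m + 1) → k) = 0 := by
  funext i
  simp [Fin.tail]

lemma tail_single_succ {m : ℕ} (j : Fin m) :
    Fin.tail (Pi.single j.succ 1 : Fin (m + 1) → k) = Pi.single j 1 := by
  funext i
  simp [Fin.tail, Pi.single_apply]

lemma tstr_eq_semiStr {m : ℕ} (α : k) (M : Matrix (Fin m) (Fin m) k) :
    Tstr α M = semiStr (LinearMap.proj 0) (extendMatrix M) α := by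
  refine algStr_ext fun i j l => ?_
  rw [Tstr, structConst_ofConst]
  simp only [structConst, semiStr_apply, extendMatrix_apply, LinearMap.proj_apply]
  refine Fin.cases ?_ (fun i => ?_) i <;> refine Fin.cases ?_ (fun j => ?_) j <;>
    refine Fin.cases ?_ (fun l => ?_) l <;>
    simp [tail_single_zero, tail_single_succ, Pi.single_apply, Fin.succ_ne_zero, eq_comm]
  ring

lemma transport_semiStr {n : ℕ} (g : (Fin n → k) ≃ₗ[k] (Fin n → k)) (f : (Fin n → k) →ₗ[k] k)
    (L : (Fin n → k) →ₗ[k] (Fin n → k)) (α : k) :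
    transport g (semiStr f L α) =
      semiStr (f ∘ₗ g.symm.toLinearMap) (g.toLinearMap ∘ₗ L ∘ₗ g.symm.toLinearMap) α :=
  LinearMap.ext fun x => LinearMap.ext fun y => by simp [transport_apply, semiStr_apply]

lemma exists_equiv_comp_eq_proj {m : ℕ} {f : (Fin (m + 1) → k) →ₗ[k] k} (hf : f ≠ 0) :
    ∃ g : (Fin (m + 1) → k) ≃ₗ[k] (Fin (m + 1) → k), ∀ x, f (g x) = x 0 := by
  obtain ⟨e, he⟩ := LinearMap.surjective hf 1
  have hker : Module.finrank k (LinearMap.ker f) = m := by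
    have h1 := LinearMap.finrank_range_add_finrank_ker f
    rw [LinearMap.range_eq_top.2 (LinearMap.surjective hf)] at h1
    simp at h1
    omega
  let b := Module.finBasisOfFinrankEq k (LinearMap.ker f) hker
  let g : (Fin (m + 1) → k) →ₗ[k] (Fin (m + 1) → k) :=
    (LinearMap.toSpanSingleton k _ e) ∘ₗ (LinearMap.proj 0) +
      (LinearMap.ker f).subtype ∘ₗ (b.equivFun.symm.toLinearMap) ∘ₗ
        (LinearMap.funLeft k k Fin.succ)
  have hg : ∀ x, f (g x) = x 0 := by
    intro x
    have : f ((b.equivFun.symm (LinearMap.funLeft k k Fin.succ x) : LinearMap.ker f) :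
      Fin (m + 1) → k) = 0 := LinearMap.mem_ker.1 (Subtype.mem _)
    simp only [g, LinearMap.add_apply, LinearMap.comp_apply, map_add, LinearEquiv.coe_coe,
      Submodule.subtype_apply, this]
    simp [he]
  have hinj : Function.Injective g := by
    rw [← LinearMap.ker_eq_bot, LinearMap.ker_eq_bot']
    intro x hx
    have h0 : x 0 = 0 := by rw [← hg x, hx, map_zero]
    have h1 : b.equivFun.symm (LinearMap.funLeft k k Fin.succ x) = 0 := by
      refine Subtype.ext ?_
      simpa [g, h0] using hx
    have h2 : LinearMap.funLeft k k Fin.succ x = 0 := (LinearEquiv.map_eq_zero_iff _).1 h1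
    funext i
    refine Fin.cases h0 (fun i => ?_) i
    exact congrFun h2 i
  exact ⟨LinearEquiv.ofInjectiveEndo g hinj, hg⟩

/-- The matrix of the endomorphism of `kᵐ` induced on the last `m` coordinates. -/
def lowerMatrix {m : ℕ} (L : (Fin (m + 1) → k) →ₗ[k] (Fin (m + 1) → k)) :
    Matrix (Fin m) (Fin m) k :=
  Matrix.of fun i j => L (Pi.single j.succ 1) i.succ

lemma lowerMatrix_mulVec_tail {m : ℕ} (L : (Fin (m + 1) → k) →ₗ[k] (Fin (m + 1) → k))
    (x : Fin (m + 1) → k) (i : Fin m) :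
    (lowerMatrix L).mulVec (Fin.tail x) i = L x i.succ - x 0 * L (Pi.single 0 1) i.succ := by
  have h : L x = ∑ j, x j • L (Pi.single j 1) := by
    conv_lhs => rw [← Finset.univ_sum_single x]
    rw [map_sum]
    refine Finset.sum_congr rfl fun j _ => ?_
    rw [← map_smul, ← Pi.single_smul, smul_eq_mul, mul_one]
  rw [h, Finset.sum_apply, Fin.sum_univ_succ]
  simp only [Pi.smul_apply, smul_eq_mul, add_sub_cancel_left, Matrix.mulVec, dotProduct,
    lowerMatrix, Matrix.of_apply, Fin.tail]
  exact Finset.sum_congr rfl fun j _ => mul_comm _ _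

lemma semiStr_proj_eq_tstr {m : ℕ} (L : (Fin (m + 1) → k) →ₗ[k] (Fin (m + 1) → k)) (α : k)
    (hL : ∀ x, L x 0 = 0) : semiStr (LinearMap.proj 0) L α = Tstr α (lowerMatrix L) := by
  rw [tstr_eq_semiStr]
  refine LinearMap.ext fun x => LinearMap.ext fun y => ?_
  funext i
  simp only [semiStr_apply, extendMatrix_apply, Pi.add_apply, Pi.sub_apply, Pi.smul_apply,
    smul_eq_mul, LinearMap.proj_apply]
  refine Fin.cases ?_ (fun i => ?_) i
  · simp [hL]
  · simp only [Fin.cons_succ, lowerMatrix_mulVec_tail]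
    ring

lemma exists_semiStr_mem_orbit {m : ℕ} {f : (Fin (m + 1) → k) →ₗ[k] k} (hf : f ≠ 0)
    {L : (Fin (m + 1) → k) →ₗ[k] (Fin (m + 1) → k)} (hL : ∀ x, f (L x) = 0) (α : k) :
    ∃ M', semiStr f L α ∈ orbit (Tstr α M') := by
  obtain ⟨g, hg⟩ := exists_equiv_comp_eq_proj hf
  have h1 : transport g.symm (semiStr f L α) = Tstr α (lowerMatrix
      (g.symm.toLinearMap ∘ₗ L ∘ₗ g.toLinearMap)) := by
    rw [← semiStr_proj_eq_tstr _ α, transport_semiStr]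
    · congr 1
      exact LinearMap.ext hg
    · intro x
      rw [← hg ((g.symm.toLinearMap ∘ₗ L ∘ₗ g.toLinearMap) x)]
      simp [hL]
  exact ⟨_, orbit_symm ⟨g.symm, h1⟩⟩

/-- Conjugate matrices up to a nonzero scalar give isomorphic structures. -/
lemma tstr_mem_orbit_of_conj {m : ℕ} {c : k} (hc : c ≠ 0) {r : k} {M X : Matrix (Fin m) (Fin m) k}
    (h : (Fin m → k) ≃ₗ[k] (Fin m → k)) (hX : ∀ u, X.mulVec (h u) = h (c • M.mulVec u)) :
    Tstr (c * r) X ∈ orbit (Tstr r M) := by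
  let g₀ : (Fin (m + 1) → k) →ₗ[k] (Fin (m + 1) → k) :=
    { toFun := fun x => Fin.cons (c⁻¹ * x 0) (h (Fin.tail x))
      map_add' := fun x y => by
        have : Fin.tail (x + y) = Fin.tail x + Fin.tail y := rfl
        rw [this, map_add]
        funext i
        refine Fin.cases ?_ (fun i => ?_) i <;> simp [mul_add]
      map_smul' := fun a x => by
        have : Fin.tail (a • x) = a • Fin.tail x := rfl
        rw [this, map_smul]
        funext i
        refine Fin.cases ?_ (fun i => ?_) i <;> simp [mul_left_comm] }
  have hg₀ : ∀ x, g₀ x = Fin.cons (c⁻¹ * x 0) (h (Fin.tail x)) := fun _ => rfl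
  have hinj : Function.Injective g₀ := by
    rw [← LinearMap.ker_eq_bot, LinearMap.ker_eq_bot']
    intro x hx
    rw [hg₀] at hx
    have h0 : c⁻¹ * x 0 = 0 := congrFun hx 0
    have h1 : h (Fin.tail x) = 0 := by
      funext i
      exact congrFun hx i.succ
    have h2 : Fin.tail x = 0 := by simpa using h1
    funext i
    refine Fin.cases ?_ (fun i => ?_) i
    · simpa [hc] using h0
    · exact congrFun h2 i
  refine orbit_symm ⟨(LinearEquiv.ofInjectiveEndo g₀ hinj).symm, ?_⟩
  refine LinearMap.ext fun x => LinearMap.ext fun y => ?_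
  rw [transport_apply, LinearEquiv.symm_symm, LinearEquiv.symm_apply_eq, tstr_eq_semiStr,
    tstr_eq_semiStr]
  simp only [LinearEquiv.coe_ofInjectiveEndo, semiStr_apply, LinearMap.proj_apply,
    extendMatrix_apply, hg₀]
  funext i
  refine Fin.cases ?_ (fun i => ?_) i
  · simp only [Pi.add_apply, Pi.sub_apply, Pi.smul_apply, smul_eq_mul, Fin.cons_zero]
    field_simp
  · have htail : ∀ a b : Fin (m + 1) → k, Fin.tail (a + b) = Fin.tail a + Fin.tail b :=
      fun _ _ => rfl
    have htail' : ∀ a b : Fin (m + 1) → k, Fin.tail (a - b) = Fin.tail a - Fin.tail b :=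
      fun _ _ => rfl
    have htail2 : ∀ (a : k) (b : Fin (m + 1) → k), Fin.tail (a • b) = a • Fin.tail b :=
      fun _ _ => rfl
    simp only [Pi.add_apply, Pi.sub_apply, Pi.smul_apply, smul_eq_mul, Fin.cons_succ,
      Fin.cons_zero, Fin.tail_cons, hX, htail, htail', htail2, map_add, map_sub, map_smul]
    field_simp

/-- Reading off the defining matrix of a structure in the standard basis. -/
def coeffMatrix {m : ℕ} (μ : AlgStr k (m + 1)) : Matrix (Fin m) (Fin m) k :=
  Matrix.of fun i j => structConst μ (0, j.succ, i.succ)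

lemma coeffMatrix_tstr {m : ℕ} (α : k) (M : Matrix (Fin m) (Fin m) k) :
    coeffMatrix (Tstr α M) = M := by
  refine Matrix.ext fun i j => ?_
  rw [coeffMatrix, Matrix.of_apply, Tstr, structConst_ofConst]
  simp [Fin.succ_ne_zero]

lemma structConst_tstr_zero {m : ℕ} (α : k) (M : Matrix (Fin m) (Fin m) k) :
    structConst (Tstr α M) (0, 0, 0) = α := by
  rw [Tstr, structConst_ofConst]
  simp

lemma structConst_transport_tstr_zero {m : ℕ} (α : k) (M : Matrix (Fin m) (Fin m) k)
    (g : (Fin (m + 1) → k) ≃ₗ[k] (Fin (m + 1) → k)) :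
    structConst (transport g (Tstr α M)) (0, 0, 0) = α * (g.symm (Pi.single 0 1)) 0 := by
  rw [tstr_eq_semiStr, transport_semiStr, structConst, semiStr_apply]
  simp

lemma exists_coeffMatrix_transport {m : ℕ} (α : k) (M : Matrix (Fin m) (Fin m) k)
    (g : (Fin (m + 1) → k) ≃ₗ[k] (Fin (m + 1) → k)) (hs : g.symm (Pi.single 0 1) 0 ≠ 0) :
    ∃ h : (Fin m → k) ≃ₗ[k] (Fin m → k), ∀ u,
      (coeffMatrix (transport g (Tstr α M))).mulVec (h u) =
        h (g.symm (Pi.single 0 1) 0 • M.mulVec u) := by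
  set s := g.symm (Pi.single 0 1) 0 with hsdef
  let c₀ : (Fin m → k) →ₗ[k] (Fin (m + 1) → k) :=
    { toFun := fun u => Fin.cons 0 u
      map_add' := fun u v => by
        funext i
        refine Fin.cases ?_ (fun i => ?_) i <;> simp
      map_smul' := fun a u => by
        funext i
        refine Fin.cases ?_ (fun i => ?_) i <;> simp }
  have hc₀ : ∀ u, c₀ u = Fin.cons 0 u := fun _ => rfl
  let h₀ : (Fin m → k) →ₗ[k] (Fin m → k) := LinearMap.funLeft k k Fin.succ ∘ₗ g.toLinearMap ∘ₗ c₀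
  have hh₀ : ∀ u, h₀ u = Fin.tail (g (Fin.cons 0 u)) := fun _ => rfl
  have hdecomp : ∀ z : Fin (m + 1) → k, z = (Fin.cons 0 (Fin.tail z) : Fin (m + 1) → k) +
      z 0 • Pi.single 0 1 := by
    intro z
    funext i
    refine Fin.cases ?_ (fun i => ?_) i <;> simp [Fin.tail]
  have hinj : Function.Injective h₀ := by
    rw [← LinearMap.ker_eq_bot, LinearMap.ker_eq_bot']
    intro u hu
    have h1 := hdecomp (g (Fin.cons 0 u))
    rw [← hh₀, hu] at h1
    have hz : (Fin.cons 0 0 : Fin (m + 1) → k) = 0 := by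
      funext i
      refine Fin.cases ?_ (fun i => ?_) i <;> simp
    rw [hz, zero_add] at h1
    have h2 := congrArg g.symm h1
    rw [LinearEquiv.symm_apply_apply, map_smul] at h2
    have h3 := congrFun h2 0
    rw [Pi.smul_apply, ← hsdef, Fin.cons_zero, smul_eq_mul, eq_comm, mul_eq_zero] at h3
    have h4 := h3.resolve_right hs
    rw [h4, zero_smul] at h2
    funext i
    simpa using congrFun h2 i.succ
  refine ⟨LinearEquiv.ofInjectiveEndo h₀ hinj, fun u => ?_⟩
  simp only [LinearEquiv.coe_ofInjectiveEndo]
  have hB : coeffMatrix (transport g (Tstr α M)) =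
      lowerMatrix (transport g (Tstr α M) (Pi.single 0 1)) := rfl
  funext i
  rw [hB, hh₀, hh₀, lowerMatrix_mulVec_tail, tstr_eq_semiStr, transport_semiStr, semiStr_apply,
    semiStr_apply]
  simp only [LinearMap.comp_apply, LinearEquiv.coe_coe, LinearEquiv.symm_apply_apply,
    LinearMap.proj_apply, extendMatrix_apply, Fin.tail_cons, Fin.cons_zero, ← hsdef]
  have h5 : (Fin.cons 0 (s • M.mulVec u) : Fin (m + 1) → k) = s • Fin.cons 0 (M.mulVec u) :=
    c₀.map_smul s (M.mulVec u)
  rw [h5, map_smul]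
  simp [Fin.tail]

/-! ### Necessary conditions for degenerations -/

/-- The part of the orbit on which the first coordinate functional pulls back to a functional
not vanishing on the first basis vector. -/
def bigOrbit {m : ℕ} (μ : AlgStr k (m + 1)) : Set (AlgStr k (m + 1)) :=
  {χ | ∃ g : (Fin (m + 1) → k) ≃ₗ[k] (Fin (m + 1) → k),
    g.symm (Pi.single 0 1) 0 ≠ 0 ∧ transport g μ = χ}

/-- The elementary map `x ↦ x + t x₀ e_j`. -/
def shearMap {m : ℕ} (j : Fin (m + 1)) (t : k) : (Fin (m + 1) → k) →ₗ[k] (Fin (m + 1) → k) :=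
  LinearMap.id + (LinearMap.toSpanSingleton k _ (Pi.single j t)) ∘ₗ LinearMap.proj 0

lemma shearMap_apply {m : ℕ} (j : Fin (m + 1)) (t : k) (x : Fin (m + 1) → k) :
    shearMap j t x = x + x 0 • Pi.single j t := by
  simp [shearMap]

lemma shearMap_shearMap {m : ℕ} {j : Fin (m + 1)} (hj : j ≠ 0) (t : k) (x : Fin (m + 1) → k) :
    shearMap j t (shearMap j (-t) x) = x := by
  rw [shearMap_apply, shearMap_apply]
  simp [Pi.single_eq_of_ne hj.symm, Pi.single_neg]

/-- The elementary map as an automorphism. -/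
def shearEquiv {m : ℕ} {j : Fin (m + 1)} (hj : j ≠ 0) (t : k) :
    (Fin (m + 1) → k) ≃ₗ[k] (Fin (m + 1) → k) :=
  LinearEquiv.ofLinearMap (shearMap j t) (shearMap j (-t))
    (LinearMap.ext fun x => shearMap_shearMap hj t x)
    (LinearMap.ext fun x => by simpa using shearMap_shearMap hj (-t) x)

lemma orbit_subset_zclosure_bigOrbit [Infinite k] {m : ℕ} (μ : AlgStr k (m + 1)) :
    orbit μ ⊆ zclosure (bigOrbit μ) := by
  rintro _ ⟨g, rfl⟩
  by_cases hs : g.symm (Pi.single 0 1) 0 ≠ 0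
  · exact subset_zclosure _ ⟨g, hs, rfl⟩
  push Not at hs
  obtain ⟨j, hj⟩ : ∃ j, g.symm (Pi.single j 1) 0 ≠ 0 := by
    by_contra! h
    have h1 : LinearMap.proj 0 ∘ₗ g.symm.toLinearMap = (0 : (Fin (m + 1) → k) →ₗ[k] k) := by
      refine LinearMap.pi_ext' fun j => LinearMap.ext_ring ?_
      simpa using h j
    have h2 := LinearMap.congr_fun h1 (g (Pi.single 0 1))
    simp at h2
  have hj0 : j ≠ 0 := by rintro rfl; exact hj hs
  set ν := transport g μ with hν
  have h0 : transport (shearEquiv hj0 0) ν = ν := by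
    refine LinearMap.ext fun x => LinearMap.ext fun y => ?_
    simp [transport_apply, shearEquiv, shearMap_apply]
  rw [← h0]
  let V : Fin (m + 1) × Fin (m + 1) × Fin (m + 1) → Polynomial k := fun x =>
    Polynomial.C (structConst ν x)
      - (if x.1 = 0 then Polynomial.X * Polynomial.C (structConst ν (j, x.2.1, x.2.2)) else 0)
      - (if x.2.1 = 0 then Polynomial.X * Polynomial.C (structConst ν (x.1, j, x.2.2)) else 0)
      + (if x.1 = 0 then if x.2.1 = 0 then
          Polynomial.X ^ 2 * Polynomial.C (structConst ν (j, j, x.2.2)) else 0 else 0)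
  refine mem_zclosure_of_curve (fun t => transport (shearEquiv hj0 t) ν)
    (fun x => V x + (if x.2.2 = j then Polynomial.X * V (x.1, x.2.1, 0) else 0)) ?_ ?_
  · rintro t ⟨a, b, c⟩
    have e1 : ∀ a : Fin (m + 1), (shearEquiv hj0 t).symm (Pi.single a 1) =
        Pi.single a 1 - (if a = 0 then t • Pi.single j 1 else 0) := by
      intro a
      have : (shearEquiv hj0 t).symm (Pi.single a 1) = shearMap j (-t) (Pi.single a 1) := rfl
      rw [this, shearMap_apply]
      by_cases ha : a = 0
      · simp [ha, Pi.single_neg, sub_eq_add_neg, ← Pi.single_smul]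
      · simp [ha]
    have hV : ∀ c, ν ((shearEquiv hj0 t).symm (Pi.single a 1))
        ((shearEquiv hj0 t).symm (Pi.single b 1)) c = (V (a, b, c)).eval t := by
      intro c
      rw [e1, e1]
      by_cases ha : a = 0 <;> by_cases hb : b = 0 <;> simp [ha, hb, V, structConst] <;> ring
    have h3 : structConst (transport (shearEquiv hj0 t) ν) (a, b, c) =
      shearMap j t (ν ((shearEquiv hj0 t).symm (Pi.single a 1))
        ((shearEquiv hj0 t).symm (Pi.single b 1))) c := rfl
    rw [h3, shearMap_apply, Pi.add_apply, hV, Pi.smul_apply, hV]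
    by_cases hc : c = j
    · simp [hc, mul_comm]
    · simp [hc]
  · intro t ht
    refine ⟨g.trans (shearEquiv hj0 t), ?_, rfl⟩
    have : (g.trans (shearEquiv hj0 t)).symm (Pi.single 0 1) =
      g.symm (shearMap j (-t) (Pi.single 0 1)) := rfl
    rw [this, shearMap_apply, map_add, Pi.add_apply, hs]
    have h2 : (Pi.single j (-t) : Fin (m + 1) → k) = (-t) • Pi.single j 1 := by
      rw [← Pi.single_smul, smul_eq_mul, mul_one]
    rw [h2]
    simp [ht, hj]

lemma mem_zclosure_bigOrbit [Infinite k] {m : ℕ} {μ χ : AlgStr k (m + 1)} (h : degenerates μ χ) :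
    χ ∈ zclosure (bigOrbit μ) :=
  zclosure_subset_of_subset (orbit_subset_zclosure_bigOrbit μ) h

/-- Evaluation of polynomials at the structure constants of an algebra structure. -/
def evalAt {n : ℕ} (μ : AlgStr k n) : MvPolynomial (Fin n × Fin n × Fin n) k →ₐ[k] k :=
  MvPolynomial.aeval (structConst μ)

lemma evalAt_apply {n : ℕ} (μ : AlgStr k n) (p : MvPolynomial (Fin n × Fin n × Fin n) k) :
    evalAt μ p = MvPolynomial.eval (structConst μ) p := by
  exact DFunLike.congr_fun (MvPolynomial.coe_aeval_eq_eval _) p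

lemma pointClosure_of_mem_zclosure {n : ℕ} {S : Set (AlgStr k n)} {χ : AlgStr k n}
    (h : χ ∈ zclosure S) : PointClosure (evalAt '' S) (evalAt χ) := by
  intro F hF
  rw [evalAt_apply]
  refine (mem_zclosure_iff S χ).1 h F fun μ hμ => ?_
  rw [← evalAt_apply]
  exact hF _ ⟨μ, hμ, rfl⟩

/-- The generic coefficient matrix. -/
def genericMatrix (k : Type*) [Field k] (m : ℕ) :
    Matrix (Fin m) (Fin m) (MvPolynomial (Fin (m + 1) × Fin (m + 1) × Fin (m + 1)) k) :=
  Matrix.of fun i j => MvPolynomial.X (0, j.succ, i.succ)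

lemma genericMatrix_map {m : ℕ} (μ : AlgStr k (m + 1)) :
    (genericMatrix k m).map (evalAt μ) = coeffMatrix μ := by
  refine Matrix.ext fun i j => ?_
  simp [genericMatrix, coeffMatrix, evalAt]

lemma rank_le_of_conj {m : ℕ} {A B : Matrix (Fin m) (Fin m) k}
    (h : (Fin m → k) ≃ₗ[k] (Fin m → k)) (hAB : ∀ u, A.mulVec (h u) = h (B.mulVec u)) :
    A.rank = B.rank := by
  have h1 : A.mulVecLin ∘ₗ h.toLinearMap = h.toLinearMap ∘ₗ B.mulVecLin :=
    LinearMap.ext hAB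
  have h2 : LinearMap.range A.mulVecLin = (LinearMap.range B.mulVecLin).map h.toLinearMap := by
    rw [← LinearMap.range_comp, ← h1, LinearMap.range_comp, LinearEquiv.range, Submodule.map_top]
  rw [Matrix.rank, h2, Matrix.rank]
  exact LinearEquiv.finrank_map_eq h _

lemma aeval_mulVec_of_conj {m : ℕ} {A B : Matrix (Fin m) (Fin m) k}
    (h : (Fin m → k) ≃ₗ[k] (Fin m → k)) (hAB : ∀ u, A.mulVec (h u) = h (B.mulVec u))
    (q : Polynomial k) (u : Fin m → k) :
    (Polynomial.aeval A q).mulVec (h u) = h ((Polynomial.aeval B q).mulVec u) := by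
  induction q using Polynomial.induction_on generalizing u with
  | C a => simp [Algebra.algebraMap_eq_smul_one, Matrix.smul_mulVec]
  | add p q hp hq => simp [Matrix.add_mulVec, hp, hq]
  | monomial n a ih =>
    rw [pow_succ, ← mul_assoc, map_mul, Polynomial.aeval_X, ← Matrix.mulVec_mulVec, hAB, ih,
      Matrix.mulVec_mulVec, map_mul (Polynomial.aeval B) _ Polynomial.X, Polynomial.aeval_X]

lemma map_aeval_eq {R : Type*} [CommRing R] {ι : Type*} [Fintype ι] [DecidableEq ι]
    {S : Type*} [CommRing S] (f : R →+* S) (A : Matrix ι ι R) (F : Polynomial R) :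
    (Polynomial.aeval A F).map f = Polynomial.aeval (A.map f) (F.map f) := by
  have : f.mapMatrix (Polynomial.aeval A F) = Polynomial.aeval (A.map f) (F.map f) := by
    rw [Polynomial.aeval_def, Polynomial.aeval_def, Polynomial.hom_eval₂, Polynomial.eval₂_map]
    congr 1
    refine RingHom.ext fun x => Matrix.ext fun i j => ?_
    simp [Matrix.algebraMap_matrix_apply, apply_ite f]
  exact this

/-- The polynomial `∏ (X - s λᵢ)^{pᵢ}`. -/
def scaledProd {l : ℕ} (lam : Fin l → k) (p : Fin l → ℕ) (s : k) : Polynomial k :=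
  ∏ i, (Polynomial.X - Polynomial.C (s * lam i)) ^ p i

lemma scaledProd_comp {l : ℕ} (lam : Fin l → k) (p : Fin l → ℕ) (s : k) :
    (scaledProd lam p s).comp (Polynomial.C s * Polynomial.X) =
      (∏ i, Polynomial.C s ^ p i) * scaledProd lam p 1 := by
  simp only [scaledProd, Polynomial.prod_comp, Polynomial.pow_comp, Polynomial.sub_comp,
    Polynomial.X_comp, Polynomial.C_comp, ← Finset.prod_mul_distrib, one_mul, ← mul_pow]
  simp only [map_mul, mul_sub]

lemma rank_aeval_scaledProd_le {m : ℕ} (M : Matrix (Fin m) (Fin m) k) {l : ℕ} (lam : Fin l → k)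
    (p : Fin l → ℕ) (s : k) :
    (Polynomial.aeval (s • M) (scaledProd lam p s)).rank ≤
      (Polynomial.aeval M (scaledProd lam p 1)).rank := by
  have h1 : Polynomial.aeval (s • M) (scaledProd lam p s) =
      Polynomial.aeval M (∏ i, Polynomial.C s ^ p i) * Polynomial.aeval M (scaledProd lam p 1) := by
    rw [← map_mul, ← scaledProd_comp, Polynomial.aeval_comp]
    congr 2
    simp [Algebra.smul_def]
  rw [h1]
  exact Matrix.rank_mul_le_right _ _

/-- Ranks of powers can only drop under degenerations. -/
lemma rank_pow_le_of_degenerates [Infinite k] {m : ℕ} {r α : k} {M M' : Matrix (Fin m) (Fin m) k}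
    (h : degenerates (Tstr r M) (Tstr α M')) (p : ℕ) : (M' ^ p).rank ≤ (M ^ p).rank := by
  have hc := pointClosure_of_mem_zclosure (mem_zclosure_bigOrbit h)
  have hmap : ∀ μ : AlgStr k (m + 1),
      ((genericMatrix k m ^ p).map (evalAt μ)) = coeffMatrix μ ^ p := by
    intro μ
    rw [← genericMatrix_map]
    exact map_pow (evalAt μ).mapMatrix _ _
  have := hc.rank_le (genericMatrix k m ^ p) (d := (M ^ p).rank) ?_
  · rwa [hmap, coeffMatrix_tstr] at this
  rintro _ ⟨_, ⟨g, hs, rfl⟩, rfl⟩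
  rw [hmap]
  obtain ⟨e, he⟩ := exists_coeffMatrix_transport r M g hs
  have h2 := aeval_mulVec_of_conj (A := coeffMatrix (transport g (Tstr r M)))
    (B := g.symm (Pi.single 0 1) 0 • M) e
    (fun u => by rw [he, Matrix.smul_mulVec]) (Polynomial.X ^ p)
  simp only [map_pow, Polynomial.aeval_X] at h2
  rw [rank_le_of_conj e h2, smul_pow]
  have : (g.symm (Pi.single 0 1) 0) ^ p • M ^ p =
    ((g.symm (Pi.single 0 1) 0) ^ p • (1 : Matrix (Fin m) (Fin m) k)) * M ^ p := by simp
  rw [this]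
  exact Matrix.rank_mul_le_right _ _

lemma eq_zero_of_degenerates {m : ℕ} {α : k} {M M' : Matrix (Fin m) (Fin m) k}
    (h : degenerates (Tstr 0 M) (Tstr α M')) : α = 0 := by
  have := (mem_zclosure_iff _ _).1 h (MvPolynomial.X (0, 0, 0)) ?_
  · simpa [structConst_tstr_zero] using this
  rintro _ ⟨g, rfl⟩
  simp [structConst_transport_tstr_zero]

lemma exists_scalar_of_degenerates [IsAlgClosed k] {m : ℕ} {r α : k}
    {M M' : Matrix (Fin m) (Fin m) k} {l : ℕ} (lam : Fin l → k)
    (hr : r = 1 ∨ ∃ i, lam i ≠ 0 ∧ (M - Matrix.scalar (Fin m) (lam i)).det = 0)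
    (h : degenerates (Tstr r M) (Tstr α M')) :
    ∃ s : k, α = r * s ∧ ∀ p : Fin l → ℕ, (Polynomial.aeval M' (scaledProd lam p s)).rank ≤
      (Polynomial.aeval M (scaledProd lam p 1)).rank := by
  have : Infinite k := IsAlgClosed.instInfinite
  let R := MvPolynomial (Fin (m + 1) × Fin (m + 1) × Fin (m + 1)) k
  let ev : AlgStr k (m + 1) → k → Polynomial R →ₐ[k] k := fun μ s =>
    (Polynomial.aeval s).comp (Polynomial.mapAlgHom (evalAt μ))
  have evC : ∀ μ s F, ev μ s (Polynomial.C F) = evalAt μ F := fun μ s F => by simp [ev]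
  have evX : ∀ μ s, ev μ s Polynomial.X = s := fun μ s => by simp [ev]
  let E : Set (Polynomial R →ₐ[k] k) := {ψ | ∃ g : (Fin (m + 1) → k) ≃ₗ[k] (Fin (m + 1) → k),
    g.symm (Pi.single 0 1) 0 ≠ 0 ∧ ev (transport g (Tstr r M)) (g.symm (Pi.single 0 1) 0) = ψ}
  have hproj : ∀ F : R, (∀ ψ ∈ E, ψ (Polynomial.C F) = 0) → evalAt (Tstr α M') F = 0 := by
    intro F hF
    refine pointClosure_of_mem_zclosure (mem_zclosure_bigOrbit h) F ?_
    rintro _ ⟨_, ⟨g, hs, rfl⟩, rfl⟩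
    rw [← hF _ ⟨g, hs, rfl⟩, evC]
  have hlift : ∃ s : k, PointClosure E (ev (Tstr α M') s) := by
    have key : ∃ s : k, ∀ F : Polynomial R, (∀ ψ ∈ E, ψ F = 0) →
        (F.map (evalAt (Tstr α M') : R →+* k)).eval s = 0 := by
      rcases hr with rfl | ⟨i, hi, hdet⟩
      · refine PointClosure.exists_lift (ι := Fin 1)
          (Matrix.of fun _ _ => MvPolynomial.X (0, 0, 0)) ?_ hproj
        rintro _ ⟨g, hs, rfl⟩
        rw [Matrix.det_fin_one]
        simp [evC, evX, evalAt, structConst_transport_tstr_zero]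
      · have hne : Nonempty (Fin m) := by
          by_contra hemp
          rw [not_nonempty_iff] at hemp
          simp at hdet
        refine PointClosure.exists_lift
          ((MvPolynomial.C (lam i)⁻¹ : R) • genericMatrix k m) ?_ hproj
        rintro _ ⟨g, hs, rfl⟩
        set s := g.symm (Pi.single 0 1) 0
        obtain ⟨e, he⟩ := exists_coeffMatrix_transport r M g hs
        obtain ⟨v, hv, hMv⟩ := Matrix.exists_mulVec_eq_zero_iff.2 hdet
        refine Matrix.exists_mulVec_eq_zero_iff.1 ⟨e v, by simpa using hv, ?_⟩
        have h3 : ((MvPolynomial.C (lam i)⁻¹ : R) • genericMatrix k m).map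
            (fun a => ev (transport g (Tstr r M)) s (Polynomial.C a)) =
            (lam i)⁻¹ • coeffMatrix (transport g (Tstr r M)) := by
          rw [← genericMatrix_map]
          refine Matrix.ext fun a b => ?_
          simp only [Matrix.map_apply, Matrix.smul_apply, evC, smul_eq_mul, map_mul]
          simp [evalAt]
        have h4 : M.mulVec v = lam i • v := by
          rw [Matrix.sub_mulVec, sub_eq_zero] at hMv
          rw [hMv, Matrix.scalar_apply, ← Matrix.smul_one_eq_diagonal, Matrix.smul_mulVec,
            Matrix.one_mulVec]
        rw [h3, evX, Matrix.sub_mulVec, Matrix.smul_mulVec, he, h4, Matrix.scalar_apply,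
          ← Matrix.smul_one_eq_diagonal, Matrix.smul_mulVec, Matrix.one_mulVec, map_smul, map_smul,
          smul_comm s, inv_smul_smul₀ hi, sub_self]
    obtain ⟨s, hs⟩ := key
    refine ⟨s, fun F hF => ?_⟩
    rw [← hs F hF]
    simp [ev]
  obtain ⟨s, hs⟩ := hlift
  refine ⟨s, ?_, fun p => ?_⟩
  · have := hs (Polynomial.C (MvPolynomial.X (0, 0, 0)) -
      Polynomial.C (MvPolynomial.C r) * Polynomial.X) ?_
    · rw [map_sub, map_mul, evC, evC, evX] at this
      simpa [evalAt, structConst_tstr_zero, sub_eq_zero] using this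
    · rintro _ ⟨g, hg, rfl⟩
      rw [map_sub, map_mul, evC, evC, evX]
      simp [evalAt, structConst_transport_tstr_zero]
  · let Q : Polynomial (Polynomial R) := ∏ i, (Polynomial.X -
      Polynomial.C (Polynomial.X * Polynomial.C (MvPolynomial.C (lam i)))) ^ p i
    have hQ : ∀ μ s, (Polynomial.aeval ((genericMatrix k m).map Polynomial.C) Q).map (ev μ s) =
        Polynomial.aeval (coeffMatrix μ) (scaledProd lam p s) := by
      intro μ s
      have h5 := map_aeval_eq (ev μ s : Polynomial R →+* k)
        ((genericMatrix k m).map Polynomial.C) Q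
      rw [RingHom.coe_coe] at h5
      rw [h5]
      congr 1
      · rw [← genericMatrix_map]
        congr 1
        refine Matrix.ext fun a b => ?_
        simp [evC]
      · rw [Polynomial.map_prod, scaledProd]
        refine Finset.prod_congr rfl fun i _ => ?_
        have h7 : ev μ s (Polynomial.X * Polynomial.C (MvPolynomial.C (lam i))) = s * lam i := by
          rw [map_mul, evX, evC]
          simp [evalAt]
        rw [Polynomial.map_pow, Polynomial.map_sub, Polynomial.map_X, Polynomial.map_C,
          RingHom.coe_coe, h7]
    have h6 := hs.rank_le (Polynomial.aeval ((genericMatrix k m).map Polynomial.C) Q)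
      (d := (Polynomial.aeval M (scaledProd lam p 1)).rank) ?_
    · rwa [hQ, coeffMatrix_tstr] at h6
    rintro _ ⟨g, hg, rfl⟩
    rw [hQ]
    obtain ⟨e, he⟩ := exists_coeffMatrix_transport r M g hg
    rw [rank_le_of_conj e (aeval_mulVec_of_conj (A := coeffMatrix (transport g (Tstr r M)))
      (B := g.symm (Pi.single 0 1) 0 • M) e (fun u => by rw [he, Matrix.smul_mulVec]) _)]
    exact rank_aeval_scaledProd_le _ _ _ _

/-- Generic structure constants of the product `(x, y) ↦ μ(x, y) - φ(y) x`, where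
`φ(e_j)` is the `j`-th coordinate of `μ(e_j, e_j)`. -/
def reducedConst {n : ℕ} (c : Fin n × Fin n × Fin n → k) (i j l : Fin n) : k :=
  c (i, j, l) - if i = l then c (j, j, j) else 0

/-- The matrix whose kernel consists of the functionals `f` realizing a structure with
structure constants `c` as some `semiStr f L α`. -/
def functionalMatrix {R : Type*} [CommRing R] {n : ℕ} (c : Fin n × Fin n × Fin n → R) :
    Matrix ((Fin n × Fin n × Fin n × Fin n) ⊕ (Fin n × Fin n) ⊕ (Fin n × Fin n)) (Fin n) R :=
  Matrix.of <| Sum.elim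
    (fun t a => (if t.1 = a then c (t.2.1, t.2.2.1, t.2.2.2)
        - if t.2.1 = t.2.2.2 then c (t.2.2.1, t.2.2.1, t.2.2.1) else 0 else 0)
      - (if t.2.1 = a then c (t.1, t.2.2.1, t.2.2.2)
        - if t.1 = t.2.2.2 then c (t.2.2.1, t.2.2.1, t.2.2.1) else 0 else 0)
      + (if t.2.2.1 = a then c (t.1, t.2.1, t.2.2.2)
        - if t.1 = t.2.2.2 then c (t.2.1, t.2.1, t.2.1) else 0 else 0))
    (Sum.elim (fun t a => c (t.1, t.2, a) - if t.1 = a then c (t.2, t.2, t.2) else 0)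
      (fun t a => (if t.1 = a then c (t.2, t.2, t.2) else 0)
        - if t.2 = a then c (t.1, t.1, t.1) else 0))

lemma functionalMatrix_mulVec {n : ℕ} (c : Fin n × Fin n × Fin n → k) (f : Fin n → k) :
    (functionalMatrix c).mulVec f = 0 ↔
      (∀ x y z w, f x * reducedConst c y z w - f y * reducedConst c x z w +
        f z * reducedConst c x y w = 0) ∧
      (∀ x y, ∑ a, reducedConst c x y a * f a = 0) ∧
      ∀ x y, f x * c (y, y, y) = f y * c (x, x, x) := by
  rw [funext_iff, Sum.forall, Sum.forall, Prod.forall, Prod.forall, Prod.forall]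
  simp only [Prod.forall, functionalMatrix, Matrix.mulVec, dotProduct, Matrix.of_apply,
    Sum.elim_inl, Sum.elim_inr, Pi.zero_apply]
  refine and_congr ?_ (and_congr ?_ ?_)
  · refine forall_congr' fun x => forall_congr' fun y => forall_congr' fun z =>
      forall_congr' fun w => ?_
    simp only [add_mul, sub_mul (ite _ _ _) (ite _ _ _), ite_mul, zero_mul,
      Finset.sum_add_distrib, Finset.sum_sub_distrib, Finset.sum_ite_eq, Finset.mem_univ, if_true,
      reducedConst, mul_comm (f _)]
  · rfl
  · refine forall_congr' fun x => forall_congr' fun y => ?_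
    simp only [sub_mul, ite_mul, zero_mul, Finset.sum_sub_distrib, Finset.sum_ite_eq,
      Finset.mem_univ, if_true, mul_comm (f _), sub_eq_zero]

lemma functionalMatrix_map {R : Type*} [CommRing R] {n : ℕ} (φ : R →+* k)
    (c : Fin n × Fin n × Fin n → R) :
    (functionalMatrix c).map φ = functionalMatrix fun t => φ (c t) := by
  refine Matrix.ext fun t a => ?_
  rcases t with t | t | t <;> simp [functionalMatrix, apply_ite φ]

lemma rank_lt_of_mulVec_eq_zero {ι : Type*} [Fintype ι] {n : ℕ} {A : Matrix ι (Fin n) k}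
    {f : Fin n → k} (hf : f ≠ 0) (hA : A.mulVec f = 0) : A.rank ≤ n - 1 := by
  have h1 := LinearMap.finrank_range_add_finrank_ker A.mulVecLin
  have h2 : LinearMap.ker A.mulVecLin ≠ ⊥ := fun h => hf (by
    have : f ∈ LinearMap.ker A.mulVecLin := hA
    rwa [h, Submodule.mem_bot] at this)
  have h3 : 0 < Module.finrank k (LinearMap.ker A.mulVecLin) := by
    rw [Nat.pos_iff_ne_zero]
    exact fun h => h2 (Submodule.finrank_eq_zero.1 h)
  rw [Module.finrank_fin_fun] at h1
  have h4 : A.rank = Module.finrank k (LinearMap.range A.mulVecLin) := rfl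
  omega

lemma exists_mulVec_eq_zero_of_rank_lt {ι : Type*} [Fintype ι] {n : ℕ} (hn : n ≠ 0)
    {A : Matrix ι (Fin n) k} (h : A.rank ≤ n - 1) : ∃ f : Fin n → k, f ≠ 0 ∧ A.mulVec f = 0 := by
  have h1 := LinearMap.finrank_range_add_finrank_ker A.mulVecLin
  rw [Module.finrank_fin_fun] at h1
  have h4 : A.rank = Module.finrank k (LinearMap.range A.mulVecLin) := rfl
  have h2 : LinearMap.ker A.mulVecLin ≠ ⊥ := fun h => by
    rw [h, finrank_bot] at h1
    omega
  obtain ⟨f, hf, hf0⟩ := Submodule.exists_mem_ne_zero_of_ne_bot h2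
  exact ⟨f, hf0, hf⟩

lemma structConst_semiStr {n : ℕ} (f : (Fin n → k) →ₗ[k] k)
    (L : (Fin n → k) →ₗ[k] (Fin n → k)) (α : k) (i j l : Fin n) :
    structConst (semiStr f L α) (i, j, l) = f (Pi.single i 1) * L (Pi.single j 1) l
      - f (Pi.single j 1) * L (Pi.single i 1) l
      + α * f (Pi.single j 1) * (if i = l then 1 else 0) := by
  simp [structConst, semiStr_apply, Pi.single_apply, eq_comm]

lemma reducedConst_semiStr {n : ℕ} (f : (Fin n → k) →ₗ[k] k)
    (L : (Fin n → k) →ₗ[k] (Fin n → k)) (α : k) (i j l : Fin n) :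
    reducedConst (structConst (semiStr f L α)) i j l = f (Pi.single i 1) * L (Pi.single j 1) l
      - f (Pi.single j 1) * L (Pi.single i 1) l := by
  rw [reducedConst, structConst_semiStr, structConst_semiStr]
  by_cases h : i = l <;> simp [h]

lemma map_eq_sum_single {n : ℕ} {V : Type*} [AddCommGroup V] [Module k V]
    (f : (Fin n → k) →ₗ[k] V) (x : Fin n → k) : f x = ∑ i, x i • f (Pi.single i 1) := by
  conv_lhs => rw [← Finset.univ_sum_single x]
  rw [map_sum]
  refine Finset.sum_congr rfl fun j _ => ?_
  rw [← map_smul, ← Pi.single_smul, smul_eq_mul, mul_one]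

lemma functionalMatrix_semiStr {n : ℕ} (f : (Fin n → k) →ₗ[k] k)
    (L : (Fin n → k) →ₗ[k] (Fin n → k)) (α : k) (hL : ∀ x, f (L x) = 0) :
    (functionalMatrix (structConst (semiStr f L α))).mulVec (fun i => f (Pi.single i 1)) = 0 := by
  rw [functionalMatrix_mulVec]
  refine ⟨fun x y z w => ?_, fun x y => ?_, fun x y => ?_⟩
  · simp only [reducedConst_semiStr]
    ring
  · have h : ∀ z, ∑ a, L z a * f (Pi.single a 1) = 0 := by
      intro z
      rw [← hL z, map_eq_sum_single f (L z)]
      rfl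
    simp only [reducedConst_semiStr, sub_mul, mul_assoc, Finset.sum_sub_distrib,
      ← Finset.mul_sum, h, mul_zero, sub_self]
  · simp only [structConst_semiStr, if_true]
    ring

lemma exists_eq_semiStr {n : ℕ} (χ : AlgStr k n) {f : Fin n → k} (hf : f ≠ 0)
    (h : (functionalMatrix (structConst χ)).mulVec f = 0) :
    ∃ (F : (Fin n → k) →ₗ[k] k) (L : (Fin n → k) →ₗ[k] (Fin n → k)) (α : k),
      F ≠ 0 ∧ (∀ x, F (L x) = 0) ∧ χ = semiStr F L α := by
  rw [functionalMatrix_mulVec] at h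
  obtain ⟨h1, h2, h3⟩ := h
  obtain ⟨e, he⟩ : ∃ e, f e ≠ 0 := by
    by_contra! h
    exact hf (funext h)
  let F : (Fin n → k) →ₗ[k] k := ∑ a, f a • LinearMap.proj a
  have hF : ∀ x, F x = ∑ a, f a * x a := by
    intro x
    simp [F]
  have hFs : ∀ a, F (Pi.single a 1) = f a := by
    intro a
    simp [hF, Pi.single_apply]
  let L : (Fin n → k) →ₗ[k] (Fin n → k) := ∑ j, (LinearMap.proj j).smulRight
    (fun l => (f e)⁻¹ * reducedConst (structConst χ) e j l)
  have hLs : ∀ j l, L (Pi.single j 1) l = (f e)⁻¹ * reducedConst (structConst χ) e j l := by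
    intro j l
    simp [L, LinearMap.sum_apply, Finset.sum_apply, Pi.single_apply, ite_apply]
  refine ⟨F, L, (f e)⁻¹ * structConst χ (e, e, e), ?_, ?_, ?_⟩
  · intro h0
    rw [← hFs e, h0] at he
    simp at he
  · have : F ∘ₗ L = 0 := by
      refine LinearMap.pi_ext' fun j => LinearMap.ext_ring ?_
      simp only [LinearMap.comp_apply, LinearMap.single_apply, LinearMap.zero_apply]
      rw [hF]
      simp only [hLs]
      have := h2 e j
      calc ∑ a, f a * ((f e)⁻¹ * reducedConst (structConst χ) e j a)
          = (f e)⁻¹ * ∑ a, reducedConst (structConst χ) e j a * f a := by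
            rw [Finset.mul_sum]
            exact Finset.sum_congr rfl fun a _ => by ring
        _ = 0 := by rw [this, mul_zero]
    exact fun x => LinearMap.congr_fun this x
  · refine algStr_ext fun i j l => ?_
    rw [structConst_semiStr, hFs, hFs, hLs, hLs]
    have h4 := h1 e i j l
    have h5 := h3 e j
    have h6 : structConst χ (i, j, l) = reducedConst (structConst χ) i j l +
        structConst χ (j, j, j) * if i = l then 1 else 0 := by
      by_cases h : i = l <;> simp [reducedConst, h]
    rw [h6]
    generalize (if i = l then (1 : k) else 0) = d
    field_simp
    linear_combination h4 + d * h5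

/-- Every degeneration of some `Tstr r M` is isomorphic to some `Tstr α M'`. -/
lemma exists_mem_orbit_tstr {m : ℕ} {r : k} {M : Matrix (Fin m) (Fin m) k}
    {χ : AlgStr k (m + 1)} (h : degenerates (Tstr r M) χ) :
    ∃ α M', χ ∈ orbit (Tstr α M') := by
  have hc := pointClosure_of_mem_zclosure h
  have hmap : ∀ μ : AlgStr k (m + 1), (functionalMatrix (R := MvPolynomial _ k)
      MvPolynomial.X).map (evalAt μ) = functionalMatrix (structConst μ) := by
    intro μ
    have := functionalMatrix_map
      (evalAt μ : MvPolynomial (Fin (m + 1) × Fin (m + 1) × Fin (m + 1)) k →+* k) MvPolynomial.X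
    rw [RingHom.coe_coe] at this
    rw [this]
    congr 1
    funext t
    simp [evalAt]
  have hrank := hc.rank_le (functionalMatrix (R := MvPolynomial _ k) MvPolynomial.X) (d := m) ?_
  · rw [hmap] at hrank
    obtain ⟨f, hf, hf0⟩ := exists_mulVec_eq_zero_of_rank_lt (Nat.succ_ne_zero m) hrank
    obtain ⟨F, L, α, hF, hL, rfl⟩ := exists_eq_semiStr χ hf hf0
    exact ⟨α, exists_semiStr_mem_orbit hF hL α⟩
  rintro _ ⟨_, ⟨g, rfl⟩, rfl⟩
  rw [hmap, tstr_eq_semiStr, transport_semiStr]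
  refine rank_lt_of_mulVec_eq_zero ?_ (functionalMatrix_semiStr _ _ _ ?_)
  · intro h0
    have h1 := map_eq_sum_single
      ((LinearMap.proj 0 : (Fin (m + 1) → k) →ₗ[k] k) ∘ₗ g.symm.toLinearMap) (g (Pi.single 0 1))
    rw [Finset.sum_eq_zero fun i _ => by rw [congrFun h0 i]; simp] at h1
    simp at h1
  · intro x
    simp [extendMatrix_apply]

/-! ### Modules over `k[X]` -/

open Polynomial in
/-- The dimension of the kernel of multiplication by `u` on a `k[X]`-module. -/
def nullityAt {k : Type*} [Field k] (W : Type*) [AddCommGroup W] [Module k W] [Module k[X] W]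
    [IsScalarTower k k[X] W] (u : k[X]) : ℕ :=
  Module.finrank k (LinearMap.ker (Algebra.lsmul k k W u))

section nullity

open Polynomial

lemma nullityAt_congr {W W' : Type*} [AddCommGroup W] [Module k W] [Module k[X] W]
    [IsScalarTower k k[X] W] [AddCommGroup W'] [Module k W'] [Module k[X] W']
    [IsScalarTower k k[X] W'] (e : W ≃ₗ[k[X]] W') (u : k[X]) :
    nullityAt W u = nullityAt W' u := by
  unfold nullityAt
  rw [← LinearEquiv.finrank_map_eq (e.restrictScalars k)]
  refine congrArg (fun p : Submodule k W' => Module.finrank k p) ?_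
  ext x
  simp only [Submodule.mem_map, LinearMap.mem_ker, Algebra.lsmul_coe]
  constructor
  · rintro ⟨y, hy, rfl⟩
    have := e.map_smul u y
    rw [hy, map_zero] at this
    exact this.symm
  · intro hx
    refine ⟨e.symm x, ?_, e.apply_symm_apply x⟩
    rw [← map_smul, hx, map_zero]

lemma nullityAt_pi {ι : Type*} [Fintype ι] (W : ι → Type*) [∀ i, AddCommGroup (W i)]
    [∀ i, Module k (W i)] [∀ i, Module k[X] (W i)] [∀ i, IsScalarTower k k[X] (W i)]
    [∀ i, Module.Finite k (W i)] (u : k[X]) :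
    nullityAt (∀ i, W i) u = ∑ i, nullityAt (W i) u := by
  unfold nullityAt
  rw [← Module.finrank_pi_fintype k]
  refine LinearEquiv.finrank_eq
    { toFun := fun x i => ⟨x.1 i, congrFun x.2 i⟩
      invFun := fun y => ⟨fun i => (y i).1, funext fun i => (y i).2⟩
      map_add' := fun _ _ => rfl
      map_smul' := fun _ _ => rfl
      left_inv := fun _ => rfl
      right_inv := fun _ => rfl }

/-- The cyclic module `k[X] / (q)`. -/
abbrev CyclicMod (q : k[X]) : Type _ := k[X] ⧸ Ideal.span {q}

lemma finite_cyclicMod {q : k[X]} (hq : q ≠ 0) : Module.Finite k (CyclicMod q) :=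
  (AdjoinRoot.powerBasis hq).finite

lemma nullityAt_cyclicMod {q u g a b : k[X]} (hq : q ≠ 0) (hgq : g ∣ q) (hgu : g ∣ u)
    (hab : g = a * q + b * u) : nullityAt (CyclicMod q) u = g.natDegree := by
  have := finite_cyclicMod hq
  have hg : g ≠ 0 := fun h => hq (by rw [h, zero_dvd_iff] at hgq; exact hgq)
  have := finite_cyclicMod hg
  have hle : Ideal.span {q} ≤ Ideal.span {g} := by
    rwa [Ideal.span_singleton_le_span_singleton]
  let π : CyclicMod q →ₗ[k] CyclicMod g := (Submodule.factor hle).restrictScalars k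
  have hπ : Function.Surjective π := Submodule.factor_surjective hle
  have hker : LinearMap.ker π = LinearMap.range (Algebra.lsmul k k (CyclicMod q) u) := by
    ext x
    obtain ⟨x, rfl⟩ := Submodule.Quotient.mk_surjective _ x
    constructor
    · intro hx
      have hx' : (Submodule.Quotient.mk x : CyclicMod g) = 0 := hx
      rw [Submodule.Quotient.mk_eq_zero, Ideal.mem_span_singleton] at hx'
      obtain ⟨y, rfl⟩ := hx'
      refine ⟨Submodule.Quotient.mk (b * y), ?_⟩
      rw [Algebra.lsmul_coe]
      beta_reduce
      rw [← Submodule.Quotient.mk_smul, Submodule.Quotient.eq,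
        Ideal.mem_span_singleton]
      refine ⟨-(a * y), ?_⟩
      rw [smul_eq_mul, hab]
      ring
    · rintro ⟨y, hy⟩
      obtain ⟨y, rfl⟩ := Submodule.Quotient.mk_surjective _ y
      rw [← hy, Algebra.lsmul_coe]
      beta_reduce
      rw [← Submodule.Quotient.mk_smul]
      change (Submodule.Quotient.mk (u • y) : CyclicMod g) = 0
      rw [Submodule.Quotient.mk_eq_zero, Ideal.mem_span_singleton, smul_eq_mul]
      exact hgu.mul_right y
  have h1 := LinearMap.finrank_range_add_finrank_ker (Algebra.lsmul k k (CyclicMod q) u)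
  have h2 := LinearMap.finrank_range_add_finrank_ker π
  rw [hker, LinearMap.range_eq_top.2 hπ, finrank_top] at h2
  have h3 : Module.finrank k (CyclicMod g) = g.natDegree :=
    finrank_quotient_span_eq_natDegree
  unfold nullityAt
  omega

lemma le_nullityAt_cyclicMod {q u g : k[X]} (hq : q ≠ 0) (hgq : g ∣ q) (hgu : g ∣ u) :
    g.natDegree ≤ nullityAt (CyclicMod q) u := by
  obtain ⟨d, hd⟩ := (IsPrincipalIdealRing.principal (Ideal.span {q, u})).principal
  have hdq : d ∣ q := by
    rw [← Ideal.mem_span_singleton]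
    change q ∈ Submodule.span k[X] {d}
    rw [← hd]
    exact Ideal.subset_span (by simp)
  have hdu : d ∣ u := by
    rw [← Ideal.mem_span_singleton]
    change u ∈ Submodule.span k[X] {d}
    rw [← hd]
    exact Ideal.subset_span (by simp)
  have hd' : d ∈ Ideal.span {q, u} := by
    rw [hd]
    exact Submodule.mem_span_singleton_self d
  obtain ⟨a, b, hab⟩ := Ideal.mem_span_pair.1 hd'
  rw [nullityAt_cyclicMod hq hdq hdu hab.symm]
  refine natDegree_le_of_dvd ?_ fun h => hq ?_
  · rw [← hab]
    exact dvd_add (hgq.mul_left a) (hgu.mul_left b)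
  · rwa [h, zero_dvd_iff] at hdq

lemma nullityAt_cyclicMod_X_sub_C_pow {q s : k[X]} {c : k} {n : ℕ}
    (hq : q = (X - C c) ^ n * s) (hs : IsCoprime (X - C c) s) (hs0 : s ≠ 0) (p : ℕ) :
    nullityAt (CyclicMod q) ((X - C c) ^ p) = min n p := by
  have hq0 : q ≠ 0 := by
    rw [hq]
    exact mul_ne_zero (pow_ne_zero _ (X_sub_C_ne_zero c)) hs0
  rcases le_total n p with h | h
  · obtain ⟨b, a, hab⟩ := (hs.pow_left (m := p - n))
    rw [min_eq_left h, nullityAt_cyclicMod (g := (X - C c) ^ n) (a := a) (b := b) hq0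
      ⟨s, hq⟩ (pow_dvd_pow _ h), natDegree_pow, natDegree_X_sub_C, mul_one]
    obtain ⟨d, rfl⟩ := Nat.exists_eq_add_of_le h
    rw [Nat.add_sub_cancel_left] at hab
    rw [hq, pow_add]
    linear_combination (-(X - C c) ^ n) * hab
  · rw [min_eq_right h, nullityAt_cyclicMod (g := (X - C c) ^ p) (a := 0) (b := 1) hq0
      (hq ▸ (pow_dvd_pow _ h).mul_right s) dvd_rfl (by ring), natDegree_pow,
      natDegree_X_sub_C, mul_one]

end nullity

section cyclic_decomposition

open Polynomial

lemma isTorsion_of_finite_base {W : Type*} [AddCommGroup W] [Module k W] [Module k[X] W]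
    [IsScalarTower k k[X] W] [Module.Finite k W] : Module.IsTorsion k[X] W := by
  intro x
  set φ : Module.End k W := Algebra.lsmul k k W (X : k[X]) with hφ
  have h0 : minpoly k φ ≠ 0 := minpoly.ne_zero (Algebra.IsIntegral.isIntegral φ)
  refine ⟨⟨minpoly k φ, mem_nonZeroDivisors_of_ne_zero h0⟩, ?_⟩
  have h1 := minpoly.aeval k φ
  rw [hφ, aeval_algHom_apply, aeval_X_left_apply] at h1
  exact LinearMap.congr_fun h1 x

/-- A `k[X]`-module which is finite dimensional over an algebraically closed field `k` is a direct
product of modules of the form `k[X] / (X - c) ^ e`. -/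
lemma exists_equiv_pi_cyclicMod {k : Type*} [Field k] [IsAlgClosed k] (W : Type*) [AddCommGroup W]
    [Module k W] [Module k[X] W] [IsScalarTower k k[X] W] [Module.Finite k W] :
    ∃ (n : ℕ) (c : Fin n → k) (e : Fin n → ℕ), (∀ i, e i ≠ 0) ∧
      Nonempty (W ≃ₗ[k[X]] ∀ i, CyclicMod ((X - C (c i)) ^ e i)) := by
  have : Module.Finite k[X] W := Module.Finite.of_restrictScalars_finite k k[X] W
  obtain ⟨ι, hι, p, hp, e, ⟨f⟩⟩ := Module.equiv_directSum_of_isTorsion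
    (isTorsion_of_finite_base (k := k) (W := W))
  have hroot : ∀ i, ∃ c, Associated (X - C c) (p i) := by
    intro i
    obtain ⟨c, hc⟩ := IsAlgClosed.exists_root (p i) (degree_pos_of_irreducible (hp i)).ne'
    exact ⟨c, (irreducible_X_sub_C c).associated_of_dvd (hp i) (dvd_iff_isRoot.2 hc)⟩
  choose c hc using hroot
  classical
  let f1 : W ≃ₗ[k[X]] ∀ i, CyclicMod ((X - C (c i)) ^ e i) :=
    f.trans ((DirectSum.linearEquivFunOnFintype k[X] ι _).trans
      (LinearEquiv.piCongrRight fun i => Submodule.quotEquivOfEq _ _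
        (Ideal.span_singleton_eq_span_singleton.2 ((hc i).symm.pow_pow (n := e i)))))
  let S := {i // e i ≠ 0}
  let g : (∀ i, CyclicMod ((X - C (c i)) ^ e i)) →ₗ[k[X]]
      ∀ i : S, CyclicMod ((X - C (c i)) ^ e i) :=
    LinearMap.pi fun i => LinearMap.proj i.1
  have hsub : ∀ i, e i = 0 → ∀ x : CyclicMod ((X - C (c i)) ^ e i), x = 0 := by
    intro i hi x
    obtain ⟨x, rfl⟩ := Submodule.Quotient.mk_surjective _ x
    rw [Submodule.Quotient.mk_eq_zero, hi, pow_zero, Ideal.span_singleton_one]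
    trivial
  have hg : Function.Bijective g := by
    constructor
    · refine (injective_iff_map_eq_zero g).2 fun x hx => funext fun i => ?_
      by_cases hi : e i = 0
      · exact hsub i hi _
      · exact congrFun hx ⟨i, hi⟩
    · intro y
      refine ⟨fun i => if hi : e i ≠ 0 then y ⟨i, hi⟩ else 0, funext fun i => ?_⟩
      exact dif_pos i.2
  let ε := (Fintype.equivFin S).symm
  exact ⟨Fintype.card S, fun i => c (ε i).1, fun i => e (ε i).1, fun i => (ε i).2,
    ⟨f1.trans ((LinearEquiv.ofBijective g hg).trans
      (LinearEquiv.piCongrLeft k[X] (fun i : S => CyclicMod ((X - C (c i)) ^ e i)) ε).symm)⟩⟩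

lemma isCoprime_X_sub_C_pow {k : Type*} [Field k] {c d : k} (h : c ≠ d) (m n : ℕ) :
    IsCoprime ((X - C c) ^ m) ((X - C d) ^ n) :=
  (isCoprime_X_sub_C_of_isUnit_sub (sub_ne_zero.2 h).isUnit).pow

lemma nullityAt_cyclicMod_primary {k : Type*} [Field k] [DecidableEq k] (c d : k) (e p : ℕ) :
    nullityAt (CyclicMod ((X - C c) ^ e)) ((X - C d) ^ p) = if c = d then min e p else 0 := by
  split_ifs with h
  · subst h
    exact nullityAt_cyclicMod_X_sub_C_pow (s := 1) (by simp) isCoprime_one_right one_ne_zero p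
  · rw [nullityAt_cyclicMod_X_sub_C_pow (c := d) (n := 0) (s := (X - C c) ^ e) (by simp)
      (by simpa using isCoprime_X_sub_C_pow (Ne.symm h) 1 e)
      (pow_ne_zero _ (X_sub_C_ne_zero c)) p]
    simp

/-- The number of indices with value `(d, p + 1)` is a second difference of nullities. -/
lemma card_filter_eq {k : Type*} [DecidableEq k] {n : ℕ} (c : Fin n → k) (e : Fin n → ℕ)
    (d : k) (p : ℕ) :
    ((Finset.univ.filter fun i => (c i, e i) = (d, p + 1)).card : ℤ) =
      2 * ∑ i, (if c i = d then (min (e i) (p + 1) : ℕ) else 0 : ℕ)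
        - ∑ i, (if c i = d then (min (e i) p : ℕ) else 0 : ℕ)
        - ∑ i, (if c i = d then (min (e i) (p + 2) : ℕ) else 0 : ℕ) := by
  rw [Finset.card_filter]
  push_cast
  rw [Finset.mul_sum, ← Finset.sum_sub_distrib, ← Finset.sum_sub_distrib]
  refine Finset.sum_congr rfl fun i _ => ?_
  by_cases h : c i = d
  · simp only [h, Prod.mk.injEq, true_and, if_true]
    split_ifs <;> omega
  · simp [h]

/-- Finite dimensional `k[X]`-modules with the same nullities are isomorphic. -/
lemma equiv_of_nullityAt_eq {k : Type*} [Field k] [IsAlgClosed k] (W W' : Type*) [AddCommGroup W]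
    [Module k W] [Module k[X] W] [IsScalarTower k k[X] W] [Module.Finite k W] [AddCommGroup W']
    [Module k W'] [Module k[X] W'] [IsScalarTower k k[X] W'] [Module.Finite k W']
    (h : ∀ (d : k) (p : ℕ), nullityAt W ((X - C d) ^ p) = nullityAt W' ((X - C d) ^ p)) :
    Nonempty (W ≃ₗ[k[X]] W') := by
  classical
  obtain ⟨n, c, e, he, ⟨f⟩⟩ := exists_equiv_pi_cyclicMod (k := k) W
  obtain ⟨n', c', e', he', ⟨f'⟩⟩ := exists_equiv_pi_cyclicMod (k := k) W'
  have hfin : ∀ (d : k) (e : ℕ), Module.Finite k (CyclicMod ((X - C d) ^ e)) := fun d e =>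
    finite_cyclicMod (pow_ne_zero _ (X_sub_C_ne_zero d))
  have hsum : ∀ (d : k) (p : ℕ), ∑ i, (if c i = d then min (e i) p else 0) =
      ∑ i, (if c' i = d then min (e' i) p else 0) := by
    intro d p
    have := h d p
    rw [nullityAt_congr f, nullityAt_congr f', nullityAt_pi, nullityAt_pi] at this
    simpa only [nullityAt_cyclicMod_primary] using this
  have hcard : ∀ y : k × ℕ, Fintype.card {i // (c i, e i) = y} =
      Fintype.card {i // (c' i, e' i) = y} := by
    rintro ⟨d, q⟩
    rw [Fintype.card_subtype, Fintype.card_subtype]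
    cases q with
    | zero =>
      rw [Finset.filter_eq_empty_iff.2 fun i _ hi => he i (Prod.mk.inj hi).2,
        Finset.filter_eq_empty_iff.2 fun i _ hi => he' i (Prod.mk.inj hi).2, Finset.card_empty,
        Finset.card_empty]
    | succ p =>
      have h1 := card_filter_eq c e d p
      rw [hsum, hsum, hsum, ← card_filter_eq c' e' d p] at h1
      exact_mod_cast h1
  let ε : Fin n ≃ Fin n' := Equiv.ofFiberEquiv (f := fun i => (c i, e i))
    (g := fun i => (c' i, e' i)) fun y => Fintype.equivOfCardEq (hcard y)
  have hε : ∀ i, (c' (ε i), e' (ε i)) = (c i, e i) := fun i =>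
    Equiv.ofFiberEquiv_map (f := fun i => (c i, e i)) (g := fun i => (c' i, e' i)) _ i
  let g : (∀ i, CyclicMod ((X - C (c i)) ^ e i)) ≃ₗ[k[X]]
      ∀ i, CyclicMod ((X - C (c' i)) ^ e' i) :=
    (LinearEquiv.piCongrRight fun i => Submodule.quotEquivOfEq _ _ (by
      rw [(Prod.mk.inj (hε i)).1, (Prod.mk.inj (hε i)).2])).trans
    (LinearEquiv.piCongrLeft k[X] (fun i => CyclicMod ((X - C (c' i)) ^ e' i)) ε)
  exact ⟨f.trans (g.trans f'.symm)⟩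

end cyclic_decomposition

section intertwine

open Polynomial

lemma map_aeval_mulVec {m : ℕ} {M : Matrix (Fin m) (Fin m) k} {W : Type*} [AddCommGroup W]
    [Module k W] [Module k[X] W] [IsScalarTower k k[X] W] (h : (Fin m → k) ≃ₗ[k] W)
    (hX : ∀ u, h (M.mulVec u) = (X : k[X]) • h u) (q : k[X]) (u : Fin m → k) :
    h ((aeval M q).mulVec u) = q • h u := by
  induction q using Polynomial.induction_on' generalizing u with
  | add p q hp hq => rw [map_add, Matrix.add_mulVec, map_add, hp, hq, add_smul]
  | monomial n a =>
    induction n generalizing u with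
    | zero =>
      rw [monomial_zero_left, aeval_C, Algebra.algebraMap_eq_smul_one, Matrix.smul_mulVec,
        Matrix.one_mulVec, map_smul, ← smul_one_smul k[X] a (h u), ← C_mul', mul_one]
    | succ n ih =>
      rw [← monomial_mul_X, map_mul, aeval_X, ← Matrix.mulVec_mulVec, ih, hX, mul_smul]

lemma rank_aeval_add_nullityAt {m : ℕ} {M : Matrix (Fin m) (Fin m) k} {W : Type*}
    [AddCommGroup W] [Module k W] [Module k[X] W] [IsScalarTower k k[X] W]
    (h : (Fin m → k) ≃ₗ[k] W) (hX : ∀ u, h (M.mulVec u) = (X : k[X]) • h u) (q : k[X]) :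
    (aeval M q).rank + nullityAt W q = m := by
  have h1 := LinearMap.finrank_range_add_finrank_ker (aeval M q).mulVecLin
  have h2 : nullityAt W q = Module.finrank k (LinearMap.ker (aeval M q).mulVecLin) := by
    unfold nullityAt
    rw [← LinearEquiv.finrank_map_eq h]
    refine congrArg (fun p : Submodule k W => Module.finrank k p) ?_
    ext x
    simp only [Submodule.mem_map, LinearMap.mem_ker, Algebra.lsmul_coe, Matrix.mulVecLin_apply]
    constructor
    · intro hx
      refine ⟨h.symm x, h.injective ?_, h.apply_symm_apply x⟩
      rw [map_aeval_mulVec h hX, h.apply_symm_apply, hx, map_zero]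
    · rintro ⟨y, hy, rfl⟩
      have := map_aeval_mulVec h hX q y
      rw [hy, map_zero] at this
      exact this.symm
  rw [h2]
  simpa [Matrix.rank] using h1

lemma aeval_X_sub_C_pow {m : ℕ} (M : Matrix (Fin m) (Fin m) k) (d : k) (p : ℕ) :
    aeval M ((X - C d) ^ p) = (M - d • (1 : Matrix (Fin m) (Fin m) k)) ^ p := by
  simp [Algebra.algebraMap_eq_smul_one]

lemma exists_intertwine_module {k : Type*} [Field k] [IsAlgClosed k] {m : ℕ}
    (M : Matrix (Fin m) (Fin m) k) (W : Type*) [AddCommGroup W] [Module k W] [Module k[X] W]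
    [IsScalarTower k k[X] W] [Module.Finite k W]
    (hW : ∀ (d : k) (p : ℕ), ((M - d • (1 : Matrix (Fin m) (Fin m) k)) ^ p).rank +
      nullityAt W ((X - C d) ^ p) = m) :
    ∃ h : (Fin m → k) ≃ₗ[k] W, ∀ u, h (M.mulVec u) = (X : k[X]) • h u := by
  have hof : ∀ u, Module.AEval'.of M.mulVecLin (M.mulVec u) =
      (X : k[X]) • Module.AEval'.of M.mulVecLin u := fun u => by
    rw [Module.AEval'.X_smul_of, Matrix.mulVecLin_apply]
  have : Module.Finite k (Module.AEval' M.mulVecLin) :=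
    Module.Finite.equiv (Module.AEval'.of M.mulVecLin)
  obtain ⟨f⟩ := equiv_of_nullityAt_eq (k := k) (Module.AEval' M.mulVecLin) W fun d p => by
    have h1 := hW d p
    have h2 := rank_aeval_add_nullityAt (Module.AEval'.of M.mulVecLin) hof ((X - C d) ^ p)
    rw [aeval_X_sub_C_pow] at h2
    omega
  refine ⟨(Module.AEval'.of M.mulVecLin).trans (f.restrictScalars k), fun u => ?_⟩
  rw [LinearEquiv.trans_apply, hof]
  exact f.map_smul _ _

/-- Matrices for which the powers of `M - d` have equal ranks are conjugate. -/
lemma exists_intertwine {k : Type*} [Field k] [IsAlgClosed k] {m : ℕ}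
    {M M' : Matrix (Fin m) (Fin m) k}
    (hM : ∀ (d : k) (p : ℕ), ((M - d • (1 : Matrix (Fin m) (Fin m) k)) ^ p).rank =
      ((M' - d • (1 : Matrix (Fin m) (Fin m) k)) ^ p).rank) :
    ∃ h : (Fin m → k) ≃ₗ[k] (Fin m → k), ∀ u, M'.mulVec (h u) = h (M.mulVec u) := by
  have hof : ∀ u, Module.AEval'.of M'.mulVecLin (M'.mulVec u) =
      (X : k[X]) • Module.AEval'.of M'.mulVecLin u := fun u => by
    rw [Module.AEval'.X_smul_of, Matrix.mulVecLin_apply]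
  have : Module.Finite k (Module.AEval' M'.mulVecLin) :=
    Module.Finite.equiv (Module.AEval'.of M'.mulVecLin)
  obtain ⟨h, hh⟩ := exists_intertwine_module M (Module.AEval' M'.mulVecLin) fun d p => by
    rw [hM, ← aeval_X_sub_C_pow]
    exact rank_aeval_add_nullityAt (Module.AEval'.of M'.mulVecLin) hof ((X - C d) ^ p)
  refine ⟨h.trans (Module.AEval'.of M'.mulVecLin).symm, fun u => ?_⟩
  apply (Module.AEval'.of M'.mulVecLin).injective
  rw [hof, LinearEquiv.trans_apply, LinearEquiv.trans_apply, LinearEquiv.apply_symm_apply,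
    LinearEquiv.apply_symm_apply, hh]

/-- The Jordan block data of a matrix: blocks of size `e j` with eigenvalue `c j`. -/
lemma exists_block_data {k : Type*} [Field k] [IsAlgClosed k] [DecidableEq k] {m : ℕ}
    (M : Matrix (Fin m) (Fin m) k) :
    ∃ (n : ℕ) (c : Fin n → k) (e : Fin n → ℕ), (∀ j, e j ≠ 0) ∧ ∑ j, e j = m ∧
      (∀ (d : k) (p : ℕ), ((M - d • (1 : Matrix (Fin m) (Fin m) k)) ^ p).rank +
        ∑ j, (if c j = d then min (e j) p else 0) = m) ∧
      ∀ (l : ℕ) (lam : Fin l → k) (p : Fin l → ℕ), Function.Injective lam →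
        (aeval M (scaledProd lam p 1)).rank +
          ∑ i, ∑ j, (if c j = lam i then min (e j) (p i) else 0) ≤ m := by
  have hof : ∀ u, Module.AEval'.of M.mulVecLin (M.mulVec u) =
      (X : k[X]) • Module.AEval'.of M.mulVecLin u := fun u => by
    rw [Module.AEval'.X_smul_of, Matrix.mulVecLin_apply]
  have : Module.Finite k (Module.AEval' M.mulVecLin) :=
    Module.Finite.equiv (Module.AEval'.of M.mulVecLin)
  obtain ⟨n, c, e, he, ⟨f⟩⟩ := exists_equiv_pi_cyclicMod (k := k) (Module.AEval' M.mulVecLin)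
  have hne : ∀ (d : k) (e : ℕ), (X - C d : k[X]) ^ e ≠ 0 := fun d e =>
    pow_ne_zero _ (X_sub_C_ne_zero d)
  have hfin : ∀ (d : k) (e : ℕ), Module.Finite k (CyclicMod ((X - C d) ^ e)) := fun d e =>
    finite_cyclicMod (hne d e)
  have key : ∀ q : k[X], (aeval M q).rank +
      ∑ j, nullityAt (CyclicMod ((X - C (c j)) ^ e j)) q = m := by
    intro q
    rw [← nullityAt_pi, ← nullityAt_congr f]
    exact rank_aeval_add_nullityAt _ hof q
  refine ⟨n, c, e, he, ?_, fun d p => ?_, fun l lam p hlam => ?_⟩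
  · have := key 0
    rw [map_zero, Matrix.rank_zero, zero_add] at this
    rw [← this]
    refine Finset.sum_congr rfl fun j _ => ?_
    rw [nullityAt_cyclicMod (g := (X - C (c j)) ^ e j) (a := 1) (b := 0) (hne _ _) dvd_rfl
      (dvd_zero _) (by ring)]
    simp
  · have := key ((X - C d) ^ p)
    rw [aeval_X_sub_C_pow] at this
    simpa only [nullityAt_cyclicMod_primary] using this
  · rw [Finset.sum_comm]
    refine le_trans ?_ (key (scaledProd lam p 1)).le
    refine Nat.add_le_add_left (Finset.sum_le_sum fun j _ => ?_) _
    by_cases hj : ∃ i, c j = lam i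
    · obtain ⟨i, hi⟩ := hj
      rw [Finset.sum_eq_single i]
      · rw [if_pos hi]
        have h1 : ((X - C (c j)) ^ min (e j) (p i)).natDegree = min (e j) (p i) := by
          simp
        rw [← h1]
        refine le_nullityAt_cyclicMod (hne _ _) (pow_dvd_pow _ (min_le_left _ _)) ?_
        refine (pow_dvd_pow _ (min_le_right _ _)).trans ?_
        have := Finset.dvd_prod_of_mem (fun i => (X - C (1 * lam i) : k[X]) ^ p i)
          (Finset.mem_univ i)
        simp only [one_mul, ← hi] at this
        simpa only [scaledProd, one_mul] using this
      · intro i' _ hi'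
        rw [if_neg fun h => hi' (hlam (h.symm.trans hi))]
      · simp
    · push Not at hj
      simp [hj]

end intertwine

/-! ### Partitions and Jordan types -/

section partitions

lemma IsPartitionOf.eq_zero {a : ℕ → ℕ} {N i : ℕ} (h : IsPartitionOf a N) (hi : N ≤ i) :
    a i = 0 := by
  obtain ⟨hanti, l, hl, hs⟩ := h
  by_contra h0
  have hil : i < l := by
    by_contra hil
    exact h0 (hl i (not_lt.1 hil))
  have h1 : ∑ _j ∈ Finset.range (i + 1), 1 ≤ ∑ j ∈ Finset.range (i + 1), a j := by
    refine Finset.sum_le_sum fun j hj => ?_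
    have := hanti j i (Nat.lt_succ_iff.1 (Finset.mem_range.1 hj))
    omega
  have h2 : ∑ j ∈ Finset.range (i + 1), a j ≤ ∑ j ∈ Finset.range l, a j :=
    Finset.sum_le_sum_of_subset (Finset.range_mono hil)
  simp only [Finset.sum_const, Finset.card_range, smul_eq_mul, mul_one] at h1
  omega

lemma sum_range_eq_of_eq_zero {f : ℕ → ℕ} {m n : ℕ} (h : ∀ i, m ≤ i → f i = 0) (hmn : m ≤ n) :
    ∑ i ∈ Finset.range n, f i = ∑ i ∈ Finset.range m, f i := by
  refine (Finset.sum_subset (Finset.range_mono hmn) fun i _ hi => h i ?_).symm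
  simpa using hi

lemma IsPartitionOf.sum_eq {a : ℕ → ℕ} {N n : ℕ} (h : IsPartitionOf a N) (hn : N ≤ n) :
    ∑ i ∈ Finset.range n, a i = N := by
  obtain ⟨_, l, hl, hs⟩ := id h
  rw [sum_range_eq_of_eq_zero (fun i hi => h.eq_zero hi) hn]
  refine Eq.trans ?_ hs
  rcases le_total l N with h1 | h1
  · exact sum_range_eq_of_eq_zero hl h1
  · exact (sum_range_eq_of_eq_zero (fun i hi => h.eq_zero hi) h1).symm

lemma isPartitionOf_of_sum {a : ℕ → ℕ} {n N : ℕ} (h : ∀ i j, i ≤ j → a j ≤ a i)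
    (h0 : ∀ i, n ≤ i → a i = 0) (hs : ∑ i ∈ Finset.range n, a i = N) : IsPartitionOf a N :=
  ⟨h, n, h0, hs⟩

lemma Dominates.antisymm {a b : ℕ → ℕ} (h : Dominates a b) (h' : Dominates b a) : a = b := by
  have : ∀ m, ∑ i ∈ Finset.range m, a i = ∑ i ∈ Finset.range m, b i := fun m =>
    le_antisymm (h' m) (h m)
  funext m
  have h1 := this (m + 1)
  rw [Finset.sum_range_succ, Finset.sum_range_succ, this m] at h1
  omega

lemma Dominates.trans {a b c : ℕ → ℕ} (h : Dominates a b) (h' : Dominates b c) :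
    Dominates a c := fun m => (h' m).trans (h m)

lemma sum_range_min_le (b : ℕ → ℕ) {N t : ℕ} (p : ℕ) (ht : t ≤ N) :
    ∑ i ∈ Finset.range N, min (b i) p + ∑ i ∈ Finset.range t, b i ≤
      t * p + ∑ i ∈ Finset.range N, b i := by
  rw [← Finset.sum_range_add_sum_Ico _ ht, ← Finset.sum_range_add_sum_Ico b ht]
  have h1 : ∑ i ∈ Finset.range t, min (b i) p ≤ ∑ _i ∈ Finset.range t, p :=
    Finset.sum_le_sum fun i _ => min_le_right _ _
  have h2 : ∑ i ∈ Finset.Ico t N, min (b i) p ≤ ∑ i ∈ Finset.Ico t N, b i :=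
    Finset.sum_le_sum fun i _ => min_le_left _ _
  simp only [Finset.sum_const, Finset.card_range, smul_eq_mul] at h1
  omega

lemma sum_range_min_eq {a : ℕ → ℕ} (ha : ∀ i j, i ≤ j → a j ≤ a i) {N t : ℕ} (ht : t ≤ N) :
    ∑ i ∈ Finset.range N, min (a i) (a t) + ∑ i ∈ Finset.range t, a i =
      t * a t + ∑ i ∈ Finset.range N, a i := by
  rw [← Finset.sum_range_add_sum_Ico _ ht, ← Finset.sum_range_add_sum_Ico a ht]
  have h1 : ∑ i ∈ Finset.range t, min (a i) (a t) = ∑ _i ∈ Finset.range t, a t :=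
    Finset.sum_congr rfl fun i hi => min_eq_right (ha i t (Finset.mem_range.1 hi).le)
  have h2 : ∑ i ∈ Finset.Ico t N, min (a i) (a t) = ∑ i ∈ Finset.Ico t N, a i :=
    Finset.sum_congr rfl fun i hi => min_eq_left (ha t i (Finset.mem_Ico.1 hi).1)
  simp only [Finset.sum_const, Finset.card_range, smul_eq_mul] at h1
  omega

/-- Comparison of the sums of truncations at the values of `a` yields dominance. -/
lemma dominates_of_sum_min_le {a b : ℕ → ℕ} {N : ℕ} (ha : ∀ i j, i ≤ j → a j ≤ a i)
    (ha0 : ∀ i, N ≤ i → a i = 0) (hb0 : ∀ i, N ≤ i → b i = 0)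
    (hab : ∑ i ∈ Finset.range N, b i = ∑ i ∈ Finset.range N, a i)
    (h : ∀ t, ∑ i ∈ Finset.range N, min (a i) (a t) ≤ ∑ i ∈ Finset.range N, min (b i) (a t)) :
    Dominates a b := by
  intro t
  rcases le_total t N with ht | ht
  · have h1 := sum_range_min_eq ha ht
    have h2 := sum_range_min_le b (a t) ht
    have h3 := h t
    omega
  · rw [sum_range_eq_of_eq_zero ha0 ht, sum_range_eq_of_eq_zero hb0 ht, hab]

/-- Sorting a finite family of natural numbers. -/
lemma exists_partition_of_family {n N : ℕ} (f : Fin n → ℕ) (hn : n ≤ N) :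
    ∃ a, IsPartitionOf a (∑ j, f j) ∧
      ∀ p, ∑ i ∈ Finset.range N, min (a i) p = ∑ j, min (f j) p := by
  set σ := Tuple.sort f with hσ
  have hmono : Monotone (f ∘ σ) := Tuple.monotone_sort f
  set a : ℕ → ℕ := fun i => if h : i < n then f (σ (Fin.rev ⟨i, h⟩)) else 0 with ha
  have ha0 : ∀ i, n ≤ i → a i = 0 := fun i hi => dif_neg (not_lt.2 hi)
  have hsum : ∀ F : ℕ → ℕ, ∑ i ∈ Finset.range n, F (a i) = ∑ j, F (f j) := by
    intro F
    rw [Finset.sum_range, ← Equiv.sum_comp (Fin.revPerm.trans σ) fun j => F (f j)]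
    refine Finset.sum_congr rfl fun i _ => ?_
    simp [ha]
  refine ⟨a, isPartitionOf_of_sum (fun i j hij => ?_) ha0 (hsum id), fun p => ?_⟩
  · by_cases hj : j < n
    · simp only [ha, dif_pos hj, dif_pos (hij.trans_lt hj)]
      exact hmono (Fin.rev_le_rev.2 hij)
    · rw [ha0 j (not_lt.1 hj)]
      exact Nat.zero_le _
  · rw [sum_range_eq_of_eq_zero (fun i hi => by rw [ha0 i hi, Nat.zero_min]) hn]
    exact hsum fun x => min x p

end partitions

section jordan

lemma IsJordanTypeAt.rank_add {m : ℕ} {M : Matrix (Fin m) (Fin m) k} {d : k} {a : ℕ → ℕ}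
    (h : IsJordanTypeAt M d a) (p : ℕ) :
    ((M - d • (1 : Matrix (Fin m) (Fin m) k)) ^ p).rank +
      ∑ i ∈ Finset.range m, min (a i) p = m := by
  have h1 : ∑ i ∈ Finset.range m, min (a i) p ≤ ∑ i ∈ Finset.range m, a i :=
    Finset.sum_le_sum fun i _ => min_le_left _ _
  rw [h.1.sum_eq (Nat.sub_le _ _)] at h1
  rw [h.2 p]
  omega

lemma IsJordanTypeAt.eq_zero {m : ℕ} {M : Matrix (Fin m) (Fin m) k} {d : k} {a : ℕ → ℕ}
    (h : IsJordanTypeAt M d a) {i : ℕ} (hi : m ≤ i) : a i = 0 :=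
  h.1.eq_zero ((Nat.sub_le _ _).trans hi)

lemma IsJordanTypeAt.le {m : ℕ} {M : Matrix (Fin m) (Fin m) k} {d : k} {a : ℕ → ℕ}
    (h : IsJordanTypeAt M d a) (i : ℕ) : a i ≤ m := by
  rcases le_or_gt m i with hi | hi
  · rw [h.eq_zero hi]
    exact Nat.zero_le _
  · refine (Finset.single_le_sum (f := a) (fun _ _ => Nat.zero_le _)
      (Finset.mem_range.2 hi)).trans ?_
    rw [h.1.sum_eq (Nat.sub_le _ _)]
    exact Nat.sub_le _ _

lemma isJordanTypeAt_of_rank_add {m T : ℕ} {M : Matrix (Fin m) (Fin m) k} {d : k} {a : ℕ → ℕ}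
    (ha : IsPartitionOf a T) (hT : T ≤ m)
    (h : ∀ p, ((M - d • (1 : Matrix (Fin m) (Fin m) k)) ^ p).rank +
      ∑ i ∈ Finset.range m, min (a i) p = m) : IsJordanTypeAt M d a := by
  refine ⟨?_, fun p => by have := h p; omega⟩
  have h1 := h m
  have h2 : ∑ i ∈ Finset.range m, min (a i) m = T := by
    rw [← ha.sum_eq hT]
    refine Finset.sum_congr rfl fun i hi => min_eq_left ?_
    refine (Finset.single_le_sum (f := a) (fun _ _ => Nat.zero_le _) hi).trans ?_
    rw [ha.sum_eq hT]
    exact hT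
  rw [show m - ((M - d • (1 : Matrix (Fin m) (Fin m) k)) ^ m).rank = T by omega]
  exact ha

lemma exists_isJordanTypeAt {k : Type*} [Field k] [IsAlgClosed k] {m : ℕ}
    (M : Matrix (Fin m) (Fin m) k) (d : k) : ∃ a, IsJordanTypeAt M d a := by
  classical
  obtain ⟨n, c, e, he, hm, hr, -⟩ := exists_block_data M
  have hn : n ≤ m := by
    have : ∑ _j : Fin n, 1 ≤ ∑ j, e j :=
      Finset.sum_le_sum fun j _ => Nat.one_le_iff_ne_zero.2 (he j)
    simpa [hm] using this
  obtain ⟨a, ha, hap⟩ := exists_partition_of_family (fun j => if c j = d then e j else 0) hn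
  refine ⟨a, isJordanTypeAt_of_rank_add ha ?_ fun p => ?_⟩
  · rw [← hm]
    exact Finset.sum_le_sum fun j _ => by split_ifs <;> omega
  · rw [hap]
    refine Eq.trans ?_ (hr d p)
    congr 1
    exact Finset.sum_congr rfl fun j _ => by split_ifs <;> simp

lemma exists_eigenvector_of_rank_lt {m : ℕ} {M : Matrix (Fin m) (Fin m) k} {d : k}
    (h : (M - d • (1 : Matrix (Fin m) (Fin m) k)).rank < m) :
    ∃ v : Fin m → k, v ≠ 0 ∧ M.mulVec v = d • v := by
  by_contra hv
  push Not at hv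
  have hinj : Function.Injective (M - d • (1 : Matrix (Fin m) (Fin m) k)).mulVecLin := by
    refine (injective_iff_map_eq_zero _).2 fun v h0 => ?_
    by_contra hne
    refine hv v hne ?_
    rw [Matrix.mulVecLin_apply, Matrix.sub_mulVec, Matrix.smul_mulVec, Matrix.one_mulVec,
      sub_eq_zero] at h0
    exact h0
  have := LinearMap.finrank_range_of_inj hinj
  rw [Module.finrank_fin_fun] at this
  exact h.ne this

lemma rank_lt_of_eigenvector {m : ℕ} {M : Matrix (Fin m) (Fin m) k} {d : k} {v : Fin m → k}
    (hv : v ≠ 0) (h : M.mulVec v = d • v) :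
    (M - d • (1 : Matrix (Fin m) (Fin m) k)).rank < m := by
  have h1 : (M - d • (1 : Matrix (Fin m) (Fin m) k)).rank ≤ m - 1 := by
    refine rank_lt_of_mulVec_eq_zero hv ?_
    rw [Matrix.sub_mulVec, Matrix.smul_mulVec, Matrix.one_mulVec, h, sub_self]
  have h2 : m ≠ 0 := by
    rintro rfl
    exact hv (Subsingleton.elim _ _)
  omega

end jordan

section specter

open Polynomial

lemma sum_sum_ite_eq {l n : ℕ} {K : Type*} [DecidableEq K] {lam : Fin l → K} {c : Fin n → K}
    (hlam : Function.Injective lam) (e : Fin n → ℕ) :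
    ∑ i, ∑ j, (if c j = lam i then e j else 0) =
      ∑ j, (if ∃ i, c j = lam i then e j else 0) := by
  classical
  rw [Finset.sum_comm]
  refine Finset.sum_congr rfl fun j _ => ?_
  split_ifs with h
  · obtain ⟨i, hi⟩ := h
    rw [Finset.sum_eq_single i, if_pos hi]
    · exact fun i' _ hi' => if_neg fun h => hi' (hlam (h.symm.trans hi))
    · simp
  · push Not at h
    exact Finset.sum_eq_zero fun i _ => if_neg (h i)

variable {k : Type*} [Field k] [IsAlgClosed k] {m l : ℕ} {M : Matrix (Fin m) (Fin m) k}
  {lam : Fin l → k} {a : Fin l → ℕ → ℕ}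

/-- The Jordan block data of a matrix with a given full specter. -/
lemma IsFullSpecter.exists_block_data [DecidableEq k] (h : IsFullSpecter M lam a) :
    ∃ (n : ℕ) (c : Fin n → k) (e : Fin n → ℕ), (∀ j, ∃ i, c j = lam i) ∧ ∑ j, e j = m ∧
      (∀ (d : k) (p : ℕ), ((M - d • (1 : Matrix (Fin m) (Fin m) k)) ^ p).rank +
        ∑ j, (if c j = d then min (e j) p else 0) = m) ∧
      (∀ i p, ∑ t ∈ Finset.range m, min (a i t) p =
        ∑ j, (if c j = lam i then min (e j) p else 0)) ∧
      ∀ p : Fin l → ℕ, (aeval M (scaledProd lam p 1)).rank +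
          ∑ i, ∑ t ∈ Finset.range m, min (a i t) (p i) ≤ m := by
  obtain ⟨n, c, e, he, hm, hr, hp⟩ := _root_.exists_block_data M
  have hsum : ∀ i p, ∑ t ∈ Finset.range m, min (a i t) p =
      ∑ j, (if c j = lam i then min (e j) p else 0) := by
    intro i p
    have h1 := (h.2.1 i).1.rank_add p
    have h2 := hr (lam i) p
    omega
  refine ⟨n, c, e, fun j => ?_, hm, hr, hsum, fun p => ?_⟩
  · have h1 := hr (c j) 1
    have h2 : 1 ≤ ∑ j', (if c j' = c j then min (e j') 1 else 0) := by
      refine le_trans ?_ (Finset.single_le_sum (fun _ _ => Nat.zero_le _) (Finset.mem_univ j))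
      have := he j
      simp only [if_true]
      omega
    rw [pow_one] at h1
    obtain ⟨v, hv, hv'⟩ := exists_eigenvector_of_rank_lt (M := M) (d := c j) (by omega)
    obtain ⟨i, hi⟩ := h.2.2 _ ⟨v, hv, hv'⟩
    exact ⟨i, hi.symm⟩
  · simp only [hsum]
    exact hp l lam p h.1

lemma IsFullSpecter.sum_total (h : IsFullSpecter M lam a) :
    ∑ i, ∑ t ∈ Finset.range m, a i t = m := by
  classical
  obtain ⟨n, c, e, hc, hm, -, hsum, -⟩ := h.exists_block_data
  have he : ∀ j, e j ≤ m := fun j => by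
    rw [← hm]
    exact Finset.single_le_sum (f := e) (fun _ _ => Nat.zero_le _) (Finset.mem_univ j)
  have h1 : ∀ i, ∑ t ∈ Finset.range m, a i t = ∑ j, (if c j = lam i then e j else 0) := by
    intro i
    have := hsum i m
    simp only [min_eq_left (he _)] at this
    rw [← this]
    exact Finset.sum_congr rfl fun t _ => (min_eq_left ((h.2.1 i).1.le t)).symm
  simp only [h1, sum_sum_ite_eq h.1, hc, if_true, hm]

lemma IsFullSpecter.rank_eq_of_not_exists (h : IsFullSpecter M lam a) {d : k}
    (hd : ¬∃ i, lam i = d) (p : ℕ) :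
    ((M - d • (1 : Matrix (Fin m) (Fin m) k)) ^ p).rank = m := by
  classical
  obtain ⟨n, c, e, hc, -, hr, -, -⟩ := h.exists_block_data
  have h1 := hr d p
  rw [Finset.sum_eq_zero, add_zero] at h1
  · exact h1
  · intro j _
    obtain ⟨i, hi⟩ := hc j
    exact if_neg fun h => hd ⟨i, hi.symm.trans h⟩

lemma IsFullSpecter.rank_eq {X : Matrix (Fin m) (Fin m) k} (h : IsFullSpecter M lam a)
    (h' : IsFullSpecter X lam a) (d : k) (p : ℕ) :
    ((M - d • (1 : Matrix (Fin m) (Fin m) k)) ^ p).rank =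
      ((X - d • (1 : Matrix (Fin m) (Fin m) k)) ^ p).rank := by
  by_cases hd : ∃ i, lam i = d
  · obtain ⟨i, rfl⟩ := hd
    have h1 := (h.2.1 i).1.rank_add p
    have h2 := (h'.2.1 i).1.rank_add p
    omega
  · rw [h.rank_eq_of_not_exists hd, h'.rank_eq_of_not_exists hd]

/-- A matrix whose powers at the eigenvalues of `M` have smaller ranks has the same spectrum,
with smaller Jordan types. -/
lemma IsFullSpecter.exists_of_rank_le {X : Matrix (Fin m) (Fin m) k} (h : IsFullSpecter M lam a)
    (hX : ∀ i p, ((X - lam i • (1 : Matrix (Fin m) (Fin m) k)) ^ p).rank ≤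
      ((M - lam i • (1 : Matrix (Fin m) (Fin m) k)) ^ p).rank) :
    ∃ a', IsFullSpecter X lam a' ∧ ∀ i, Dominates (a i) (a' i) := by
  classical
  have hex := fun i => exists_isJordanTypeAt X (lam i)
  choose a' ha' using hex
  obtain ⟨n, c, e, he, hm, hr, -⟩ := _root_.exists_block_data X
  have hmin : ∀ i p, ∑ t ∈ Finset.range m, min (a i t) p ≤
      ∑ t ∈ Finset.range m, min (a' i t) p := by
    intro i p
    have h1 := (h.2.1 i).1.rank_add p
    have h2 := (ha' i).rank_add p
    have h3 := hX i p
    omega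
  have htot : ∀ i, ∑ t ∈ Finset.range m, a i t ≤ ∑ t ∈ Finset.range m, a' i t := by
    intro i
    have := hmin i m
    simpa only [min_eq_left ((h.2.1 i).1.le _), min_eq_left ((ha' i).le _)] using this
  have hej : ∀ j, e j ≤ m := fun j => by
    rw [← hm]
    exact Finset.single_le_sum (f := e) (fun _ _ => Nat.zero_le _) (Finset.mem_univ j)
  have h1 : ∀ i, ∑ t ∈ Finset.range m, a' i t = ∑ j, (if c j = lam i then e j else 0) := by
    intro i
    have h1 := (ha' i).rank_add m
    have h2 := hr (lam i) m
    simp only [min_eq_left ((ha' i).le _)] at h1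
    simp only [min_eq_left (hej _)] at h2
    omega
  have h2 : ∑ i, ∑ t ∈ Finset.range m, a' i t =
      ∑ j, (if ∃ i, c j = lam i then e j else 0) := by
    simp only [h1, sum_sum_ite_eq h.1]
  have h3 : ∑ j, (if ∃ i, c j = lam i then e j else 0) ≤ ∑ j, e j :=
    Finset.sum_le_sum fun j _ => by split_ifs <;> omega
  have h4 := h.sum_total
  have h5 : ∑ i, ∑ t ∈ Finset.range m, a i t ≤ ∑ i, ∑ t ∈ Finset.range m, a' i t :=
    Finset.sum_le_sum fun i _ => htot i
  have h6 : ∀ i, ∑ t ∈ Finset.range m, a i t = ∑ t ∈ Finset.range m, a' i t := by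
    have := (Finset.sum_eq_sum_iff_of_le (s := Finset.univ) fun i _ => htot i).1 (by omega)
    exact fun i => this i (Finset.mem_univ i)
  have h7 : ∀ j, ∃ i, c j = lam i := by
    have := (Finset.sum_eq_sum_iff_of_le (s := Finset.univ)
      (f := fun j => if ∃ i, c j = lam i then e j else 0) (g := e)
      fun j _ => by split_ifs <;> omega).1 (by omega)
    intro j
    by_contra hj
    have h8 := this j (Finset.mem_univ j)
    rw [if_neg hj] at h8
    exact he j h8.symm
  refine ⟨a', ⟨h.1, fun i => ⟨ha' i, fun h0 => ?_⟩, ?_⟩, fun i => ?_⟩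
  · have h8 : ∑ t ∈ Finset.range m, a' i t = 0 := Finset.sum_eq_zero fun t _ =>
      Nat.le_zero.1 (h0 ▸ (ha' i).1.1 0 t (Nat.zero_le _))
    rw [← h6 i] at h8
    refine (h.2.1 i).2 ?_
    rcases Nat.eq_zero_or_pos m with hm0 | hm0
    · exact (h.2.1 i).1.eq_zero hm0.le
    · exact Finset.sum_eq_zero_iff.1 h8 0 (Finset.mem_range.2 hm0)
  · rintro d ⟨v, hv, hv'⟩
    have h8 := rank_lt_of_eigenvector hv hv'
    have h9 := hr d 1
    rw [pow_one] at h9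
    by_contra hd
    rw [Finset.sum_eq_zero] at h9
    · omega
    · intro j _
      obtain ⟨i, hi⟩ := h7 j
      exact if_neg fun h => hd ⟨i, hi.symm.trans h⟩
  · exact dominates_of_sum_min_le (h.2.1 i).1.1.1 (fun t ht => (h.2.1 i).1.eq_zero ht)
      (fun t ht => (ha' i).eq_zero ht) (h6 i).symm fun t => hmin i _

lemma IsFullSpecter.isPartitionOf_sum (h : IsFullSpecter M lam a) :
    IsPartitionOf (fun t => ∑ i, a i t) m := by
  refine isPartitionOf_of_sum (n := m)
    (fun s t hst => Finset.sum_le_sum fun i _ => (h.2.1 i).1.1.1 s t hst)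
    (fun t ht => Finset.sum_eq_zero fun i _ => (h.2.1 i).1.eq_zero ht) ?_
  rw [Finset.sum_comm]
  exact h.sum_total

lemma sum_min_sum_eq {l : ℕ} {a : Fin l → ℕ → ℕ} (ha : ∀ i s t, s ≤ t → a i t ≤ a i s)
    (m t : ℕ) : ∑ i, ∑ j ∈ Finset.range m, min (a i j) (a i t) =
      ∑ j ∈ Finset.range m, min (∑ i, a i j) (∑ i, a i t) := by
  rw [Finset.sum_comm]
  refine Finset.sum_congr rfl fun j _ => ?_
  rcases le_total j t with h | h
  · rw [min_eq_right (Finset.sum_le_sum fun i _ => ha i j t h)]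
    exact Finset.sum_congr rfl fun i _ => min_eq_right (ha i j t h)
  · rw [min_eq_left (Finset.sum_le_sum fun i _ => ha i t j h)]
    exact Finset.sum_congr rfl fun i _ => min_eq_left (ha i t j h)

lemma IsFullSpecter.exists_nilpotent {X : Matrix (Fin m) (Fin m) k} (h : IsFullSpecter M lam a)
    (hX : ∀ p : Fin l → ℕ, (aeval X (scaledProd lam p 0)).rank ≤
      (aeval M (scaledProd lam p 1)).rank) :
    ∃ b, IsJordanTypeAt X 0 b ∧ IsPartitionOf b m ∧ Dominates (fun t => ∑ i, a i t) b := by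
  classical
  obtain ⟨n, c, e, -, -, -, -, hp⟩ := h.exists_block_data
  obtain ⟨b, hb⟩ := exists_isJordanTypeAt X 0
  have key : ∀ p : Fin l → ℕ, ∑ i, ∑ t ∈ Finset.range m, min (a i t) (p i) ≤
      ∑ t ∈ Finset.range m, min (b t) (∑ i, p i) := by
    intro p
    have h1 := hp p
    have h2 := hX p
    have h3 : aeval X (scaledProd lam p 0) =
        (X - (0 : k) • (1 : Matrix (Fin m) (Fin m) k)) ^ ∑ i, p i := by
      simp [scaledProd, Finset.prod_pow_eq_pow_sum]
    rw [h3] at h2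
    have h4 := hb.rank_add (∑ i, p i)
    omega
  have htot : m ≤ ∑ t ∈ Finset.range m, b t := by
    have h1 := key fun _ => m
    simp only [min_eq_left ((h.2.1 _).1.le _)] at h1
    rw [h.sum_total] at h1
    exact h1.trans (Finset.sum_le_sum fun t _ => min_le_left _ _)
  have htot' : ∑ t ∈ Finset.range m, b t = m := by
    refine le_antisymm ?_ htot
    rw [hb.1.sum_eq (Nat.sub_le _ _)]
    exact Nat.sub_le _ _
  refine ⟨b, hb, isPartitionOf_of_sum hb.1.1 (fun i hi => hb.eq_zero hi) htot',
    dominates_of_sum_min_le h.isPartitionOf_sum.1 (fun t ht => h.isPartitionOf_sum.eq_zero ht)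
      (fun t ht => hb.eq_zero ht) ?_ fun t => ?_⟩
  · rw [htot', h.isPartitionOf_sum.sum_eq le_rfl]
  · have := key fun i => a i t
    rwa [sum_min_sum_eq fun i => (h.2.1 i).1.1.1] at this

end specter

/-! ### Degenerations of `Tstr r M` -/

section companion

open Polynomial

/-- The entries of a block companion matrix. -/
def companionEntry {R : Type*} [CommRing R] {m : ℕ} (b : Fin m → ℕ)
    (c : (Σ l, Fin (b l)) → Fin m → R) (x y : Σ l, Fin (b l)) : R :=
  if (y.2 : ℕ) + 1 < b y.1 then if x.1 = y.1 ∧ (x.2 : ℕ) = y.2 + 1 then 1 else 0 else c x y.1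

/-- The block companion matrix with blocks of sizes `b l` and last columns given by `c`. -/
def companion {R : Type*} [CommRing R] {m : ℕ} (b : Fin m → ℕ) (ε : (Σ l, Fin (b l)) ≃ Fin m)
    (c : (Σ l, Fin (b l)) → Fin m → R) : Matrix (Fin m) (Fin m) R :=
  Matrix.of fun i j => companionEntry b c (ε.symm i) (ε.symm j)

lemma companion_map {R S : Type*} [CommRing R] [CommRing S] (f : R →+* S) {m : ℕ} (b : Fin m → ℕ)
    (ε : (Σ l, Fin (b l)) ≃ Fin m) (c : (Σ l, Fin (b l)) → Fin m → R) :
    (companion b ε c).map f = companion b ε fun x l => f (c x l) := by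
  ext i j
  simp only [companion, companionEntry, Matrix.map_apply, Matrix.of_apply]
  split_ifs <;> simp

lemma exists_equiv_companion {m : ℕ} (b : Fin m → ℕ) (ε : (Σ l, Fin (b l)) ≃ Fin m) {W : Type*}
    [AddCommGroup W] [Module k W] [Module k[X] W] [IsScalarTower k k[X] W]
    (hW : Module.finrank k W = m) {t : k} (ht : t ≠ 0) (w : Fin m → W)
    (hw : Submodule.span k[X] (Set.range w) = ⊤) (c : (Σ l, Fin (b l)) → Fin m → k)
    (hc : ∀ l, (C t * X : k[X]) ^ b l • w l = ∑ x, c x l • (C t * X : k[X]) ^ (x.2 : ℕ) • w x.1) :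
    ∃ h : (Fin m → k) ≃ₗ[k] W, ∀ u,
      (C t * X : k[X]) • h u = h ((companion b ε c).mulVec u) := by
  set Y : k[X] := C t * X with hY
  set v : (Σ l, Fin (b l)) → W := fun x => Y ^ (x.2 : ℕ) • w x.1 with hv
  have hcol : ∀ y, Y • v y = ∑ x, (companion b ε c) (ε x) (ε y) • v x := by
    intro y
    simp only [companion, Matrix.of_apply, Equiv.symm_apply_apply]
    unfold companionEntry
    split_ifs with h
    · rw [Finset.sum_eq_single ⟨y.1, ⟨y.2 + 1, h⟩⟩]
      · simp [hv, smul_smul, pow_succ']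
      · rintro ⟨x1, x2⟩ _ hx
        rw [if_neg, zero_smul]
        rintro ⟨h1, h2⟩
        dsimp only at h1 h2
        subst h1
        exact hx (by congr 1; exact Fin.ext h2)
      · simp
    · rw [← hc y.1]
      have : b y.1 = y.2 + 1 := by have := y.2.2; omega
      rw [this, pow_succ']
      exact smul_smul _ _ _
  set S : Submodule k W := Submodule.span k (Set.range v) with hS
  have hstab : ∀ x ∈ S, (X : k[X]) • x ∈ S := by
    have hYS : ∀ x ∈ S, Y • x ∈ S := by
      intro x hx
      induction hx using Submodule.span_induction with
      | mem x hx =>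
        obtain ⟨y, rfl⟩ := hx
        rw [hcol]
        exact Submodule.sum_mem _ fun x _ =>
          S.smul_mem _ (Submodule.subset_span (Set.mem_range_self x))
      | zero => rw [smul_zero]; exact S.zero_mem
      | add x y _ _ hx hy => rw [smul_add]; exact S.add_mem hx hy
      | smul a x _ hx => rw [smul_comm]; exact S.smul_mem a hx
    intro x hx
    have h1 : (X : k[X]) • x = t⁻¹ • Y • x := by
      rw [← smul_assoc, hY, smul_eq_C_mul, ← mul_assoc, ← C_mul, inv_mul_cancel₀ ht, C_1, one_mul]
    rw [h1]
    exact S.smul_mem _ (hYS x hx)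
  have hpoly : ∀ (q : k[X]) (x), x ∈ S → q • x ∈ S := by
    intro q
    induction q using Polynomial.induction_on' with
    | add p q hp hq =>
      intro x hx
      rw [add_smul]
      exact S.add_mem (hp x hx) (hq x hx)
    | monomial n a =>
      induction n with
      | zero =>
        intro x hx
        rw [monomial_zero_left, ← mul_one (C a), C_mul', smul_assoc, one_smul]
        exact S.smul_mem a hx
      | succ n ih =>
        intro x hx
        rw [← monomial_mul_X, mul_smul]
        exact ih _ (hstab x hx)
  have hwS : ∀ l, w l ∈ S := by
    intro l
    rcases Nat.eq_zero_or_pos (b l) with h | h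
    · have h1 := hc l
      rw [h, pow_zero, one_smul] at h1
      rw [h1]
      exact Submodule.sum_mem _ fun x _ =>
        S.smul_mem _ (Submodule.subset_span (Set.mem_range_self x))
    · have : v ⟨l, ⟨0, h⟩⟩ = w l := by simp [hv]
      rw [← this]
      exact Submodule.subset_span (Set.mem_range_self _)
  have htop : ⊤ ≤ S := by
    intro x _
    have hx : x ∈ Submodule.span k[X] (Set.range w) := hw ▸ Submodule.mem_top
    induction hx using Submodule.span_induction with
    | mem x hx => obtain ⟨l, rfl⟩ := hx; exact hwS l
    | zero => exact S.zero_mem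
    | add x y _ _ hx hy => exact S.add_mem (hx trivial) (hy trivial)
    | smul a x _ hx => exact hpoly a x (hx trivial)
  let B := basisOfTopLeSpanOfCardEqFinrank v htop (by rw [hW, Fintype.card_congr ε, Fintype.card_fin])
  have hB : ∀ x, B x = v x := fun x => by simp [B]
  refine ⟨(B.reindex ε).equivFun.symm, fun u => ?_⟩
  simp only [Module.Basis.equivFun_symm_apply, Module.Basis.reindex_apply, hB]
  rw [Finset.smul_sum]
  rw [← Equiv.sum_comp ε, ← Equiv.sum_comp ε]
  simp only [Equiv.symm_apply_apply, smul_comm Y, hcol]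
  simp only [Matrix.mulVec, dotProduct, Finset.smul_sum, Finset.sum_smul]
  rw [Finset.sum_comm]
  refine Finset.sum_congr rfl fun x _ => ?_
  rw [← Equiv.sum_comp ε]
  exact Finset.sum_congr rfl fun y _ => by rw [smul_smul, mul_comm]

end companion

section degenerations

open Polynomial

lemma degenerates_tstr_of_curve [Infinite k] {m : ℕ} {r : k} {M : Matrix (Fin m) (Fin m) k}
    (ρ : k[X]) (Q : Matrix (Fin m) (Fin m) k[X])
    (h : ∀ t : k, t ≠ 0 → Tstr (ρ.eval t) (Q.map (evalRingHom t)) ∈ orbit (Tstr r M)) :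
    degenerates (Tstr r M) (Tstr (ρ.eval 0) (Q.map (evalRingHom 0))) := by
  refine mem_zclosure_of_curve (fun t => Tstr (ρ.eval t) (Q.map (evalRingHom t)))
    (fun x => if hi : x.1 = 0 then
      if hj : x.2.1 = 0 then (if x.2.2 = 0 then ρ else 0)
      else if hmm : x.2.2 = 0 then 0 else Q (x.2.2.pred hmm) (x.2.1.pred hj)
    else if hj : x.2.1 = 0 then
      if hmm : x.2.2 = 0 then 0 else (if x.1 = x.2.2 then ρ else 0) - Q (x.2.2.pred hmm) (x.1.pred hi)
    else 0) ?_ h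
  rintro t ⟨i, j, l⟩
  rw [Tstr, structConst_ofConst]
  dsimp only
  split_ifs <;> simp

/-- The generator of the `s`-th summand of a sum of cyclic modules. -/
def cyclicGen {m : ℕ} (q : Fin m → k[X]) (s : Fin m) : ∀ s, CyclicMod (q s) :=
  Pi.single s (Submodule.Quotient.mk (1 : k[X]) : CyclicMod (q s))

lemma smul_cyclicGen {m : ℕ} (q : Fin m → k[X]) (s : Fin m) (y : k[X]) :
    y • cyclicGen q s = Pi.single s (Submodule.Quotient.mk y : CyclicMod (q s)) := by
  rw [cyclicGen, ← Pi.single_smul, ← Submodule.Quotient.mk_smul, smul_eq_mul, mul_one]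

lemma smul_cyclicGen_self {m : ℕ} (q : Fin m → k[X]) (s : Fin m) : q s • cyclicGen q s = 0 := by
  rw [smul_cyclicGen, (Submodule.Quotient.mk_eq_zero _).2 (Ideal.mem_span_singleton_self _),
    Pi.single_zero]

lemma span_cyclicGen_eq_top {m : ℕ} (q : Fin m → k[X]) {S : Submodule k[X] (∀ s, CyclicMod (q s))}
    (hS : ∀ s, cyclicGen q s ∈ S) : S = ⊤ := by
  rw [eq_top_iff]
  intro x _
  rw [← Finset.univ_sum_single x]
  refine Submodule.sum_mem _ fun s _ => ?_
  obtain ⟨y, hy⟩ := Submodule.Quotient.mk_surjective _ (x s)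
  rw [← hy, ← smul_cyclicGen]
  exact S.smul_mem _ (hS s)

variable {k : Type*} [Field k] [IsAlgClosed k] {m l : ℕ} {M : Matrix (Fin m) (Fin m) k}
  {lam : Fin l → k} {a : Fin l → ℕ → ℕ}

/-- The rational canonical form attached to a full specter. -/
lemma IsFullSpecter.exists_equiv (h : IsFullSpecter M lam a) (q : Fin m → k[X])
    (hq : ∀ s, q s = ∏ i, (X - C (lam i)) ^ a i s) :
    ∃ g : (Fin m → k) ≃ₗ[k] ∀ s, CyclicMod (q s), ∀ u, g (M.mulVec u) = (X : k[X]) • g u := by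
  classical
  have hne : ∀ (S : Finset (Fin l)) (s : Fin m), ∏ i ∈ S, (X - C (lam i)) ^ a i s ≠ 0 :=
    fun S s => Finset.prod_ne_zero_iff.2 fun i _ => pow_ne_zero _ (X_sub_C_ne_zero _)
  have hfin : ∀ s, Module.Finite k (CyclicMod (q s)) := fun s =>
    finite_cyclicMod (hq s ▸ hne _ s)
  refine exists_intertwine_module M (∀ s, CyclicMod (q s)) fun d p => ?_
  rw [nullityAt_pi]
  by_cases hd : ∃ i, lam i = d
  · obtain ⟨i, rfl⟩ := hd
    refine Eq.trans ?_ ((h.2.1 i).1.rank_add p)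
    rw [Finset.sum_range]
    congr 1
    refine Finset.sum_congr rfl fun s _ => ?_
    refine nullityAt_cyclicMod_X_sub_C_pow
      (s := ∏ j ∈ Finset.univ.erase i, (X - C (lam j)) ^ a j s) ?_ ?_ (hne _ s) p
    · rw [hq, Finset.mul_prod_erase _ (fun i => (X - C (lam i)) ^ a i s) (Finset.mem_univ i)]
    · refine IsCoprime.prod_right fun j hj => ?_
      have : lam i ≠ lam j := fun h' => (Finset.mem_erase.1 hj).1 (h.1 h').symm
      simpa using isCoprime_X_sub_C_pow this 1 (a j s)
  · rw [h.rank_eq_of_not_exists hd, Finset.sum_eq_zero, add_zero]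
    intro s _
    rw [nullityAt_cyclicMod_X_sub_C_pow (c := d) (n := 0) (s := q s) (by simp) ?_
      (hq s ▸ hne _ s) p, Nat.zero_min]
    rw [hq]
    refine IsCoprime.prod_right fun j _ => ?_
    have : d ≠ lam j := fun h' => hd ⟨j, h'.symm⟩
    simpa using isCoprime_X_sub_C_pow this 1 (a j s)

/-- The nilpotent matrix with Jordan blocks of sizes `b`. -/
lemma isJordanTypeAt_companion_zero {b : ℕ → ℕ} (hb : IsPartitionOf b m)
    (ε : (Σ s : Fin m, Fin (b s)) ≃ Fin m) :
    IsJordanTypeAt (companion (R := k) (fun s : Fin m => b s) ε 0) 0 b := by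
  have hne : ∀ s : Fin m, (X : k[X]) ^ b s ≠ 0 := fun s => pow_ne_zero _ X_ne_zero
  have hfin : ∀ s : Fin m, Module.Finite k (CyclicMod ((X : k[X]) ^ b s)) := fun s =>
    finite_cyclicMod (hne s)
  have hrank : Module.finrank k (∀ s : Fin m, CyclicMod ((X : k[X]) ^ b s)) = m := by
    rw [Module.finrank_pi_fintype]
    simp only [finrank_quotient_span_eq_natDegree, natDegree_X_pow]
    rw [← Finset.sum_range fun s => b s]
    exact hb.sum_eq le_rfl
  obtain ⟨h, hh⟩ := exists_equiv_companion (fun s : Fin m => b s) ε hrank one_ne_zero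
    (cyclicGen fun s : Fin m => (X : k[X]) ^ b s)
    (span_cyclicGen_eq_top _ fun s => Submodule.subset_span (Set.mem_range_self s)) 0 (by
      intro s
      rw [C_1, one_mul]
      refine (smul_cyclicGen_self (fun s : Fin m => (X : k[X]) ^ b s) s).trans ?_
      exact (Finset.sum_eq_zero fun _ _ => zero_smul _ _).symm)
  simp only [C_1, one_mul] at hh
  refine isJordanTypeAt_of_rank_add hb le_rfl fun p => ?_
  have h1 := rank_aeval_add_nullityAt h (fun u => (hh u).symm) ((X - C 0) ^ p)
  rw [aeval_X_sub_C_pow, nullityAt_pi] at h1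
  rw [Finset.sum_range]
  refine Eq.trans ?_ h1
  congr 1
  refine Finset.sum_congr rfl fun s _ => ?_
  exact (nullityAt_cyclicMod_X_sub_C_pow (s := 1) (by simp) isCoprime_one_right one_ne_zero p).symm

lemma exists_equiv_sigma {b : ℕ → ℕ} (hb : IsPartitionOf b m) :
    Nonempty ((Σ s : Fin m, Fin (b s)) ≃ Fin m) := by
  refine ⟨Fintype.equivFinOfCardEq ?_⟩
  rw [Fintype.card_sigma]
  simp only [Fintype.card_fin]
  rw [← Finset.sum_range fun s => b s]
  exact hb.sum_eq le_rfl

lemma IsJordanTypeAt.isFullSpecter {a : ℕ → ℕ} (h : IsJordanTypeAt M 0 a) (ha : IsPartitionOf a m)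
    (hm : 1 ≤ m) : IsFullSpecter M (fun _ : Fin 1 => 0) (fun _ => a) := by
  classical
  refine ⟨fun _ _ _ => Subsingleton.elim _ _, fun _ => ⟨h, fun h0 => ?_⟩, ?_⟩
  · have h1 := ha.sum_eq le_rfl
    rw [Finset.sum_eq_zero fun t _ => Nat.le_zero.1 (h0 ▸ ha.1 0 t (Nat.zero_le _))] at h1
    omega
  · rintro d ⟨v, hv, hd⟩
    obtain ⟨n, c, e, he, hm', hr, -⟩ := _root_.exists_block_data M
    have hej : ∀ j, e j ≤ m := fun j => by
      rw [← hm']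
      exact Finset.single_le_sum (f := e) (fun _ _ => Nat.zero_le _) (Finset.mem_univ j)
    have h1 := hr 0 m
    have h2 := h.rank_add m
    simp only [min_eq_left (h.le _), min_eq_left (hej _)] at h1 h2
    rw [ha.sum_eq le_rfl] at h2
    have h3 : ∑ j, (if c j = 0 then e j else 0) = ∑ j, e j := by omega
    have h4 := (Finset.sum_eq_sum_iff_of_le fun j _ => by split_ifs <;> omega).1 h3
    have h5 := hr d 1
    have h6 := rank_lt_of_eigenvector hv hd
    rw [pow_one] at h5
    have h7 : ∃ j, c j = d := by
      by_contra hn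
      push Not at hn
      rw [Finset.sum_eq_zero fun j _ => if_neg (hn j)] at h5
      omega
    obtain ⟨j, rfl⟩ := h7
    refine ⟨0, ?_⟩
    by_contra hj
    have := h4 j (Finset.mem_univ j)
    rw [if_neg (Ne.symm hj)] at this
    exact he j this.symm

end degenerations

section degenerations

open Polynomial

section generators

variable {k : Type*} [Field k] {m : ℕ} {W : Type*} [AddCommGroup W] [Module k W] [Module k[X] W]
  [IsScalarTower k k[X] W] {M : Matrix (Fin m) (Fin m) k}

lemma tstr_companion_move_mem_orbit {a b : ℕ → ℕ} {v : Fin m → W}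
    (hspan : ∀ S : Submodule k[X] W, (∀ s, v s ∈ S) → S = ⊤)
    (hself : ∀ s : Fin m, (X : k[X]) ^ a s • v s = 0)
    (g : (Fin m → k) ≃ₗ[k] W) (hg : ∀ u, g (M.mulVec u) = (X : k[X]) • g u)
    {i j : Fin m} (hij : i ≠ j) (hbi : b i + 1 = a i)
    (hbj : b j = a j + 1) (hbo : ∀ s, s ≠ i → s ≠ j → b s = a s) (hab : b j ≤ b i)
    (ε : (Σ s : Fin m, Fin (b s)) ≃ Fin m) {t : k} (ht : t ≠ 0) (x₀ : Σ s : Fin m, Fin (b s))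
    (hx₁ : x₀.1 = j) (hx₂ : (x₀.2 : ℕ) = a j) :
    Tstr 0 (companion (fun s : Fin m => b s) ε fun x s => if s = i ∧ x = x₀ then t else 0) ∈
      orbit (Tstr 0 M) := by
  classical
  have hrank : Module.finrank k W = m := by rw [← g.finrank_eq, Module.finrank_fin_fun]
  set w : Fin m → W := fun s =>
    if s = i then C t • v i
    else if s = j then v j + (X : k[X]) ^ (b i - a j) • v i
    else v s with hw
  have hwi : w i = C t • v i := if_pos rfl
  have hwj : w j = v j + (X : k[X]) ^ (b i - a j) • v i := by
    rw [hw]; dsimp only; rw [if_neg hij.symm, if_pos rfl]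
  have hwo : ∀ s, s ≠ i → s ≠ j → w s = v s := fun s h1 h2 => by
    rw [hw]; dsimp only; rw [if_neg h1, if_neg h2]
  have hspan' : Submodule.span k[X] (Set.range w) = ⊤ := by
    have hmem : ∀ s, w s ∈ Submodule.span k[X] (Set.range w) := fun s =>
      Submodule.subset_span (Set.mem_range_self s)
    have hi : v i ∈ Submodule.span k[X] (Set.range w) := by
      have := Submodule.smul_mem _ (C t⁻¹) (hmem i)
      rwa [hwi, smul_smul, ← C_mul, inv_mul_cancel₀ ht, C_1, one_smul] at this
    refine hspan _ fun s => ?_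
    by_cases h1 : s = i
    · rwa [h1]
    by_cases h2 : s = j
    · have := Submodule.sub_mem _ (hmem j) (Submodule.smul_mem _ ((X : k[X]) ^ (b i - a j)) hi)
      rwa [hwj, add_sub_cancel_right, ← h2] at this
    · rw [← hwo s h1 h2]
      exact hmem s
  obtain ⟨e, he⟩ := exists_equiv_companion (fun s : Fin m => b s) ε hrank one_ne_zero w hspan'
    (fun x s => if s = i ∧ x = x₀ then t else 0) (by
      intro s
      simp only [C_1, one_mul, ite_smul, zero_smul]
      by_cases h1 : s = i
      · subst h1
        simp only [true_and, Finset.sum_ite_eq', Finset.mem_univ, if_true]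
        rw [hwi]
        rw [hx₂, congrArg w hx₁, hwj, smul_add, hself, zero_add, smul_smul ((X : k[X]) ^ a j), ← pow_add,
          show (a j : ℕ) + (b s - a j) = b s by omega, smul_comm, ← algebraMap_smul k[X] t, algebraMap_eq]
      · simp only [h1, false_and, if_false, Finset.sum_const_zero]
        by_cases h2 : s = j
        · rw [h2, hwj, smul_add, hbj, pow_succ', mul_smul, hself, smul_zero, zero_add, smul_smul,
            mul_assoc, ← pow_add, show (a j : ℕ) + (b i - a j) = b i by omega, ← pow_succ', hbi,
            hself]
        · rw [hwo s h1 h2, hbo s h1 h2, hself])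
  simp only [C_1, one_mul] at he
  have := tstr_mem_orbit_of_conj (r := 0) (M := M)
    (X := companion (fun s : Fin m => b s) ε fun x s => if s = i ∧ x = x₀ then t else 0)
    (one_ne_zero (α := k)) (g.trans e.symm) fun u => by
      rw [one_smul, LinearEquiv.trans_apply, LinearEquiv.trans_apply, hg,
        LinearEquiv.eq_symm_apply, ← he, LinearEquiv.apply_symm_apply]
  rwa [mul_zero] at this

lemma tstr_companion_scale_mem_orbit (r : k) {P : Fin m → ℕ} {q : Fin m → k[X]} {v : Fin m → W}
    (hspan : ∀ S : Submodule k[X] W, (∀ s, v s ∈ S) → S = ⊤)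
    (hmonic : ∀ s, (q s).Monic) (hdeg : ∀ s, (q s).natDegree = P s) (hself : ∀ s, q s • v s = 0)
    (g : (Fin m → k) ≃ₗ[k] W) (hg : ∀ u, g (M.mulVec u) = (X : k[X]) • g u)
    (ε : (Σ s : Fin m, Fin (P s)) ≃ Fin m) {t : k} (ht : t ≠ 0) :
    Tstr (t * r) (companion P ε fun x s =>
      if x.1 = s then -((q s).coeff x.2 * t ^ (P s - x.2)) else 0) ∈ orbit (Tstr r M) := by
  classical
  have hrank : Module.finrank k W = m := by rw [← g.finrank_eq, Module.finrank_fin_fun]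
  obtain ⟨e, he⟩ := exists_equiv_companion P ε hrank ht v
    (hspan _ fun s => Submodule.subset_span (Set.mem_range_self s))
    (fun x s => if x.1 = s then -((q s).coeff x.2 * t ^ (P s - x.2)) else 0) (by
      intro s
      rw [Fintype.sum_sigma, Finset.sum_eq_single s]
      · simp only [if_true]
        have h1 : q s = X ^ P s + ∑ i ∈ Finset.range (P s), C ((q s).coeff i) * X ^ i := by
          rw [← hdeg s]; exact (hmonic s).as_sum
        have h2 : (C t * X) ^ P s - ∑ i : Fin (P s), C (-((q s).coeff i * t ^ (P s - i))) *
            (C t * X) ^ (i : ℕ) = C (t ^ P s) * q s := by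
          conv_rhs => rw [h1]
          rw [Finset.sum_range, mul_add, Finset.mul_sum, mul_pow, ← C_pow, sub_eq_add_neg,
            ← Finset.sum_neg_distrib]
          congr 1
          refine Finset.sum_congr rfl fun i _ => ?_
          have : t ^ P s = t ^ (P s - i) * t ^ (i : ℕ) := by
            rw [← pow_add, Nat.sub_add_cancel i.2.le]
          rw [this, mul_pow]
          simp only [C_neg, C_mul, C_pow]
          ring
        rw [← sub_eq_zero]
        have h3 : ((C t * X) ^ P s - ∑ i : Fin (P s), C (-((q s).coeff i * t ^ (P s - i))) *
            (C t * X) ^ (i : ℕ)) • v s = 0 := by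
          rw [h2, mul_smul, hself, smul_zero]
        rw [sub_smul, Finset.sum_smul] at h3
        refine Eq.trans ?_ h3
        congr 1
        refine Finset.sum_congr rfl fun i _ => ?_
        rw [mul_smul, ← algebraMap_smul k[X] (-((q s).coeff i * t ^ (P s - i))),
          algebraMap_eq]
      · intro s' _ hs'
        simp only [hs', if_false, zero_smul, Finset.sum_const_zero]
      · simp)
  exact tstr_mem_orbit_of_conj (r := r) (M := M)
    (X := companion P ε fun x s => if x.1 = s then -((q s).coeff x.2 * t ^ (P s - x.2)) else 0)
    ht (g.trans e.symm) fun u => by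
      rw [map_smul, LinearEquiv.trans_apply, LinearEquiv.trans_apply, hg, ← map_smul,
        LinearEquiv.eq_symm_apply, ← he, LinearEquiv.apply_symm_apply, mul_smul,
        ← algebraMap_smul k[X] t, algebraMap_eq]

end generators

variable {k : Type*} [Field k] [IsAlgClosed k] {m l : ℕ} {M : Matrix (Fin m) (Fin m) k}

/-- Moving a box down the Jordan type of a nilpotent matrix is a degeneration. -/
lemma IsJordanTypeAt.degenerates_of_move {a b : ℕ → ℕ} (h : IsJordanTypeAt M 0 a)
    (ha : IsPartitionOf a m) (hm : 1 ≤ m) {i j : Fin m} (hij : i ≠ j) (hbi : b i + 1 = a i)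
    (hbj : b j = a j + 1) (hbo : ∀ s, s ≠ i → s ≠ j → b s = a s) (hab : b j ≤ b i)
    (ε : (Σ s : Fin m, Fin (b s)) ≃ Fin m) :
    degenerates (Tstr 0 M) (Tstr 0 (companion (fun s : Fin m => b s) ε 0)) := by
  classical
  set q : Fin m → k[X] := fun s => X ^ a s with hq
  obtain ⟨g, hg⟩ := (h.isFullSpecter ha hm).exists_equiv q fun s => by simp [hq]
  set x₀ : Σ s : Fin m, Fin (b s) := ⟨j, ⟨a j, by omega⟩⟩ with hx₀
  have key := degenerates_tstr_of_curve (r := 0) (M := M) 0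
    (companion (fun s : Fin m => b s) ε fun x s => if s = i ∧ x = x₀ then (X : k[X]) else 0) ?_
  · rw [companion_map] at key
    convert key using 3
    · simp
    · funext x s
      split_ifs <;> simp
  intro t ht
  have hc := tstr_companion_move_mem_orbit (v := cyclicGen q) (fun S => span_cyclicGen_eq_top q)
    (fun s => smul_cyclicGen_self q s) g hg hij hbi hbj hbo hab ε ht x₀ rfl rfl
  rw [companion_map]
  convert hc using 1
  congr 1
  · simp
  · congr 1
    funext x s
    split_ifs <;> simp

/-- Every `Tstr r M` degenerates to the nilpotent structure of type the sum of the full specter. -/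
lemma IsFullSpecter.degenerates_nilpotent {lam : Fin l → k} {a : Fin l → ℕ → ℕ} (r : k)
    (h : IsFullSpecter M lam a)
    (ε : (Σ s : Fin m, Fin (∑ i, a i s)) ≃ Fin m) :
    degenerates (Tstr r M) (Tstr 0 (companion (fun s : Fin m => ∑ i, a i s) ε 0)) := by
  classical
  set P : Fin m → ℕ := fun s => ∑ i, a i s with hP
  set q : Fin m → k[X] := fun s => ∏ i, (X - C (lam i)) ^ a i s with hq
  have hmonic : ∀ s, (q s).Monic := fun s =>
    monic_prod_of_monic _ _ fun i _ => (monic_X_sub_C _).pow _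
  have hdeg : ∀ s, (q s).natDegree = P s := fun s => by
    rw [hq]
    dsimp only
    rw [natDegree_prod_of_monic _ _ fun i _ => (monic_X_sub_C _).pow _]
    simp [hP]
  obtain ⟨g, hg⟩ := h.exists_equiv q fun s => rfl
  have key := degenerates_tstr_of_curve (r := r) (M := M) (X * C r)
    (companion P ε fun x s =>
      if x.1 = s then -(C ((q s).coeff x.2) * X ^ (P s - x.2)) else 0) ?_
  · rw [companion_map] at key
    convert key using 3
    · simp
    · funext x s
      split_ifs with hx
      · have h1 : (x.2 : ℕ) < P x.1 := x.2.2
        subst hx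
        simp [Nat.sub_ne_zero_of_lt h1]
      · simp
  intro t ht
  have hc := tstr_companion_scale_mem_orbit r (v := cyclicGen q)
    (fun S => span_cyclicGen_eq_top q) hmonic hdeg (fun s => smul_cyclicGen_self q s) g hg ε ht
  rw [companion_map]
  convert hc using 1
  congr 1
  · rw [eval_mul, eval_X, eval_C]
  · congr 1
    funext x s
    split_ifs <;> simp

end degenerations

/-! ### Box moves in the dominance order -/

section dominance

/-- Move a box from row `i` to row `j`. -/
def moveBox (a : ℕ → ℕ) (i j : ℕ) (s : ℕ) : ℕ :=
  if s = i then a i - 1 else if s = j then a j + 1 else a s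

lemma sum_moveBox {a : ℕ → ℕ} {i j : ℕ} (hij : i ≠ j) (hi : a i ≠ 0) (n : ℕ) :
    ∑ s ∈ Finset.range n, moveBox a i j s + (if i < n then 1 else 0) =
      ∑ s ∈ Finset.range n, a s + (if j < n then 1 else 0) := by
  induction n with
  | zero => simp
  | succ n ih =>
    rw [Finset.sum_range_succ, Finset.sum_range_succ]
    have : moveBox a i j n + (if i = n then 1 else 0) = a n + (if j = n then 1 else 0) := by
      unfold moveBox
      split_ifs <;> subst_vars <;> omega
    split_ifs at * <;> omega

lemma exists_moveBox {N : ℕ} {a b : ℕ → ℕ} (ha : IsPartitionOf a N) (hb : IsPartitionOf b N)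
    (hab : Dominates a b) (hne : a ≠ b) :
    ∃ i j, i < j ∧ j < N ∧ a i ≠ 0 ∧ a j + 1 ≤ a i - 1 ∧ IsPartitionOf (moveBox a i j) N ∧
      Dominates (moveBox a i j) b := by
  classical
  have hex : ∃ j, a j < b j := by
    by_contra hn
    push Not at hn
    refine hne (hab.antisymm fun n => Finset.sum_le_sum fun s _ => ?_)
    by_contra hs
    push Not at hs
    have h1 := ha.sum_eq (n := N + s + 1) (by omega)
    have h2 := hb.sum_eq (n := N + s + 1) (by omega)
    have h3 : ∑ t ∈ Finset.range (N + s + 1), b t < ∑ t ∈ Finset.range (N + s + 1), a t :=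
      Finset.sum_lt_sum (fun t _ => hn t) ⟨s, Finset.mem_range.2 (by omega), hs⟩
    omega
  have hj := Nat.find_spec hex
  have hlt : ∀ s < Nat.find hex, b s ≤ a s := fun s hs => not_lt.1 (Nat.find_min hex hs)
  set j := Nat.find hex with hjdef
  have hex' : ∃ i < j, b i < a i := by
    by_contra hn
    push Not at hn
    have h1 := hab (j + 1)
    rw [Finset.sum_range_succ, Finset.sum_range_succ] at h1
    have h2 : ∑ s ∈ Finset.range j, a s ≤ ∑ s ∈ Finset.range j, b s :=
      Finset.sum_le_sum fun s hs => hn s (Finset.mem_range.1 hs)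
    omega
  obtain ⟨i, ⟨hij, hi⟩, hlast⟩ : ∃ i, (i < j ∧ b i < a i) ∧ ∀ s, i < s → s < j → a s = b s := by
    obtain ⟨i₀, hi₀, hi₁⟩ := hex'
    have hP : Nat.findGreatest (fun i => i < j ∧ b i < a i) j < j ∧ _ :=
      Nat.findGreatest_spec (P := fun i => i < j ∧ b i < a i) hi₀.le ⟨hi₀, hi₁⟩
    refine ⟨_, hP, fun s h1 h2 => ?_⟩
    have h3 := Nat.findGreatest_is_greatest h1 h2.le
    have h4 := hlt s h2
    by_contra h5
    exact h3 ⟨h2, by omega⟩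
  have hbij := hb.1 i j hij.le
  have h1 : ∀ t, i < t → a t + 1 ≤ a i := fun t ht => by
    rcases lt_or_ge t j with htj | htj
    · have := hlast t ht htj
      have := hb.1 i t ht.le
      omega
    · have := ha.1 j t htj
      omega
  have h2 : ∀ s, s < j → a j + 1 ≤ a s := fun s hs => by
    rcases le_or_gt s i with hsi | hsi
    · have := ha.1 s i hsi
      omega
    · have := hlast s hsi hs
      have := hb.1 s j hs.le
      omega
  have hjN : j < N := by
    by_contra hn
    have := hb.eq_zero (not_lt.1 hn)
    omega
  refine ⟨i, j, hij, hjN, by omega, by omega, ?_, ?_⟩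
  · refine isPartitionOf_of_sum (n := N) ?_ ?_ ?_
    · intro s t hst
      have h3 := ha.1 s t hst
      have h4 := h1 t
      have h5 := h2 s
      have h6 := h1 j hij
      unfold moveBox
      split_ifs <;> subst_vars <;> omega
    · intro s hs
      have := ha.eq_zero hs
      unfold moveBox
      rw [if_neg (by omega), if_neg (by omega), this]
    · have h3 := sum_moveBox (a := a) hij.ne (by omega) N
      rw [if_pos (by omega), if_pos hjN, ha.sum_eq le_rfl] at h3
      omega
  · intro n
    have h3 := sum_moveBox (a := a) hij.ne (by omega) n
    have h4 := hab n
    by_cases h5 : i < n ∧ n ≤ j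
    · have h6 : ∑ s ∈ Finset.range n, b s < ∑ s ∈ Finset.range n, a s :=
        Finset.sum_lt_sum (fun s hs => hlt s (by have := Finset.mem_range.1 hs; omega))
          ⟨i, Finset.mem_range.2 h5.1, hi⟩
      split_ifs at h3 <;> omega
    · split_ifs at h3 <;> omega

lemma Dominates.sum {l : ℕ} {a b : Fin l → ℕ → ℕ} (h : ∀ i, Dominates (a i) (b i)) :
    Dominates (fun t => ∑ i, a i t) fun t => ∑ i, b i t := by
  intro n
  rw [Finset.sum_comm, Finset.sum_comm (s := Finset.range n)]
  exact Finset.sum_le_sum fun i _ => h i n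

lemma eq_of_dominates_of_sum_eq {l : ℕ} {a b : Fin l → ℕ → ℕ} (h : ∀ i, Dominates (a i) (b i))
    (hs : (fun t => ∑ i, a i t) = fun t => ∑ i, b i t) : a = b := by
  funext i
  refine (h i).antisymm fun n => ?_
  have h1 : ∑ i, ∑ t ∈ Finset.range n, b i t = ∑ i, ∑ t ∈ Finset.range n, a i t := by
    rw [Finset.sum_comm, Finset.sum_comm (s := Finset.univ)]
    exact Finset.sum_congr rfl fun t _ => (congrFun hs t).symm
  exact ((Finset.sum_eq_sum_iff_of_le fun i _ => h i n).1 h1 i (Finset.mem_univ i)).ge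

end dominance

section degenerations

variable {k : Type*} [Field k] [IsAlgClosed k] {m l : ℕ} {M X : Matrix (Fin m) (Fin m) k}
  {lam : Fin l → k} {a : Fin l → ℕ → ℕ}

lemma IsFullSpecter.mem_orbit (h : IsFullSpecter M lam a) (hX : IsFullSpecter X lam a) (r : k) :
    Tstr r X ∈ orbit (Tstr r M) := by
  obtain ⟨e, he⟩ := exists_intertwine fun d p => h.rank_eq hX d p
  have := tstr_mem_orbit_of_conj (r := r) (M := M) (X := X) (one_ne_zero (α := k)) e fun u => by
    rw [one_smul, he]
  rwa [one_mul] at this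

lemma IsJordanTypeAt.mem_orbit {a : ℕ → ℕ} (h : IsJordanTypeAt M 0 a) (hX : IsJordanTypeAt X 0 a)
    (ha : IsPartitionOf a m) (hm : 1 ≤ m) (r : k) : Tstr r X ∈ orbit (Tstr r M) :=
  (h.isFullSpecter ha hm).mem_orbit (hX.isFullSpecter ha hm) r

lemma IsJordanTypeAt.degenerates_of_dominates {a b : ℕ → ℕ} (h : IsJordanTypeAt M 0 a)
    (hX : IsJordanTypeAt X 0 b) (ha : IsPartitionOf a m) (hb : IsPartitionOf b m) (hm : 1 ≤ m)
    (hab : Dominates a b) : degenerates (Tstr 0 M) (Tstr 0 X) := by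
  induction hn : ∑ n ∈ Finset.range (m + 1), ∑ s ∈ Finset.range n, a s using
    Nat.strong_induction_on generalizing M a with
  | _ n ih =>
  by_cases hne : a = b
  · subst hne
    exact degenerates_of_mem_orbit (h.mem_orbit hX ha hm 0)
  obtain ⟨i, j, hij, hj, hi, hle, hp, hd⟩ := exists_moveBox ha hb hab hne
  obtain ⟨ε⟩ := exists_equiv_sigma hp
  have hvi : moveBox a i j i = a i - 1 := if_pos rfl
  have hvj : moveBox a i j j = a j + 1 := by rw [moveBox, if_neg hij.ne', if_pos rfl]
  refine degenerates_trans (h.degenerates_of_move ha hm (i := ⟨i, by omega⟩) (j := ⟨j, hj⟩)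
    (b := moveBox a i j) ?_ ?_ hvj ?_ ?_ ε)
    (ih _ ?_ (isJordanTypeAt_companion_zero hp ε) hp hd rfl)
  · exact fun h' => hij.ne (Fin.mk.inj_iff.1 h')
  · dsimp only
    omega
  · intro s h1 h2
    rw [moveBox, if_neg fun h' => h1 (Fin.ext h'), if_neg fun h' => h2 (Fin.ext h')]
  · dsimp only
    omega
  · rw [← hn]
    refine Finset.sum_lt_sum (fun n _ => ?_) ⟨i + 1, Finset.mem_range.2 (by omega), ?_⟩
    · have := sum_moveBox (a := a) hij.ne hi n
      split_ifs at this <;> omega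
    · have := sum_moveBox (a := a) hij.ne hi (i + 1)
      rw [if_pos (by omega), if_neg (by omega)] at this
      omega

end degenerations

/-! ### Chains of degenerations and chains of partitions -/

section chains

lemma hasChain_zero {n : ℕ} (μ : AlgStr k n) : hasChain μ 0 :=
  ⟨fun _ => μ, rfl, fun i hi => absurd hi (Nat.not_lt_zero i)⟩

lemma hasChain_succ_iff {n : ℕ} {μ : AlgStr k n} {j : ℕ} :
    hasChain μ (j + 1) ↔ ∃ χ, properlyDegenerates μ χ ∧ hasChain χ j := by
  constructor
  · rintro ⟨c, rfl, hc⟩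
    exact ⟨c j, hc j j.lt_succ_self, c, rfl, fun i hi => hc i (hi.trans j.lt_succ_self)⟩
  · rintro ⟨χ, hχ, c, rfl, hc⟩
    refine ⟨Function.update c (j + 1) μ, Function.update_self .., fun i hi => ?_⟩
    rw [Function.update_of_ne hi.ne]
    rcases Nat.lt_succ_iff_lt_or_eq.1 hi with hi | rfl
    · rw [Function.update_of_ne (by omega)]
      exact hc i hi
    · rwa [Function.update_self]

lemma hasChain_of_mem_orbit {n : ℕ} {μ χ : AlgStr k n} {j : ℕ} (h : χ ∈ orbit μ)
    (hμ : hasChain μ j) : hasChain χ j := by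
  cases j with
  | zero => exact hasChain_zero χ
  | succ j =>
    obtain ⟨ν, hν, hc⟩ := hasChain_succ_iff.1 hμ
    refine hasChain_succ_iff.2 ⟨ν, ?_, hc⟩
    rwa [properlyDegenerates, degenerates, orbit_eq_of_mem h]

lemma partChain_zero_iff {a : ℕ → ℕ} {N : ℕ} : partChain a N 0 ↔ IsPartitionOf a N := by
  constructor
  · rintro ⟨c, hc, rfl, -⟩
    exact hc 0 le_rfl
  · exact fun h => ⟨fun _ => a, fun _ _ => h, rfl, fun i hi => absurd hi (Nat.not_lt_zero i)⟩

lemma partChain.isPartitionOf {a : ℕ → ℕ} {N j : ℕ} (h : partChain a N j) : IsPartitionOf a N := by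
  obtain ⟨c, hc, rfl, -⟩ := h
  exact hc j le_rfl

lemma partChain_succ_iff {a : ℕ → ℕ} {N j : ℕ} (ha : IsPartitionOf a N) :
    partChain a N (j + 1) ↔ ∃ b, Dominates a b ∧ a ≠ b ∧ partChain b N j := by
  constructor
  · rintro ⟨c, hp, rfl, hc⟩
    exact ⟨c j, (hc j j.lt_succ_self).1, (hc j j.lt_succ_self).2, c,
      fun i hi => hp i (hi.trans j.le_succ), rfl, fun i hi => hc i (hi.trans j.lt_succ_self)⟩
  · rintro ⟨b, hab, hne, c, hp, rfl, hc⟩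
    refine ⟨Function.update c (j + 1) a, fun i hi => ?_, Function.update_self .., fun i hi => ?_⟩
    · rcases Nat.le_succ_iff.1 hi with hi | rfl
      · rw [Function.update_of_ne (by omega)]
        exact hp i hi
      · rwa [Function.update_self]
    · rw [Function.update_of_ne hi.ne]
      rcases Nat.lt_succ_iff_lt_or_eq.1 hi with hi | rfl
      · rw [Function.update_of_ne (by omega)]
        exact hc i hi
      · rw [Function.update_self]
        exact ⟨hab, hne⟩

lemma partChain.of_dominates {a b : ℕ → ℕ} {N j : ℕ} (ha : IsPartitionOf a N) (hab : Dominates a b)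
    (h : partChain b N j) : partChain a N j := by
  cases j with
  | zero => exact partChain_zero_iff.2 ha
  | succ j =>
    obtain ⟨b', hb, hne, hc⟩ := (partChain_succ_iff h.isPartitionOf).1 h
    refine (partChain_succ_iff ha).2 ⟨b', hab.trans hb, ?_, hc⟩
    rintro rfl
    exact hne (hb.antisymm hab)

end chains

section levels

open Polynomial

lemma rank_smul_of_ne_zero {m : ℕ} {c : k} (hc : c ≠ 0) (A : Matrix (Fin m) (Fin m) k) :
    (c • A).rank = A.rank :=
  Matrix.rank_smul_of_mem_nonZeroDivisors A (mem_nonZeroDivisors_of_ne_zero hc)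

variable {k : Type*} [Field k] [IsAlgClosed k] {m l : ℕ} {M : Matrix (Fin m) (Fin m) k}
  {lam : Fin l → k} {a : Fin l → ℕ → ℕ}

lemma IsJordanTypeAt.exists_of_degenerates {a : ℕ → ℕ} (h : IsJordanTypeAt M 0 a)
    (ha : IsPartitionOf a m) (hm : 1 ≤ m) {χ : AlgStr k (m + 1)} (hχ : degenerates (Tstr 0 M) χ) :
    ∃ X b, IsJordanTypeAt X 0 b ∧ IsPartitionOf b m ∧ Dominates a b ∧ χ ∈ orbit (Tstr 0 X) := by
  obtain ⟨α, X, hX⟩ := exists_mem_orbit_tstr hχ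
  have hd := degenerates_trans hχ (degenerates_of_mem_orbit (orbit_symm hX))
  obtain rfl := eq_zero_of_degenerates hd
  have : Infinite k := IsAlgClosed.instInfinite
  obtain ⟨b, hb, hab⟩ := (h.isFullSpecter ha hm).exists_of_rank_le (X := X) fun _ p => by
    simpa using rank_pow_le_of_degenerates hd p
  exact ⟨X, b 0, (hb.2.1 0).1, by simpa using hb.isPartitionOf_sum, hab 0, hX⟩

lemma IsFullSpecter.exists_eigenvector (h : IsFullSpecter M lam a) (i : Fin l) :
    ∃ v, v ≠ 0 ∧ M.mulVec v = lam i • v := by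
  have h1 := (h.2.1 i).1.rank_add 1
  have h0 := (h.2.1 i).2
  have hm : 0 < m := by
    by_contra hm
    exact h0 ((h.2.1 i).1.eq_zero (by omega))
  have h2 := Finset.single_le_sum (f := fun t => min (a i t) 1) (fun _ _ => Nat.zero_le _)
    (Finset.mem_range.2 hm)
  rw [pow_one] at h1
  exact exists_eigenvector_of_rank_lt (by omega)

lemma IsFullSpecter.det_sub_eq_zero (h : IsFullSpecter M lam a) (i : Fin l) :
    (M - Matrix.scalar (Fin m) (lam i)).det = 0 := by
  obtain ⟨v, hv, hv'⟩ := h.exists_eigenvector i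
  refine Matrix.exists_mulVec_eq_zero_iff.1 ⟨v, hv, ?_⟩
  have : Matrix.scalar (Fin m) (lam i) = lam i • (1 : Matrix (Fin m) (Fin m) k) := by
    rw [Matrix.smul_one_eq_diagonal]
    rfl
  rw [this, Matrix.sub_mulVec, Matrix.smul_mulVec, Matrix.one_mulVec, hv', sub_self]

/-- The degenerations of `Tstr r M` are nilpotent or share the full specter's eigenvalues. -/
lemma IsFullSpecter.exists_of_degenerates {r : k} (h : IsFullSpecter M lam a)
    (hr : r = 1 ∨ ∃ i, lam i ≠ 0) {χ : AlgStr k (m + 1)} (hχ : degenerates (Tstr r M) χ) :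
    (∃ X b, IsJordanTypeAt X 0 b ∧ IsPartitionOf b m ∧ Dominates (fun t => ∑ i, a i t) b ∧
      χ ∈ orbit (Tstr 0 X)) ∨
    ∃ X a', IsFullSpecter X lam a' ∧ (∀ i, Dominates (a i) (a' i)) ∧ χ ∈ orbit (Tstr r X) := by
  classical
  obtain ⟨α, X, hX⟩ := exists_mem_orbit_tstr hχ
  have hd := degenerates_trans hχ (degenerates_of_mem_orbit (orbit_symm hX))
  obtain ⟨s, rfl, hs⟩ := exists_scalar_of_degenerates lam
    (hr.imp id fun ⟨i, hi⟩ => ⟨i, hi, h.det_sub_eq_zero i⟩) hd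
  by_cases h0 : s = 0
  · subst h0
    left
    obtain ⟨b, hb, hbm, hab⟩ := h.exists_nilpotent hs
    rw [mul_zero] at hX
    exact ⟨X, b, hb, hbm, hab, hX⟩
  right
  have hprod : ∀ i p c, scaledProd lam (Pi.single i p) c = (Polynomial.X - C (c * lam i)) ^ p := by
    intro i p c
    rw [scaledProd, Finset.prod_eq_single i (fun j _ hj => by rw [Pi.single_eq_of_ne hj, pow_zero])
      (by simp), Pi.single_eq_same]
  obtain ⟨a', ha', hdom⟩ := h.exists_of_rank_le (X := s⁻¹ • X) fun i p => by
    have h1 := hs (Pi.single i p)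
    rw [hprod, hprod, aeval_X_sub_C_pow, aeval_X_sub_C_pow, one_mul] at h1
    have h2 : X - (s * lam i) • (1 : Matrix (Fin m) (Fin m) k) =
        s • (s⁻¹ • X - lam i • (1 : Matrix (Fin m) (Fin m) k)) := by
      rw [smul_sub, smul_smul, smul_smul, mul_inv_cancel₀ h0, one_smul]
    rwa [h2, _root_.smul_pow, rank_smul_of_ne_zero (pow_ne_zero _ h0)] at h1
  refine ⟨s⁻¹ • X, a', ha', hdom, orbit_trans (orbit_symm ?_) hX⟩
  have := tstr_mem_orbit_of_conj (r := r * s) (M := X) (X := s⁻¹ • X) (inv_ne_zero h0)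
    (LinearEquiv.refl k _) fun u => by
      rw [LinearEquiv.refl_apply, LinearEquiv.refl_apply, Matrix.smul_mulVec]
  rwa [mul_comm r s, inv_mul_cancel_left₀ h0, mul_comm s r] at this

lemma IsJordanTypeAt.eq_of_mem_orbit {X : Matrix (Fin m) (Fin m) k} {a b : ℕ → ℕ}
    (h : IsJordanTypeAt M 0 a) (hX : IsJordanTypeAt X 0 b) (ha : IsPartitionOf a m)
    (hb : IsPartitionOf b m) (ho : Tstr 0 X ∈ orbit (Tstr 0 M)) : a = b := by
  have : Infinite k := IsAlgClosed.instInfinite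
  have key : ∀ {M X : Matrix (Fin m) (Fin m) k} {a b : ℕ → ℕ}, IsJordanTypeAt M 0 a →
      IsJordanTypeAt X 0 b → IsPartitionOf a m → IsPartitionOf b m →
      Tstr 0 X ∈ orbit (Tstr 0 M) → Dominates a b := by
    intro M X a b h hX ha hb ho
    refine dominates_of_sum_min_le ha.1 (fun _ => ha.eq_zero) (fun _ => hb.eq_zero)
      (by rw [ha.sum_eq le_rfl, hb.sum_eq le_rfl]) fun t => ?_
    have h1 := h.rank_add (a t)
    have h2 := hX.rank_add (a t)
    have h3 := rank_pow_le_of_degenerates (degenerates_of_mem_orbit ho) (a t)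
    rw [zero_smul, sub_zero] at h1 h2
    omega
  exact (key h hX ha hb ho).antisymm (key hX h hb ha (orbit_symm ho))

lemma IsJordanTypeAt.hasChain_iff {a : ℕ → ℕ} (h : IsJordanTypeAt M 0 a) (ha : IsPartitionOf a m)
    (hm : 1 ≤ m) (j : ℕ) : hasChain (Tstr 0 M) j ↔ partChain a m j := by
  induction j generalizing M a with
  | zero => exact iff_of_true (hasChain_zero _) (partChain_zero_iff.2 ha)
  | succ j ih =>
    rw [hasChain_succ_iff, partChain_succ_iff ha]
    constructor
    · rintro ⟨χ, ⟨hd, hn⟩, hc⟩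
      obtain ⟨X, b, hb, hbm, hab, hX⟩ := h.exists_of_degenerates ha hm hd
      refine ⟨b, hab, ?_, (ih hb hbm).1 (hasChain_of_mem_orbit (orbit_symm hX) hc)⟩
      rintro rfl
      exact hn (orbit_trans (h.mem_orbit hb ha hm 0) hX)
    · rintro ⟨b, hab, hne, hc⟩
      have hbm := hc.isPartitionOf
      obtain ⟨ε⟩ := exists_equiv_sigma hbm
      have hb := isJordanTypeAt_companion_zero (k := k) hbm ε
      exact ⟨_, ⟨h.degenerates_of_dominates hb ha hbm hm hab,
        fun ho => hne (h.eq_of_mem_orbit hb ha hbm ho)⟩, (ih hb hbm).2 hc⟩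

lemma IsFullSpecter.hasChain_succ_iff {r : k} (h : IsFullSpecter M lam a)
    (hr : r = 1 ∨ ∃ i, lam i ≠ 0) (hm : 1 ≤ m) (j : ℕ) :
    hasChain (Tstr r M) (j + 1) ↔ partChain (fun t => ∑ i, a i t) m j := by
  have hP := h.isPartitionOf_sum
  constructor
  · intro hc
    induction j generalizing M a with
    | zero => exact partChain_zero_iff.2 hP
    | succ j ih =>
      obtain ⟨χ, ⟨hd, hn⟩, hc⟩ := _root_.hasChain_succ_iff.1 hc
      rcases h.exists_of_degenerates hr hd with
        ⟨X, b, hb, hbm, hab, hX⟩ | ⟨X, a', ha', hdom, hX⟩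
      · exact ((hb.hasChain_iff hbm hm _).1 (hasChain_of_mem_orbit (orbit_symm hX) hc)).of_dominates
          hP hab
      · refine (partChain_succ_iff hP).2 ⟨_, Dominates.sum hdom, fun he => ?_,
          ih ha' ha'.isPartitionOf_sum (hasChain_of_mem_orbit (orbit_symm hX) hc)⟩
        obtain rfl := eq_of_dominates_of_sum_eq hdom he
        exact hn (orbit_trans (h.mem_orbit ha' r) hX)
  · intro hc
    obtain ⟨ε⟩ := exists_equiv_sigma hP
    have hb := isJordanTypeAt_companion_zero (k := k) hP ε
    refine _root_.hasChain_succ_iff.2 ⟨_, ⟨h.degenerates_nilpotent r ε, fun ho => ?_⟩,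
      (hb.hasChain_iff hP hm j).2 hc⟩
    have hd := degenerates_of_mem_orbit (orbit_symm ho)
    obtain rfl := eq_zero_of_degenerates hd
    obtain ⟨i, hi⟩ := hr.resolve_left zero_ne_one
    have : Infinite k := IsAlgClosed.instInfinite
    obtain ⟨b, hb', -⟩ := (hb.isFullSpecter hP hm).exists_of_rank_le (X := M) fun _ p => by
      simpa using rank_pow_le_of_degenerates hd p
    obtain ⟨_, h0⟩ := hb'.2.2 (lam i) (h.exists_eigenvector i)
    exact hi h0.symm

end levels

/-! ## STATEMENT 7 -/
theorem stmt7 {k : Type*} [Field k] [IsAlgClosed k] :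
    (∀ m : ℕ, 1 ≤ m → ∀ (M : Matrix (Fin m) (Fin m) k) (a : ℕ → ℕ),
      IsJordanTypeAt M 0 a → IsPartitionOf a m →
      ∀ j : ℕ, levelIs (Tstr (0 : k) M) j ↔ (partChain a m j ∧ ¬ partChain a m (j + 1))) ∧
    (∀ m : ℕ, 1 ≤ m → ∀ r : k, (r = 0 ∨ r = 1) →
      ∀ (l : ℕ) (M : Matrix (Fin m) (Fin m) k) (lam : Fin l → k) (a : Fin l → ℕ → ℕ),
      IsFullSpecter M lam a → (r = 1 ∨ ∃ i, lam i ≠ 0) →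
      ∀ j : ℕ, levelIs (Tstr r M) (j + 1) ↔
        (partChain (fun t => ∑ i, a i t) m j ∧
          ¬ partChain (fun t => ∑ i, a i t) m (j + 1))) := by
  refine ⟨fun m hm M a h ha j => ?_, fun m hm r _ l M lam a h hr j => ?_⟩
  · rw [levelIs, h.hasChain_iff ha hm, h.hasChain_iff ha hm]
  · rw [levelIs, h.hasChain_succ_iff hr hm, h.hasChain_succ_iff hr hm]

end
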